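/- arXiv:2109.09230 — 2 statements merged into one kernel-verified Lean document; each statement's English description precedes it below -/
import Mathlib

section
/- Let F be a differential field of characteristic 0 and let E be a differential field extension of F. Suppose a ∈ E satisfies a′ ≠ 0, a ≠ 0, a ≠ 1728 and the j-equation in the polynomial form 2·a‴·a′·a²·(a − 1728)² − 3·(a″)²·a²·(a − 1728)² + 2·(a′)⁴·(a² − 1968·a + 2654208) = 0. Then either a is algebraic over F, or the three elements a, a′, a″ are algebraically independent over F (equivalently, the transcendence degree of F(a, a′, a″) over F equals 3). -/
open Polynomial

namespace JEq

/-- A sum of three square roots of nonpositive rationals is never a nonzero rational. -/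
lemma rat_aux (A B C X : ℚ) (hA : A ≤ 0) (hB : B ≤ 0) (hC : C ≤ 0) (hX : 0 < X)
    (h : ((X^2 + C - A - B)^2 + 4*X^2*C - 4*A*B)^2 = 16*X^2*(X^2+C-A-B)^2*C) : False := by
  have h1 : ((X^2 + C - A - B)^2 + 4*X^2*C - 4*A*B)^2 = 0 := by
    have : 16*X^2*(X^2+C-A-B)^2*C ≤ 0 := mul_nonpos_of_nonneg_of_nonpos (by positivity) hC
    nlinarith [sq_nonneg ((X^2 + C - A - B)^2 + 4*X^2*C - 4*A*B)]
  have h2 : (X^2 + C - A - B)^2 + 4*X^2*C - 4*A*B = 0 := by simpa using h1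
  rw [h1] at h
  have hX2 : 0 < X^2 := by positivity
  have h3 : X^2+C-A-B = 0 ∨ C = 0 := by
    have := h.symm
    simp only [mul_eq_zero, pow_eq_zero_iff, ne_eq, OfNat.ofNat_ne_zero, not_false_eq_true] at this
    rcases this with ((h|h)|h)|h
    · norm_num at h
    · exact absurd h hX.ne'
    · exact Or.inl h
    · exact Or.inr h
  have hAB : 0 ≤ A * B := mul_nonneg_of_nonpos_of_nonpos hA hB
  have hC0 : C = 0 := by
    rcases h3 with h3 | h3
    · rw [h3] at h2
      by_contra hne
      have : C < 0 := lt_of_le_of_ne hC hne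
      nlinarith [mul_neg_of_pos_of_neg hX2 this]
    · exact h3
  subst hC0
  nlinarith [sq_nonneg (A - B), mul_nonneg hX2.le (neg_nonneg.2 hA), mul_nonneg hX2.le (neg_nonneg.2 hB), mul_pos hX2 hX2]

lemma sqrt_aux {K : Type*} [Field K] [CharZero K] (a b c : K) (A B C X : ℚ)
    (ha : a^2 = A) (hb : b^2 = B) (hc : c^2 = C) (hA : A ≤ 0) (hB : B ≤ 0) (hC : C ≤ 0)
    (hX : 0 < X) (h : a + b + c = X) : False := by
  apply rat_aux A B C X hA hB hC hX
  have : (((((X^2 + C - A - B)^2 + 4*X^2*C - 4*A*B)^2 : ℚ)) : K)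
      = ((16*X^2*(X^2+C-A-B)^2*C : ℚ) : K) := by
    push_cast
    rw [← ha, ← hb, ← hc]
    have e1 : (X:K)^2 + c^2 - a^2 - b^2 = 2*X*c + 2*a*b := by rw [← h]; ring
    have e2 : ((X:K)^2 + c^2 - a^2 - b^2)^2 + 4*X^2*c^2 - 4*a^2*b^2
        = 4*X*c*((X:K)^2 + c^2 - a^2 - b^2) := by rw [e1]; ring
    rw [e2]; ring
  exact_mod_cast this

/-- Polynomial solutions of the first order equation with a quadratic coefficient. -/
lemma quad_aux {K : Type*} [Field K] [CharZero K] (r s : K) (hrs : r ≠ s) (H : K[X]) (hH : H ≠ 0)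
    (α β : K) (h : C (-1/2) * (X - C r) * (X - C s) * derivative H = (C α * X + C β) * H) :
    ∃ a b : ℕ, α = -((a : K) + b)/2 ∧ β = (a * s + b * r)/2 ∧ H.natDegree = a + b := by
  obtain ⟨H1, h1, h1r⟩ := exists_eq_pow_rootMultiplicity_mul_and_not_dvd H hH r
  set a := rootMultiplicity r H
  have hH1 : H1 ≠ 0 := by rintro rfl; simp at h1r
  obtain ⟨H2, h2, h2s⟩ := exists_eq_pow_rootMultiplicity_mul_and_not_dvd H1 hH1 s
  set b := rootMultiplicity s H1
  have hH2 : H2 ≠ 0 := by rintro rfl; simp at h2s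
  have h2r : ¬ (X - C r) ∣ H2 := fun hd => h1r (h2 ▸ hd.mul_left _)
  rw [dvd_iff_isRoot, IsRoot.def] at h2r h2s
  have key : C (-1/2) * (X - C r) * (X - C s) * derivative H2 =
      (C (α + (a+b)/2) * X + C (β - (a*s+b*r)/2)) * H2 := by
    have hne : (X - C r)^a * (X - C s)^b ≠ 0 := mul_ne_zero (pow_ne_zero _ (X_sub_C_ne_zero r)) (pow_ne_zero _ (X_sub_C_ne_zero s))
    apply mul_left_cancel₀ hne
    have hd : ∀ (t : K) (n : ℕ), (X - C t) * derivative ((X - C t)^n) = C (n:K) * (X - C t)^n := by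
      intro t n
      rw [derivative_X_sub_C_pow]
      rcases n with _ | n
      · simp
      · simp [pow_succ]; ring
    have e1 := hd r a
    have e2 := hd s b
    rw [h1, h2] at h
    simp only [derivative_mul] at h
    have hc : (C (-1/2) : K[X]) = - C (1/2) := by rw [← C_neg]; congr 1; ring
    have c1 : (C (α + (a+b)/2) : K[X]) = C α + C (1/2) * (C (a:K) + C (b:K)) := by
      rw [← C_add, ← C_mul, ← C_add]; congr 1; ring
    have c2 : (C (β - (a*s+b*r)/2) : K[X]) = C β - C (1/2) * (C (a:K) * C s + C (b:K) * C r) := by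
      rw [← C_mul, ← C_mul, ← C_add, ← C_mul, ← C_sub]; congr 1; ring
    rw [c1, c2]
    rw [hc] at h ⊢
    linear_combination h + C (1/2) * (X - C s) * (X - C s)^b * H2 * e1 + C (1/2) * (X - C r) * (X - C r)^a * H2 * e2
  have k1 := congrArg (eval r) key
  have k2 := congrArg (eval s) key
  simp only [eval_mul, eval_add, eval_sub, eval_X, eval_C, sub_self, mul_zero, zero_mul] at k1 k2
  have k1' := (mul_eq_zero.1 k1.symm).resolve_right h2r
  have k2' := (mul_eq_zero.1 k2.symm).resolve_right h2s
  have ea : α + (a+b)/2 = 0 := by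
    have : (α + (a+b)/2) * (r - s) = 0 := by linear_combination k1' - k2'
    exact (mul_eq_zero.1 this).resolve_right (sub_ne_zero.2 hrs)
  have eb : β - (a*s+b*r)/2 = 0 := by rw [ea] at k1'; linear_combination k1'
  rw [ea, eb] at key
  have hd0 : derivative H2 = 0 := by
    have : C (-1/2 : K) * (X - C r) * (X - C s) ≠ 0 := by
      refine mul_ne_zero (mul_ne_zero ?_ (X_sub_C_ne_zero r)) (X_sub_C_ne_zero s)
      rw [Ne, C_eq_zero]; norm_num
    simpa [this] using key
  have hdeg : H2.natDegree = 0 := natDegree_eq_zero_of_derivative_eq_zero hd0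
  refine ⟨a, b, by linear_combination ea, by linear_combination eb, ?_⟩
  rw [h1, h2, natDegree_mul (pow_ne_zero _ (X_sub_C_ne_zero r)) (mul_ne_zero (pow_ne_zero _ (X_sub_C_ne_zero s)) hH2),
    natDegree_mul (pow_ne_zero _ (X_sub_C_ne_zero s)) hH2]
  simp [hdeg]

end JEq


open Polynomial

namespace JEq

/-- A derivation of a commutative ring. -/
structure Der (A : Type*) [CommRing A] where
  /-- the underlying additive map -/
  f : A →+ A
  /-- the Leibniz rule -/
  leib : ∀ a b, f (a * b) = a * f b + f a * b

namespace Der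
variable {A : Type*} [CommRing A] (d : Der A)

lemma one : d.f 1 = 0 := by
  have := d.leib 1 1
  simpa using this

lemma natCast (n : ℕ) : d.f (n : A) = 0 := by
  induction n with
  | zero => simp
  | succ n ih => rw [Nat.cast_succ, map_add, ih, d.one, add_zero]

lemma ofNat (n : ℕ) [n.AtLeastTwo] : d.f (OfNat.ofNat n : A) = 0 := d.natCast n

lemma pow_succ (a : A) (n : ℕ) : d.f (a^(n+1)) = (n+1 : ℕ) * a^n * d.f a := by
  induction n with
  | zero => simp
  | succ n ih => rw [_root_.pow_succ a (n+1), d.leib, ih]; push_cast; ring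

lemma sq (a : A) : d.f (a^2) = 2 * a * d.f a := by
  rw [d.pow_succ a 1]; push_cast; ring

end Der

/-- Apply a derivation to all coefficients of a polynomial. -/
noncomputable def mapDer {A : Type*} [CommRing A] (d : Der A) : Der A[X] where
  f :=
    { toFun := fun p => p.sum fun n a => monomial n (d.f a)
      map_zero' := by simp
      map_add' := fun p q => by
        apply sum_add_index <;> simp }
  leib := by
    have hm : ∀ n a, (fun p : A[X] => p.sum fun n a => monomial n (d.f a)) (monomial n a) = monomial n (d.f a) := by
      intro n a
      exact sum_monomial_index a _ (by simp)
    have ha : ∀ p q : A[X], (fun p : A[X] => p.sum fun n a => monomial n (d.f a)) (p + q) =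
      (fun p : A[X] => p.sum fun n a => monomial n (d.f a)) p + (fun p : A[X] => p.sum fun n a => monomial n (d.f a)) q := by
      intro p q
      apply sum_add_index <;> simp
    simp only [AddMonoidHom.coe_mk, ZeroHom.coe_mk]
    simp only at hm ha
    intro p q
    induction p using Polynomial.induction_on' with
    | add p p' h h' => rw [add_mul, ha, ha, h, h']; ring
    | monomial n a =>
      induction q using Polynomial.induction_on' with
      | add q q' h h' => rw [mul_add, ha, ha, h, h']; ring
      | monomial m b =>
        rw [monomial_mul_monomial, hm, hm, hm, d.leib, monomial_mul_monomial, monomial_mul_monomial, map_add]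

@[simp]
lemma coeff_mapDer {A : Type*} [CommRing A] (d : Der A) (p : A[X]) (i : ℕ) :
    ((mapDer d).f p).coeff i = d.f (p.coeff i) := by
  change (p.sum fun n a => monomial n (d.f a)).coeff i = _
  rw [Polynomial.sum_def, finsetSum_coeff]
  simp only [coeff_monomial]
  rw [Finset.sum_ite_eq']
  split_ifs with h
  · rfl
  · rw [notMem_support_iff.1 h, map_zero]

@[simp]
lemma mapDer_C {A : Type*} [CommRing A] (d : Der A) (a : A) :
    (mapDer d).f (C a) = C (d.f a) := by
  ext i; rw [coeff_mapDer]; simp only [coeff_C]; split_ifs <;> simp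

@[simp]
lemma mapDer_X {A : Type*} [CommRing A] (d : Der A) :
    (mapDer d).f (X : A[X]) = 0 := by
  ext i; rw [coeff_mapDer]; simp only [coeff_X]; split_ifs <;> simp [d.one]

/-- The usual derivative. -/
noncomputable def der (A : Type*) [CommRing A] : Der A[X] where
  f := (derivative : A[X] →ₗ[A] A[X]).toAddMonoidHom
  leib a b := by simp [derivative_mul]; ring

@[simp]
lemma der_apply {A : Type*} [CommRing A] (p : A[X]) : (der A).f p = derivative p := rfl

/-- The discriminant polynomial `y (y - 1728)`. -/
noncomputable def dl (F : Type*) [Field F] : F[X] := X * (X - C 1728)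
/-- The numerator `y² - 1968 y + 2654208`. -/
noncomputable def nm (F : Type*) [Field F] : F[X] := X^2 - C 1968 * X + C 2654208

/-- The polynomial Riccati derivation on `F[y][x]`, where `x = y (y - 1728) u`. -/
noncomputable def Mder (F : Type*) [Field F] : Der F[X][X] where
  f := (AddMonoidHom.mulLeft (C (dl F))).comp (mapDer (der F)).f +
    (AddMonoidHom.mulLeft (C (derivative (dl F)) * X - C (C (1/2)) * X^2 - C (nm F))).comp (der F[X]).f
  leib a b := by
    simp only [AddMonoidHom.add_apply, AddMonoidHom.comp_apply, AddMonoidHom.coe_mulLeft, Der.leib]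
    ring

lemma Mder_apply {F : Type*} [Field F] (g : F[X][X]) : (Mder F).f g = C (dl F) * (mapDer (der F)).f g +
    (C (derivative (dl F)) * X - C (C (1/2)) * X^2 - C (nm F)) * derivative g := rfl

lemma derivative_dl (F : Type*) [Field F] : derivative (dl F) = C 2 * X - C 1728 := by
  have : (C 2 : F[X]) = 2 := map_ofNat C 2
  simp [dl, derivative_mul, this]; ring

lemma coeff_Mder_succ {F : Type*} [Field F] (g : F[X][X]) (k : ℕ) :
    ((Mder F).f g).coeff (k+1) = dl F * derivative (g.coeff (k+1))
      + derivative (dl F) * (((k+1 : ℕ) : F[X]) * g.coeff (k+1)) - C (1/2) * ((k : F[X]) * g.coeff k)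
      - nm F * (((k+2 : ℕ) : F[X]) * g.coeff (k+2)) := by
  rw [Mder_apply]
  rw [coeff_add, coeff_C_mul, coeff_mapDer, der_apply, sub_mul, sub_mul, coeff_sub, coeff_sub,
    mul_assoc, coeff_C_mul, mul_assoc, coeff_C_mul, coeff_C_mul, coeff_X_mul, pow_two, mul_assoc,
    coeff_X_mul, coeff_derivative, coeff_derivative]
  have : (X * derivative g).coeff k = k * g.coeff k := by
    rcases k with _ | k
    · simp
    · rw [coeff_X_mul, coeff_derivative]; push_cast; ring
  rw [this]; push_cast; ring

lemma natDegree_Mder_le {F : Type*} [Field F] (g : F[X][X]) :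
    ((Mder F).f g).natDegree ≤ g.natDegree + 1 := by
  rw [natDegree_le_iff_coeff_eq_zero]
  intro N hN
  obtain ⟨k, rfl⟩ : ∃ k, N = k + 1 := ⟨N - 1, by omega⟩
  rw [coeff_Mder_succ, coeff_eq_zero_of_natDegree_lt (n := k+1) (by omega),
    coeff_eq_zero_of_natDegree_lt (n := k) (by omega), coeff_eq_zero_of_natDegree_lt (n := k+2) (by omega)]
  simp

lemma riccati_mult {F : Type*} [Field F] [CharZero F] (g : F[X][X]) (hg : g ≠ 0)
    (hd : g ∣ (Mder F).f g) : ∃ β : F[X],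
      (Mder F).f g = (C (C (-(g.natDegree : F)/2)) * X + C β) * g := by
  obtain ⟨S, hS⟩ := hd
  by_cases h0 : (Mder F).f g = 0
  · rw [h0] at hS
    have hS0 : S = 0 := by simpa [hg] using hS.symm
    have h1 := coeff_Mder_succ g g.natDegree
    rw [coeff_eq_zero_of_natDegree_lt (p := g) (n := g.natDegree+1) (by omega),
      coeff_eq_zero_of_natDegree_lt (p := g) (n := g.natDegree+2) (by omega), h0] at h1
    have hc : g.coeff g.natDegree ≠ 0 := by simpa using hg
    have : g.natDegree = 0 := by simpa [hg] using h1
    exact ⟨0, by rw [h0, this]; simp⟩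
  have hSne : S ≠ 0 := by rintro rfl; simp [h0] at hS
  have hdeg : S.natDegree ≤ 1 := by
    have := natDegree_Mder_le g
    rw [hS, natDegree_mul hg hSne] at this; omega
  obtain ⟨α, β, hαβ⟩ := exists_eq_X_add_C_of_natDegree_le_one hdeg
  refine ⟨β, ?_⟩
  have h1 := coeff_Mder_succ g g.natDegree
  have hc : g.coeff g.natDegree ≠ 0 := by simpa using hg
  have h2 : ((Mder F).f g).coeff (g.natDegree + 1) = α * g.coeff g.natDegree := by
    rw [hS, hαβ, mul_comm, add_mul, coeff_add, mul_assoc, coeff_C_mul, coeff_X_mul, coeff_C_mul,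
      coeff_eq_zero_of_natDegree_lt (n := g.natDegree+1) (by omega)]; simp
  rw [h2, coeff_eq_zero_of_natDegree_lt (n := g.natDegree+1) (by omega),
      coeff_eq_zero_of_natDegree_lt (n := g.natDegree+2) (by omega)] at h1
  have h3 : α = C (-(g.natDegree : F)/2) := by
    apply mul_right_cancel₀ hc
    rw [h1]
    have : (C (-(g.natDegree : F)/2) : F[X]) = - (C (1/2) * (g.natDegree : F[X])) := by
      rw [← C_eq_natCast, ← C_mul, ← C_neg]; congr 1; ring
    rw [this]; simp; ring
  rw [hS, hαβ, h3, mul_comm]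

lemma riccati_local {F : Type*} [Field F] [CharZero F] {K : Type*} [Field K] [CharZero K]
    (φ : F →+* K) (g : F[X][X]) (β : F[X]) (c : F) (hc : (dl F).eval c = 0)
    (h : (Mder F).f g = (C (C (-(g.natDegree : F)/2)) * X + C β) * g)
    (hg : g.map (evalRingHom c) ≠ 0) (r s : K) (hrs : r ≠ s)
    (h1 : r + s = 2 * φ ((derivative (dl F)).eval c)) (h2 : r * s = 2 * φ ((nm F).eval c)) :
    ∃ a b : ℕ, g.natDegree = a + b ∧ φ (β.eval c) = (a * s + b * r)/2 := by
  have h' := congrArg (Polynomial.map (φ.comp (evalRingHom c))) h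
  rw [Mder_apply] at h'
  simp only [Polynomial.map_add, Polynomial.map_mul, Polynomial.map_sub, map_C, map_X,
    Polynomial.map_pow, RingHom.comp_apply, coe_evalRingHom, hc, eval_C, map_zero, zero_mul, zero_add,
    ← derivative_map] at h'
  obtain ⟨a, b, ha, hb, -⟩ := quad_aux r s hrs (g.map (φ.comp (evalRingHom c)))
    (by rw [← Polynomial.map_map]; exact (Polynomial.map_ne_zero_iff φ.injective).2 hg) (φ (-(g.natDegree : F)/2))
    (φ (β.eval c)) (by
      rw [← h']
      congr 1
      have e1 : (C (φ ((derivative (dl F)).eval c)) : K[X]) = C (1/2) * (C r + C s) := by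
        rw [← C_add, ← C_mul, h1]; congr 1; ring
      have e2 : (C (φ ((nm F).eval c)) : K[X]) = C (1/2) * (C r * C s) := by
        rw [← C_mul, ← C_mul, h2]; congr 1; ring
      have e3 : (C (-1/2) : K[X]) = - C (1/2) := by rw [← C_neg]; congr 1; ring
      rw [e1, e2, e3]
      have e4 : φ (1/2) = 1/2 := by simp [map_ofNat φ 2]
      rw [e4]; ring)
  refine ⟨a, b, ?_, hb⟩
  have : (g.natDegree : K) = a + b := by
    have e : φ (-(g.natDegree : F)/2) = -(g.natDegree : K)/2 := by simp [map_ofNat φ 2]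
    rw [e] at ha
    linear_combination -2 * ha
  exact_mod_cast this

end JEq


open Polynomial

namespace JEq

/-- The substitution `y ↦ T`, `x ↦ x T`, into `F[x][T]`. -/
noncomputable def Phi (F : Type*) [Field F] : F[X][X] →+* F[X][X] :=
  eval₂RingHom (eval₂RingHom (C.comp C) X) (C X * X)

section
variable {F : Type*} [Field F]

lemma Phi_X : Phi F X = C X * X := by simp [Phi]
lemma Phi_CX : Phi F (C X) = X := by simp [Phi]
lemma Phi_CC (c : F) : Phi F (C (C c)) = C (C c) := by simp [Phi]

lemma Phi_C (p : F[X]) : Phi F (C p) = p.map C := by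
  induction p using Polynomial.induction_on' with
  | add p q hp hq => rw [C_add, map_add, hp, hq, Polynomial.map_add]
  | monomial n a =>
    rw [← C_mul_X_pow_eq_monomial, C_mul, C_pow, map_mul, map_pow, Phi_CX, Phi_CC]; simp

lemma coeff_Phi (g : F[X][X]) (i k : ℕ) : ((Phi F g).coeff (i+k)).coeff k = (g.coeff k).coeff i := by
  induction g using Polynomial.induction_on' with
  | add p q hp hq => simp only [map_add, coeff_add, hp, hq]
  | monomial n p =>
    rw [← C_mul_X_pow_eq_monomial, map_mul, map_pow, Phi_X, Phi_C, mul_pow, ← C_pow]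
    have : (map C p * (C (X^n) * X^n) : F[X][X]) = C (X^n) * (map C p * X^n) := by ring
    rw [this, coeff_C_mul, coeff_C_mul, coeff_mul_X_pow', coeff_X_pow]
    by_cases hkn : k = n
    · subst hkn
      rw [if_pos (by omega), coeff_map]
      simp
    · rw [if_neg hkn]
      split_ifs with h
      · rw [coeff_map, mul_comm, coeff_C_mul, coeff_X_pow, if_neg hkn]; simp
      · simp

lemma Phi_ne_zero (g : F[X][X]) (hg : g ≠ 0) : Phi F g ≠ 0 := by
  intro h
  apply hg
  ext k i
  rw [← coeff_Phi, h]; simp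

lemma natDegree_Phi (g : F[X][X]) (hg : g ≠ 0) : g.natDegree ≤ (Phi F g).natDegree := by
  have h1 : ((Phi F g).coeff (g.leadingCoeff.natDegree + g.natDegree)).coeff g.natDegree ≠ 0 := by
    rw [coeff_Phi]; simpa using hg
  have h2 : (Phi F g).coeff (g.leadingCoeff.natDegree + g.natDegree) ≠ 0 := by
    intro h; rw [h] at h1; simp at h1
  have := le_natDegree_of_ne_zero h2
  omega

/-- The transformed derivation, multiplied by `T`. -/
noncomputable def Minf (F : Type*) [Field F] : Der F[X][X] where
  f := (AddMonoidHom.mulLeft ((dl F).map C * X)).comp (der F[X]).f +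
    (AddMonoidHom.mulLeft ((derivative (dl F)).map C * X * C X - C (C (1/2) * X^2) * X^2 - (nm F).map C
      - C X * (dl F).map C)).comp (mapDer (der F)).f
  leib a b := by
    simp only [AddMonoidHom.add_apply, AddMonoidHom.comp_apply, AddMonoidHom.coe_mulLeft, Der.leib]
    ring

lemma Minf_apply (h : F[X][X]) : (Minf F).f h = (dl F).map C * X * derivative h +
    ((derivative (dl F)).map C * X * C X - C (C (1/2) * X^2) * X^2 - (nm F).map C
      - C X * (dl F).map C) * (mapDer (der F)).f h := rfl

lemma Phi_Mder (g : F[X][X]) : X * Phi F ((Mder F).f g) = (Minf F).f (Phi F g) := by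
  have hmul : ∀ p q : F[X][X], X * Phi F ((Mder F).f p) = (Minf F).f (Phi F p) →
      X * Phi F ((Mder F).f q) = (Minf F).f (Phi F q) →
      X * Phi F ((Mder F).f (p*q)) = (Minf F).f (Phi F (p*q)) := by
    intro p q hp hq
    rw [Der.leib, map_mul (Phi F) p q, Der.leib, map_add, map_mul, map_mul]
    linear_combination Phi F p * hq + Phi F q * hp
  have hX : X * Phi F ((Mder F).f X) = (Minf F).f (Phi F X) := by
    rw [Mder_apply, Minf_apply, Phi_X]
    simp only [mapDer_X, mul_zero, zero_add, derivative_X, mul_one, map_sub, map_mul, Phi_C, Phi_X, map_pow,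
      Der.leib, mapDer_C, der_apply, C_1, Polynomial.map_C]
    rw [derivative_mul, derivative_C, derivative_X]
    ring
  have hCX : X * Phi F ((Mder F).f (C X)) = (Minf F).f (Phi F (C X)) := by
    rw [Mder_apply, Minf_apply, Phi_CX]
    simp [Phi_C]
    ring
  have hCC : ∀ c, X * Phi F ((Mder F).f (C (C c))) = (Minf F).f (Phi F (C (C c))) := by
    intro c
    rw [Mder_apply, Minf_apply, Phi_CC]
    simp
  have hC : ∀ p : F[X], X * Phi F ((Mder F).f (C p)) = (Minf F).f (Phi F (C p)) := by
    intro p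
    induction p using Polynomial.induction_on with
    | C a => exact hCC a
    | add p q hp hq => simp only [map_add, mul_add, hp, hq]
    | monomial n a ih =>
      rw [_root_.pow_succ, ← mul_assoc, C_mul]
      exact hmul _ _ ih hCX
  induction g using Polynomial.induction_on with
  | C a => exact hC a
  | add p q hp hq => simp only [map_add, mul_add, hp, hq]
  | monomial n a ih =>
    rw [_root_.pow_succ, ← mul_assoc]
    exact hmul _ _ ih hX

lemma dl_eq : dl F = X^2 - C 1728 * X := by simp [dl]; ring

lemma riccati_inf [CharZero F] (g : F[X][X]) (hg : g ≠ 0) (β : F[X]) 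
    (h : (Mder F).f g = (C (C (-(g.natDegree : F)/2)) * X + C β) * g) :
    β.natDegree ≤ 1 ∧ ∃ H : F[X], H ≠ 0 ∧ (X - C (1/2) * X^2 - 1) * derivative H =
      (C (-(g.natDegree : F)/2) * X + C (β.coeff 1 - (Phi F g).natDegree)) * H := by
  have hH := Phi_Mder g
  set H := Phi F g with hHdef
  set w := H.natDegree with hw
  have hHne : H ≠ 0 := Phi_ne_zero g hg
  set α : F := -(g.natDegree : F)/2
  rw [h, map_mul, map_add, map_mul, Phi_C, Phi_C, Phi_X, Polynomial.map_C, ← hHdef] at hH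
  set S : F[X][X] := C (C α) * (C X * X) + β.map C with hS
  have hdl : ((dl F).map C * X : F[X][X]).natDegree ≤ 3 := by
    rw [dl_eq]; simp; compute_degree
  have hm : ((mapDer (der F)).f H).natDegree ≤ w := by
    rw [natDegree_le_iff_coeff_eq_zero]
    intro N hN
    rw [coeff_mapDer, coeff_eq_zero_of_natDegree_lt hN]; simp
  have hq : ((derivative (dl F)).map C * X * C X - C (C (1/2) * X^2) * X^2 - (nm F).map C
      - C X * (dl F).map C : F[X][X]).natDegree ≤ 2 := by
    rw [derivative_dl, dl_eq, nm]; simp; compute_degree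
  have hd : (derivative H).natDegree ≤ w - 1 := natDegree_derivative_le H
  have hdH : ((dl F).map C * X * derivative H : F[X][X]).natDegree ≤ w + 2 := by
    by_cases hw0 : w = 0
    · rw [derivative_of_natDegree_zero hw0]; simp
    · exact (natDegree_mul_le_of_le hdl hd).trans (by omega)
  have hL : ((Minf F).f H).natDegree ≤ w + 2 := by
    rw [Minf_apply]
    refine natDegree_add_le_of_degree_le hdH ?_
    exact (natDegree_mul_le_of_le hq hm).trans (by omega)
  have hSdeg : S.natDegree ≤ 1 := by
    by_cases hS0 : S = 0
    · rw [hS0]; simp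
    · rw [← hH, natDegree_mul X_ne_zero (mul_ne_zero hS0 hHne), natDegree_mul hS0 hHne, natDegree_X] at hL
      omega
  have hScoeff : ∀ j, j ≠ 1 → S.coeff j = C (β.coeff j) := by
    intro j hj
    rw [hS, coeff_add, coeff_map, ← mul_assoc, ← C_mul, coeff_C_mul, coeff_X, if_neg hj.symm]; simp
  constructor
  · rw [natDegree_le_iff_coeff_eq_zero]
    intro N hN
    have := hScoeff N (by omega)
    rw [coeff_eq_zero_of_natDegree_lt (by omega)] at this
    exact C_eq_zero.1 this.symm
  refine ⟨H.coeff w, by simpa [hw] using hHne, ?_⟩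
  have key := congrArg (fun p => coeff p (w+2)) hH
  beta_reduce at key
  have e1 : (X * (S * H)).coeff (w+2) = (C α * X + C (β.coeff 1)) * H.coeff w := by
    rw [show w + 2 = (w+1)+1 from rfl, coeff_X_mul, show w + 1 = 1 + w by omega, coeff_mul_add_eq_of_natDegree_le hSdeg le_rfl]
    congr 1
    rw [hS, coeff_add, coeff_map, ← mul_assoc, ← C_mul, coeff_C_mul, coeff_X]; simp
  have e2 : ((dl F).map C * X * derivative H : F[X][X]).coeff (w+2) = (w : F[X]) * H.coeff w := by
    by_cases hw0 : w = 0
    · rw [derivative_of_natDegree_zero hw0]; simp [hw0]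
    · obtain ⟨t, ht⟩ : ∃ t, w = t + 1 := ⟨w - 1, by omega⟩
      rw [show w + 2 = 3 + t by omega, coeff_mul_add_eq_of_natDegree_le hdl (by rw [ht] at hd; simpa using hd),
        coeff_derivative, ← ht]
      have : ((dl F).map C * X : F[X][X]).coeff 3 = 1 := by
        rw [coeff_mul_X, dl_eq, coeff_map]
        simp [coeff_X]
      rw [this, ht]; push_cast; ring
  have e3 : (((derivative (dl F)).map C * X * C X - C (C (1/2) * X^2) * X^2 - (nm F).map C
      - C X * (dl F).map C : F[X][X]) * (mapDer (der F)).f H).coeff (w+2) = 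
      (X - C (1/2) * X^2 - 1) * derivative (H.coeff w) := by
    rw [show w + 2 = 2 + w by omega, coeff_mul_add_eq_of_natDegree_le hq hm, coeff_mapDer, der_apply]
    congr 1
    rw [coeff_sub, coeff_sub, coeff_sub, coeff_C_mul, coeff_mul_C, coeff_mul_X, coeff_C_mul, coeff_map, coeff_map, coeff_map,
      derivative_dl, dl_eq, nm]
    have h2 : (C 2 : F[X]) = 2 := map_ofNat C 2
    simp [coeff_X, h2]
    ring
  rw [e1, Minf_apply, coeff_add, e2, e3] at key
  rw [C_sub, C_eq_natCast]
  linear_combination -key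

theorem riccati [CharZero F] (g : F[X][X]) (hm : 1 ≤ g.natDegree)
    (h0 : g.map (evalRingHom 0) ≠ 0) (h1 : g.map (evalRingHom 1728) ≠ 0)
    (hd : g ∣ (Mder F).f g) : False := by
  have hg : g ≠ 0 := by rintro rfl; simp at hm
  obtain ⟨β, hβ⟩ := riccati_mult g hg hd
  obtain ⟨hβ1, H, hH, hHeq⟩ := riccati_inf g hg β hβ
  set w := (Phi F g).natDegree
  have hw : g.natDegree ≤ w := natDegree_Phi g hg
  let K := AlgebraicClosure F
  have : CharZero K := charZero_of_injective_algebraMap (algebraMap F K).injective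
  let φ : F →+* K := algebraMap F K
  have hsq : ∀ q : ℚ, ∃ s : K, s^2 = (q : K) := fun q => IsAlgClosed.exists_pow_nat_eq _ (by norm_num)
  obtain ⟨s0, hs0⟩ := hsq (-7/9)
  obtain ⟨s1, hs1⟩ := hsq (-1/2)
  obtain ⟨s2, hs2⟩ := hsq (-1)
  have hs0' : s0 ≠ 0 := by rintro rfl; norm_num at hs0
  have hs1' : s1 ≠ 0 := by rintro rfl; norm_num at hs1
  have hs2' : s2 ≠ 0 := by rintro rfl; norm_num at hs2
  push_cast at hs0 hs1 hs2
  have f1 : φ 1728 = 1728 := map_ofNat φ 1728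
  have f2 : φ 2 = 2 := map_ofNat φ 2
  have f3 : φ 1968 = 1968 := map_ofNat φ 1968
  have f4 : φ 2654208 = 2654208 := map_ofNat φ 2654208
  obtain ⟨a, b, hab, hb⟩ := riccati_local φ g β 0 (by simp [dl]) hβ h0
    (1728 * (-1 + s0)) (1728 * (-1 - s0)) (by
      intro h
      apply hs0'
      linear_combination (1/3456) * h) (by simp [derivative_dl, f1]; ring)
      (by simp [nm, f4]; linear_combination (-1728^2) * hs0)
  obtain ⟨a', b', hab', hb'⟩ := riccati_local φ g β 1728 (by simp [dl]) hβ h1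
    (1728 * (1 + s1)) (1728 * (1 - s1)) (by
      intro h
      apply hs1'
      linear_combination (1/3456) * h) (by simp [derivative_dl, f1, f2]; ring)
      (by simp [nm, f1, f3, f4]; linear_combination (-1728^2) * hs1)
  obtain ⟨c, d, hc, hcd, -⟩ := quad_aux (1 + s2) (1 - s2) (by
      intro h
      apply hs2'
      linear_combination (1/2) * h) (H.map φ) ((Polynomial.map_ne_zero_iff φ.injective).2 hH)
      (φ (-(g.natDegree : F)/2)) (φ (β.coeff 1 - w)) (by
        have := congrArg (Polynomial.map φ) hHeq
        simp only [Polynomial.map_mul, Polynomial.map_sub, Polynomial.map_add, Polynomial.map_pow, map_X, map_C,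
          Polynomial.map_one, ← derivative_map] at this
        rw [← this]
        congr 1
        have e1 : (C (1 + s2) : K[X]) = 1 + C s2 := by simp
        have e2 : (C (1 - s2) : K[X]) = 1 - C s2 := by simp
        have e3 : (C (-1/2) : K[X]) = - C (1/2) := by rw [← C_neg]; congr 1; ring
        have e4 : φ (1/2) = 1/2 := by simp [f2]
        have e5 : (C s2 : K[X])^2 = -1 := by rw [← C_pow, hs2]; simp
        have e6 : (C (1/2) : K[X]) * 2 = 1 := by
          rw [← map_ofNat C 2, ← C_mul]; norm_num
        rw [e1, e2, e3, e4]
        linear_combination C (1/2) * e5 + (X - 1) * e6)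
  have hm' : (g.natDegree : K) = c + d := by
    have e : φ (-(g.natDegree : F)/2) = -(g.natDegree : K)/2 := by simp [f2]
    rw [e] at hc
    linear_combination -2 * hc
  have hab1 : (g.natDegree : K) = a + b := by exact_mod_cast hab
  have hab2 : (g.natDegree : K) = a' + b' := by exact_mod_cast hab'
  have hrel : φ (β.eval 1728) - φ (β.eval 0) = 1728 * φ (β.coeff 1) := by
    obtain ⟨p, q, rfl⟩ := exists_eq_X_add_C_of_natDegree_le_one hβ1
    simp [f1]; ring
  have hcd' : φ (β.coeff 1) = w + (c * (1 - s2) + d * (1 + s2))/2 := by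
    rw [← hcd]; simp
  rw [hb, hb', hcd'] at hrel
  refine sqrt_aux (((b':K) - a') * s1) ((a - b : K) * s0) ((c - d : K) * s2) (((b':ℚ) - a')^2 * (-1/2))
    (((a : ℚ) - b)^2 * (-7/9)) (((c:ℚ) - d)^2 * (-1)) (2 * w - g.natDegree) ?_ ?_ ?_ ?_ ?_ ?_ ?_ ?_
  · rw [mul_pow, hs1]; push_cast; ring
  · rw [mul_pow, hs0]; push_cast; ring
  · rw [mul_pow, hs2]; push_cast; ring
  · nlinarith [sq_nonneg ((b':ℚ) - a')]
  · nlinarith [sq_nonneg ((a:ℚ) - b)]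
  · nlinarith [sq_nonneg ((c:ℚ) - d)]
  · have : (g.natDegree : ℚ) ≤ w := by exact_mod_cast hw
    have : (1:ℚ) ≤ g.natDegree := by exact_mod_cast hm
    linarith
  · push_cast
    linear_combination (1/864) * hrel - hm' + hab1 + hab2
end

end JEq


open Polynomial

namespace JEq

lemma prime_dvd_der {A : Type*} [CommRing A] [IsDomain A] [WfDvdMonoid A] (M : Der A)
    (hu : ∀ k : ℕ, k ≠ 0 → IsUnit (k : A)) (p q : A) (hp : p ≠ 0) (hq : Prime q) (hqp : q ∣ p)
    (hM : p ∣ M.f p) : q ∣ M.f q := by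
  obtain ⟨r, hr, hqr⟩ := (FiniteMultiplicity.of_prime_left hq hp).exists_eq_pow_mul_and_not_dvd
  set k := multiplicity q p
  rcases hk : k with _ | k'
  · rw [hk] at hr; simp at hr; rw [hr] at hqp; exact absurd hqp hqr
  rw [hk] at hr
  rw [hr, M.leib, M.pow_succ] at hM
  have h1 : q^k' * q ∣ q^k' * (q * M.f r + ((k'+1 : ℕ) : A) * (M.f q * r)) := by
    refine dvd_trans ⟨r, ?_⟩ (hM.trans (dvd_of_eq ?_))
    · rw [pow_succ]
    · ring
  have h2 := (mul_dvd_mul_iff_left (pow_ne_zero _ hq.ne_zero)).1 h1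
  have h3 : q ∣ ((k'+1 : ℕ) : A) * (M.f q * r) := (dvd_add_right (dvd_mul_right q _)).1 h2
  rw [(hu _ (Nat.succ_ne_zero k')).dvd_mul_left] at h3
  exact (hq.dvd_or_dvd h3).resolve_right hqr

lemma exists_irred_factor {A : Type*} [CommRing A] [IsDomain A] [UniqueFactorizationMonoid A]
    (p : A[X]) (hp : 1 ≤ p.natDegree) : ∃ q, Irreducible q ∧ q ∣ p ∧ 1 ≤ q.natDegree := by
  induction p using WfDvdMonoid.induction_on_irreducible with
  | zero => simp at hp
  | unit u hu => rw [natDegree_eq_zero_of_isUnit hu] at hp; omega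
  | mul a i ha hi ih =>
    by_cases h : 1 ≤ i.natDegree
    · exact ⟨i, hi, dvd_mul_right _ _, h⟩
    · rw [natDegree_mul hi.ne_zero ha] at hp
      obtain ⟨q, h1, h2, h3⟩ := ih (by omega)
      exact ⟨q, h1, h2.mul_left _, h3⟩

lemma irred_eval_ne {F : Type*} [Field F] (q : F[X][X]) (hq : Irreducible q) (hd : 1 ≤ q.natDegree) (c : F) :
    q.map (evalRingHom c) ≠ 0 := by
  intro h
  have h1 : C (X - C c) ∣ q := by
    rw [C_dvd_iff_dvd_coeff]
    intro i
    rw [dvd_iff_isRoot, IsRoot.def]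
    have := congrArg (fun p => coeff p i) h
    simpa using this
  obtain ⟨t, ht⟩ := h1
  have h2 : IsUnit t := by
    refine (hq.isUnit_or_isUnit ht).resolve_left ?_
    rw [isUnit_C]
    exact not_isUnit_X_sub_C c
  have h3 : t ≠ 0 := h2.ne_zero
  rw [ht, natDegree_mul (by rw [Ne, C_eq_zero]; exact X_sub_C_ne_zero c) h3, natDegree_C, natDegree_eq_zero_of_isUnit h2] at hd
  omega

theorem riccati' {F : Type*} [Field F] [CharZero F] (p : F[X][X]) (hp : p ≠ 0)
    (hd : p ∣ (Mder F).f p) : p.natDegree = 0 := by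
  by_contra hne
  obtain ⟨q, hq, hqp, hqd⟩ := exists_irred_factor p (by omega)
  refine riccati q hqd (irred_eval_ne q hq hqd 0) (irred_eval_ne q hq hqd 1728) ?_
  refine prime_dvd_der (Mder F) ?_ p q hp hq.prime hqp hd
  intro k hk
  have : IsUnit ((k : F)) := (Nat.cast_ne_zero.2 hk).isUnit
  have := this.map ((C : F[X] →+* F[X][X]).comp C)
  simpa using this

lemma prime_kernel {A E : Type*} [CommRing A] [IsDomain A] [UniqueFactorizationMonoid A] [CommRing E] [IsDomain E]
    (f : A[X] →+* E) (hC : ∀ a : A, f (C a) = 0 → a = 0) (hk : ∃ p, p ≠ 0 ∧ f p = 0) :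
    ∃ P : A[X], Irreducible P ∧ 1 ≤ P.natDegree ∧ f P = 0 ∧ ∀ q, f q = 0 → P ∣ q := by
  classical
  let T : Set ℕ := {n | ∃ p, p ≠ 0 ∧ f p = 0 ∧ p.natDegree = n}
  have hT : T.Nonempty := by obtain ⟨p, h1, h2⟩ := hk; exact ⟨_, p, h1, h2, rfl⟩
  obtain ⟨p, hp0, hfp, hpn⟩ := Nat.sInf_mem hT
  set n := sInf T
  have hmin : ∀ q, f q = 0 → q.natDegree < n → q = 0 := by
    intro q hq hqn
    by_contra h
    exact Nat.notMem_of_lt_sInf hqn ⟨q, h, hq, rfl⟩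
  have hfac : ∀ p : A[X], p ≠ 0 → f p = 0 → ∃ P, Irreducible P ∧ P ∣ p ∧ f P = 0 := by
    intro p
    induction p using WfDvdMonoid.induction_on_irreducible with
    | zero => simp
    | unit u hu => 
      intro _ h
      exact absurd h (hu.map f).ne_zero
    | mul a i ha hi ih =>
      intro _ h
      rw [map_mul] at h
      rcases mul_eq_zero.1 h with h | h
      · exact ⟨i, hi, dvd_mul_right _ _, h⟩
      · obtain ⟨P, h1, h2, h3⟩ := ih ha h
        exact ⟨P, h1, h2.mul_left _, h3⟩
  obtain ⟨P, hP, hPp, hfP⟩ := hfac p hp0 hfp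
  have hPn : P.natDegree = n := by
    apply le_antisymm
    · rw [← hpn]; exact natDegree_le_of_dvd hPp hp0
    · by_contra h
      exact hP.ne_zero (hmin P hfP (by omega))
  have hP1 : 1 ≤ P.natDegree := by
    by_contra h
    have h0 : P.natDegree = 0 := by omega
    rw [eq_C_of_natDegree_eq_zero h0] at hfP
    have := hC _ hfP
    apply hP.ne_zero
    rw [eq_C_of_natDegree_eq_zero h0, this, C_0]
  refine ⟨P, hP, hP1, hfP, ?_⟩
  have hpseudo : ∀ m : ℕ, ∀ q, f q = 0 → q.natDegree ≤ m → ∃ k, P ∣ C (P.leadingCoeff^k) * q := by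
    intro m
    induction m with
    | zero =>
      intro q hq hqm
      rw [hmin q hq (by omega)]
      exact ⟨0, by simp⟩
    | succ m ih =>
      intro q hq hqm
      by_cases hlt : q.natDegree < n
      · rw [hmin q hq hlt]
        exact ⟨0, by simp⟩
      have h1 : (C P.leadingCoeff * q - C (q.coeff (m+1)) * X^(m+1-n) * P).natDegree ≤ m := by
        rw [natDegree_le_iff_coeff_eq_zero]
        intro N hN
        rw [coeff_sub, coeff_C_mul, mul_assoc, coeff_C_mul, coeff_X_pow_mul']
        rcases Nat.lt_or_ge (m+1) N with h | h
        · rw [coeff_eq_zero_of_natDegree_lt (p := q) (by omega), if_pos (by omega),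
            coeff_eq_zero_of_natDegree_lt (p := P) (by omega)]; simp
        · have : N = m + 1 := by omega
          subst this
          rw [if_pos (by omega), show m + 1 - (m + 1 - n) = P.natDegree by omega, coeff_natDegree]; ring
      obtain ⟨k, hk⟩ := ih _ (by rw [map_sub, map_mul, map_mul, hq, hfP]; simp) h1
      refine ⟨k+1, ?_⟩
      rw [mul_sub] at hk
      have h2 := (dvd_sub_left (dvd_mul_of_dvd_right (dvd_mul_left P _) _)).1 hk
      rw [pow_succ, C_mul, mul_assoc]
      exact h2
  intro q hq
  obtain ⟨k, hk⟩ := hpseudo q.natDegree q hq le_rfl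
  refine (hP.prime.dvd_or_dvd hk).resolve_left ?_
  intro h
  have := natDegree_le_of_dvd h (by rw [Ne, C_eq_zero]; exact pow_ne_zero _ (leadingCoeff_ne_zero.2 hP.ne_zero))
  rw [natDegree_C] at this
  omega

section
variable {F : Type*} [Field F]

/-- The total derivation on `F[y][x][v]`, multiplied by `y (y - 1728)`. -/
noncomputable def Tder (dF : Der F) : Der F[X][X][X] where
  f := (AddMonoidHom.mulLeft (C (C (dl F)))).comp (mapDer (mapDer (mapDer dF))).f +
    (AddMonoidHom.mulLeft X).comp (mapDer (Mder F)).f +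
    (AddMonoidHom.mulLeft (C X * X^2)).comp (der F[X][X]).f
  leib a b := by
    simp only [AddMonoidHom.add_apply, AddMonoidHom.comp_apply, AddMonoidHom.coe_mulLeft, Der.leib]
    ring

lemma Tder_apply (dF : Der F) (p : F[X][X][X]) : (Tder dF).f p =
    C (C (dl F)) * (mapDer (mapDer (mapDer dF))).f p + X * (mapDer (Mder F)).f p + C X * X^2 * derivative p := rfl

lemma coeff_Tder_zero (dF : Der F) (p : F[X][X][X]) : ((Tder dF).f p).coeff 0 =
    C (dl F) * (mapDer (mapDer dF)).f (p.coeff 0) := by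
  rw [Tder_apply, coeff_add, coeff_add, coeff_C_mul, coeff_mapDer, mul_assoc, coeff_C_mul, coeff_X_mul_zero, pow_two,
    mul_assoc, coeff_X_mul_zero]; simp

lemma coeff_Tder_succ (dF : Der F) (p : F[X][X][X]) (k : ℕ) : ((Tder dF).f p).coeff (k+1) =
    C (dl F) * (mapDer (mapDer dF)).f (p.coeff (k+1)) + (Mder F).f (p.coeff k) + X * ((k : F[X][X]) * p.coeff k) := by
  rw [Tder_apply, coeff_add, coeff_add, coeff_C_mul, coeff_mapDer, mul_assoc (C X), coeff_C_mul, coeff_X_mul, pow_two,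
    mul_assoc, coeff_X_mul, coeff_mapDer]
  congr 2
  rcases k with _ | k
  · simp
  · rw [coeff_X_mul, coeff_derivative]; push_cast; ring

lemma zlem [CharZero F] (p : F[X][X]) (c : ℕ) (hc : 1 ≤ c) (μ τ : F[X])
    (h : (Mder F).f p = ((c : F[X][X]) * X + C μ) * p + C τ) : p = 0 := by
  by_contra hp
  have h1 := coeff_Mder_succ p p.natDegree
  rw [coeff_eq_zero_of_natDegree_lt (p := p) (n := p.natDegree+1) (by omega),
      coeff_eq_zero_of_natDegree_lt (p := p) (n := p.natDegree+2) (by omega), h, coeff_add, add_mul, coeff_add,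
      coeff_C_succ, coeff_C_mul, mul_assoc, ← C_eq_natCast, coeff_C_mul, coeff_X_mul,
      coeff_eq_zero_of_natDegree_lt (p := p) (n := p.natDegree+1) (by omega)] at h1
  have h2 : (C ((c : F) + p.natDegree / 2)) * p.coeff p.natDegree = 0 := by
    have e : (C ((c : F) + p.natDegree / 2) : F[X]) = (c : F[X]) + C (1/2) * (p.natDegree : F[X]) := by
      rw [← C_eq_natCast, ← C_eq_natCast, ← C_mul, ← C_add]; congr 1; ring
    rw [e]
    simp only [map_zero, mul_zero, add_zero, zero_sub] at h1
    linear_combination h1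
  rcases mul_eq_zero.1 h2 with h2 | h2
  · rw [C_eq_zero] at h2
    have : (2 * c + p.natDegree : ℕ) = (0 : F) := by push_cast; linear_combination 2 * h2
    have := Nat.cast_eq_zero.1 this
    omega
  · rw [coeff_natDegree, leadingCoeff_eq_zero] at h2
    exact hp h2

theorem case2_alg [CharZero F] (dF : Der F) (P : F[X][X][X]) (h0 : P.coeff 0 ≠ 0) (hn : 1 ≤ P.natDegree)
    (hd : P ∣ (Tder dF).f P) : False := by
  obtain ⟨S, hS⟩ := hd
  have hP : P ≠ 0 := by rintro rfl; simp at hn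
  set n := P.natDegree with hndef
  have hdeg : ((Tder dF).f P).natDegree ≤ n + 1 := by
    rw [natDegree_le_iff_coeff_eq_zero]
    intro N hN
    obtain ⟨k, rfl⟩ : ∃ k, N = k + 1 := ⟨N - 1, by omega⟩
    rw [coeff_Tder_succ, coeff_eq_zero_of_natDegree_lt (n := k+1) (by omega),
      coeff_eq_zero_of_natDegree_lt (n := k) (by omega)]
    simp
  have hS1 : S.natDegree ≤ 1 := by
    by_cases hS0 : S = 0
    · rw [hS0]; simp
    · rw [hS, natDegree_mul hP hS0] at hdeg; omega
  obtain ⟨A1, A0, rfl⟩ := exists_eq_X_add_C_of_natDegree_le_one hS1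
  have c0 : C (dl F) * (mapDer (mapDer dF)).f (P.coeff 0) = A0 * P.coeff 0 := by
    rw [← coeff_Tder_zero, hS, mul_coeff_zero]; simp; ring
  have cs : ∀ k, C (dl F) * (mapDer (mapDer dF)).f (P.coeff (k+1)) + (Mder F).f (P.coeff k)
      + X * ((k : F[X][X]) * P.coeff k) = A1 * P.coeff k + A0 * P.coeff (k+1) := by
    intro k
    rw [← coeff_Tder_succ, hS, mul_add, coeff_add, coeff_mul_C, ← mul_assoc, coeff_mul_X, coeff_mul_C]; ring
  have hln : P.coeff n ≠ 0 := by simpa [hndef] using hP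
  have ctop := cs n
  rw [coeff_eq_zero_of_natDegree_lt (p := P) (n := n+1) (by omega)] at ctop
  simp only [map_zero, mul_zero, zero_add, add_zero] at ctop
  have hl0 : (P.coeff n).natDegree = 0 := by
    apply riccati' _ hln
    exact ⟨A1 - X * (n : F[X][X]), by linear_combination ctop⟩
  obtain ⟨l, hl⟩ : ∃ l, P.coeff n = C l := ⟨_, eq_C_of_natDegree_eq_zero hl0⟩
  have hμ : ∃ μ : F[X], A1 = (n : F[X][X]) * X + C μ := by
    have h1 : (A1 - (n : F[X][X]) * X) * C l = C (dl F * derivative l) := by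
      rw [hl, Mder_apply] at ctop
      simp only [mapDer_C, der_apply, derivative_C, mul_zero, add_zero, ← C_mul] at ctop
      linear_combination -ctop
    have h2 : (A1 - (n : F[X][X]) * X).natDegree = 0 := by
      by_cases hz : A1 - (n : F[X][X]) * X = 0
      · rw [hz]; simp
      have := congrArg natDegree h1
      rw [natDegree_mul hz (by rw [← hl]; exact hln)] at this
      rw [natDegree_C, natDegree_C, add_zero] at this
      exact this
    refine ⟨(A1 - (n : F[X][X]) * X).coeff 0, ?_⟩
    rw [← eq_C_of_natDegree_eq_zero h2]; ring
  obtain ⟨μ, rfl⟩ := hμ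
  have hν : ∃ ν, A0 = C ν := by
    refine ⟨A0.coeff 0, eq_C_of_natDegree_eq_zero ?_⟩
    by_cases hz : A0 = 0
    · rw [hz]; simp
    have h1 : (C (dl F) * (mapDer (mapDer dF)).f (P.coeff 0)).natDegree ≤ (P.coeff 0).natDegree := by
      rw [natDegree_le_iff_coeff_eq_zero]
      intro N hN
      rw [coeff_C_mul, coeff_mapDer, coeff_eq_zero_of_natDegree_lt hN]; simp
    rw [c0, natDegree_mul hz h0] at h1
    omega
  obtain ⟨ν, rfl⟩ := hν
  have step : ∀ k, k < n → (∃ t, P.coeff (k+1) = C t) → P.coeff k = 0 := by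
    rintro k hk ⟨t, ht⟩
    have := cs k
    rw [ht] at this
    obtain ⟨c, hc⟩ := Nat.exists_eq_add_of_lt hk
    have hc2 : (n : F[X][X]) = (k : F[X][X]) + (c : F[X][X]) + 1 := by rw [hc]; push_cast; rfl
    rw [hc2] at this
    refine zlem _ (c+1) (by omega) μ (ν * t - dl F * (mapDer dF).f t) ?_
    rw [mapDer_C] at this
    simp only [C_sub, C_mul]
    push_cast at this ⊢
    linear_combination this
  have all : ∀ j, j < n → P.coeff (n - 1 - j) = 0 := by
    intro j
    induction j with
    | zero =>
      intro _
      refine step _ (by omega) ⟨l, ?_⟩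
      rw [show n - 1 - 0 + 1 = n by omega, hl]
    | succ j ih =>
      intro hj
      refine step _ (by omega) ⟨0, ?_⟩
      rw [show n - 1 - (j+1) + 1 = n - 1 - j by omega, ih (by omega), C_0]
  have := all (n-1) (by omega)
  rw [Nat.sub_self] at this
  exact h0 this

end

end JEq


open Polynomial
set_option linter.unusedSectionVars false
set_option linter.unusedSimpArgs false

namespace JEq

section
variable {F E : Type*} [Field F] [CharZero F] [Field E] [Algebra F E]

/-- evaluation of a polynomial in two variables -/
noncomputable def ev2 (F : Type*) {E : Type*} [Field F] [Field E] [Algebra F E] (y x : E) : F[X][X] →+* E :=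
  eval₂RingHom (aeval y : F[X] →ₐ[F] E).toRingHom x

/-- evaluation of a polynomial in three variables -/
noncomputable def ev3 (F : Type*) {E : Type*} [Field F] [Field E] [Algebra F E] (y x v : E) : F[X][X][X] →+* E :=
  eval₂RingHom (ev2 F y x) v

@[simp] lemma ev2_C (y x : E) (p : F[X]) : ev2 F y x (C p) = aeval y p := by simp [ev2]
@[simp] lemma ev2_X (y x : E) : ev2 F y x X = x := by simp [ev2]
@[simp] lemma ev3_C (y x v : E) (p : F[X][X]) : ev3 F y x v (C p) = ev2 F y x p := by simp [ev3]
@[simp] lemma ev3_X (y x v : E) : ev3 F y x v X = v := by simp [ev3]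

lemma poly_ind {A B : Type*} [CommRing A] [CommRing B] (φ ψ : A[X] → B)
    (hφ : ∀ p q, φ (p+q) = φ p + φ q) (hψ : ∀ p q, ψ (p+q) = ψ p + ψ q) (ev : A[X] → B)
    (mφ : ∀ p q, φ (p*q) = ev p * φ q + φ p * ev q)
    (mψ : ∀ p q, ψ (p*q) = ev p * ψ q + ψ p * ev q)
    (hC : ∀ a, φ (C a) = ψ (C a)) (hX : φ X = ψ X) (p : A[X]) : φ p = ψ p := by
  induction p using Polynomial.induction_on with
  | C a => exact hC a
  | add p q h h' => rw [hφ, hψ, h, h']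
  | monomial n a h => rw [_root_.pow_succ, ← mul_assoc, mφ, mψ, h, hX]

variable (dF : Der F) (dE : Der E) (hcomp : ∀ c, dE.f (algebraMap F E c) = algebraMap F E (dF.f c))
include hcomp

lemma chain1 (y : E) (p : F[X]) :
    dE.f (aeval y p) = aeval y ((mapDer dF).f p) + dE.f y * aeval y (derivative p) := by
  refine poly_ind (fun p : F[X] => dE.f (aeval y p)) (fun p => aeval y ((mapDer dF).f p) + dE.f y * aeval y (derivative p))
    (fun p q => by simp) (fun p q => by simp; ring) (fun p => aeval y p) (fun p q => by simp [Der.leib])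
    (fun p q => by simp [Der.leib, derivative_mul]; ring) (fun a => ?_) ?_ p
  · simp [hcomp]
  · simp

lemma chain3 (y x v : E) (hy : dE.f y = v) (hv : y * (y - 1728) * dE.f v = x * v^2)
    (hx : y * (y - 1728) * dE.f x = v * ((2 * y - 1728) * x - x^2/2 - (y^2 - 1968*y + 2654208))) (p : F[X][X][X]) :
    ev3 F y x v ((Tder dF).f p) = y * (y - 1728) * dE.f (ev3 F y x v p) := by
  have e1 : aeval y (dl F) = y * (y - 1728) := by simp [dl, map_ofNat (algebraMap F E)]
  have e2 : aeval y (nm F) = y^2 - 1968*y + 2654208 := by simp [nm, map_ofNat (algebraMap F E)]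
  have e3 : aeval y (derivative (dl F)) = 2 * y - 1728 := by simp [derivative_dl, map_ofNat (algebraMap F E)]
  have add : ∀ p q : F[X][X][X], ev3 F y x v ((Tder dF).f (p + q)) = ev3 F y x v ((Tder dF).f p) + ev3 F y x v ((Tder dF).f q) := fun p q => by simp
  have add' : ∀ p q : F[X][X][X], y * (y - 1728) * dE.f (ev3 F y x v (p + q)) = y * (y - 1728) * dE.f (ev3 F y x v p) +  y * (y - 1728) * dE.f (ev3 F y x v q) := fun p q => by simp; ring
  have mul : ∀ p q : F[X][X][X], ev3 F y x v ((Tder dF).f (p * q)) = ev3 F y x v p * ev3 F y x v ((Tder dF).f q) + ev3 F y x v ((Tder dF).f p) * ev3 F y x v q := fun p q => by simp [Der.leib]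
  have mul' : ∀ p q : F[X][X][X], y * (y - 1728) * dE.f (ev3 F y x v (p * q)) = ev3 F y x v p * (y * (y - 1728) * dE.f (ev3 F y x v q)) +  y * (y - 1728) * dE.f (ev3 F y x v p) * ev3 F y x v q := fun p q => by simp [Der.leib]; ring
  refine poly_ind (fun p : F[X][X][X] => ev3 F y x v ((Tder dF).f p)) (fun p => y * (y - 1728) * dE.f (ev3 F y x v p))
    add add' (fun p => ev3 F y x v p) mul mul' (fun p => ?_) ?_ p
  · refine poly_ind (fun p : F[X][X] => ev3 F y x v ((Tder dF).f (C p))) (fun p => y * (y - 1728) * dE.f (ev3 F y x v (C p)))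
      (fun p q => by rw [C_add, add]) (fun p q => by rw [C_add, add']) (fun p => ev3 F y x v (C p)) (fun p q => by rw [C_mul, mul])
       (fun p q => by rw [C_mul, mul']) (fun p => ?_) ?_ p
    · simp only [Tder_apply, map_add, map_mul, ev3_C, ev2_C, ev3_X, mapDer_C, e1, chain1 dF dE hcomp, derivative_C, map_zero, mul_zero,
        add_zero, Mder_apply, der_apply, hy]
      ring
    · simp only [Tder_apply, map_add, map_mul, ev3_C, ev2_X, ev2_C, ev3_X, mapDer_C, e1, derivative_C, map_zero, mul_zero,
        add_zero, Mder_apply, der_apply, mapDer_X, derivative_X, map_sub, map_pow, e2, e3, hx, aeval_C]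
      have e4 : algebraMap F E (1/2) = 1/2 := by simp [map_ofNat (algebraMap F E)]
      rw [e4, map_one]
      ring
  · simp only [Tder_apply, map_add, map_mul, ev3_C, ev2_X, ev2_C, ev3_X, mapDer_C, e1, derivative_C, map_zero, mul_zero,
        add_zero, Mder_apply, der_apply, mapDer_X, derivative_X, map_sub, map_pow, hv, map_one]
    ring

lemma chain2 (y x v : E) (hy : dE.f y = v) (hv : y * (y - 1728) * dE.f v = x * v^2)
    (hx : y * (y - 1728) * dE.f x = v * ((2 * y - 1728) * x - x^2/2 - (y^2 - 1968*y + 2654208))) (p : F[X][X]) :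
    y * (y - 1728) * ev2 F y x ((mapDer (mapDer dF)).f p) + v * ev2 F y x ((Mder F).f p) = y * (y - 1728) * dE.f (ev2 F y x p) := by
  have := chain3 dF dE hcomp y x v hy hv hx (C p)
  rw [ev3_C] at this
  rw [← this, Tder_apply]
  simp [dl, map_ofNat (algebraMap F E)]
  ring

/-- Case 2. -/
lemma case2 (y x v : E) (hy : dE.f y = v) (hv : y * (y - 1728) * dE.f v = x * v^2)
    (hx : y * (y - 1728) * dE.f x = v * ((2 * y - 1728) * x - x^2/2 - (y^2 - 1968*y + 2654208)))
    (hv0 : v ≠ 0) (h2 : ∀ p, ev2 F y x p = 0 → p = 0) : ∀ p, ev3 F y x v p = 0 → p = 0 := by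
  by_contra! hne
  obtain ⟨P, hP, hP1, hfP, hdiv⟩ := prime_kernel (ev3 F y x v) (fun p h => h2 p (by simpa using h)) (by
    obtain ⟨p, h1, h2⟩ := hne; exact ⟨p, h2, h1⟩)
  refine case2_alg dF P ?_ hP1 (hdiv _ ?_)
  · intro h
    obtain ⟨t, ht⟩ := X_dvd_iff.2 h
    rcases hP.isUnit_or_isUnit ht with h3 | h3
    · exact not_isUnit_X h3
    · have h4 := h3.map (ev3 F y x v)
      rw [ht, map_mul, ev3_X] at hfP
      rcases mul_eq_zero.1 hfP with h | h
      · exact hv0 h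
      · exact h4.ne_zero h
  · rw [chain3 dF dE hcomp y x v hy hv hx, hfP]; simp

/-- Case 1b. -/
lemma case1b (y x v : E) (hy : dE.f y = v) (hv : y * (y - 1728) * dE.f v = x * v^2)
    (hx : y * (y - 1728) * dE.f x = v * ((2 * y - 1728) * x - x^2/2 - (y^2 - 1968*y + 2654208)))
    (hyt : Transcendental F y)
    (hvt : ∀ p q, y * (y - 1728) * ev2 F y x p + v * ev2 F y x q = 0 → ev2 F y x q = 0) :
    ∀ p, ev2 F y x p = 0 → p = 0 := by
  by_contra! hne
  obtain ⟨P, hP, hP1, hfP, hdiv⟩ := prime_kernel (ev2 F y x) (fun p h => by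
     rw [ev2_C] at h
     by_contra hh
     exact hyt ⟨p, hh, h⟩) (by
    obtain ⟨p, h1, h2⟩ := hne; exact ⟨p, h2, h1⟩)
  have := riccati' P hP.ne_zero (hdiv _ (by
    apply hvt ((mapDer (mapDer dF)).f P)
    rw [chain2 dF dE hcomp y x v hy hv hx, hfP]; simp))
  omega

end
end JEq


open Polynomial
set_option linter.unusedSectionVars false
set_option linter.unusedSimpArgs false

namespace JEq

/-- A discrete place of `K`, trivial on `F`, with algebraic residues, for which the derivation is bounded. -/
structure Place (F K : Type*) [Field F] [Field K] [Algebra F K] (D : Der K) where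
  /-- the order function, with an irrelevant value at zero -/
  ord : K → ℤ
  ord_mul : ∀ x y, x ≠ 0 → y ≠ 0 → ord (x * y) = ord x + ord y
  ord_add : ∀ x y, x ≠ 0 → y ≠ 0 → x + y ≠ 0 → min (ord x) (ord y) ≤ ord (x + y)
  ord_F : ∀ c : F, c ≠ 0 → ord (algebraMap F K c) = 0
  /-- a uniformizer -/
  π : K
  π_ne : π ≠ 0
  ord_π : ord π = 1
  bdd : ∃ d : ℤ, ∀ x, x ≠ 0 → D.f x = 0 ∨ ord x + d ≤ ord (D.f x)
  res : ∀ x, x ≠ 0 → ord x = 0 → ∃ p : F[X], p ≠ 0 ∧ (aeval x p = 0 ∨ 1 ≤ ord (aeval x p))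

namespace Place
variable {F K : Type*} [Field F] [CharZero F] [Field K] [CharZero K] [Algebra F K] {dF : Der F} {D : Der K}
  (hcomp : ∀ c, D.f (algebraMap F K c) = algebraMap F K (dF.f c)) (P : Place F K D)

/-- order at least `n` -/
def O (n : ℤ) (x : K) : Prop := x = 0 ∨ n ≤ P.ord x

variable {P}

lemma O_zero (n : ℤ) : P.O n 0 := Or.inl rfl

lemma O_mono {m n : ℤ} {x : K} (h : P.O n x) (hmn : m ≤ n) : P.O m x := by
  rcases h with h | h
  · exact Or.inl h
  · exact Or.inr (hmn.trans h)

lemma O_mul {m n : ℤ} {x y : K} (h : P.O m x) (h' : P.O n y) : P.O (m + n) (x * y) := by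
  by_cases hx : x = 0
  · left; simp [hx]
  by_cases hy : y = 0
  · left; simp [hy]
  right
  rw [P.ord_mul x y hx hy]
  exact add_le_add (h.resolve_left hx) (h'.resolve_left hy)

lemma O_add {n : ℤ} {x y : K} (h : P.O n x) (h' : P.O n y) : P.O n (x + y) := by
  by_cases hx : x = 0
  · simpa [hx] using h'
  by_cases hy : y = 0
  · simpa [hy] using h
  by_cases hxy : x + y = 0
  · exact Or.inl hxy
  right
  exact (le_min (h.resolve_left hx) (h'.resolve_left hy)).trans (P.ord_add x y hx hy hxy)

lemma O_F (c : F) : P.O 0 (algebraMap F K c) := by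
  by_cases hc : c = 0
  · left; simp [hc]
  · right; rw [P.ord_F c hc]

lemma ord_one : P.ord 1 = 0 := by
  have := P.ord_F 1 one_ne_zero
  simpa using this

lemma ord_inv {x : K} (hx : x ≠ 0) : P.ord x⁻¹ = - P.ord x := by
  have := P.ord_mul x x⁻¹ hx (inv_ne_zero hx)
  rw [mul_inv_cancel₀ hx, ord_one] at this
  omega

lemma ord_div {x y : K} (hx : x ≠ 0) (hy : y ≠ 0) : P.ord (x / y) = P.ord x - P.ord y := by
  rw [div_eq_mul_inv, P.ord_mul _ _ hx (inv_ne_zero hy), ord_inv hy]; rfl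

lemma ord_neg {x : K} (hx : x ≠ 0) : P.ord (-x) = P.ord x := by
  have h1 : P.ord (-1) = 0 := by
    have := P.ord_F (-1) (by simp)
    simpa using this
  rw [neg_eq_neg_one_mul, P.ord_mul _ _ (by simp) hx, h1, zero_add]

lemma O_neg {n : ℤ} {x : K} (h : P.O n x) : P.O n (-x) := by
  by_cases hx : x = 0
  · left; simp [hx]
  right
  rw [ord_neg hx]
  exact h.resolve_left hx

lemma O_sub {n : ℤ} {x y : K} (h : P.O n x) (h' : P.O n y) : P.O n (x - y) := by
  rw [sub_eq_add_neg]; exact O_add h (O_neg h')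

lemma O_self (x : K) : P.O (P.ord x) x := Or.inr le_rfl

lemma O_div {m : ℤ} {x y : K} (h : P.O m x) (hy : y ≠ 0) : P.O (m - P.ord y) (x / y) := by
  rw [div_eq_mul_inv, sub_eq_add_neg, ← ord_inv hy]
  exact O_mul h (O_self _)

lemma O_of_mul {m : ℤ} {x y : K} (h : P.O m (x * y)) (hy : y ≠ 0) : P.O (m - P.ord y) x := by
  have := O_div h hy
  rwa [mul_div_cancel_right₀ _ hy] at this

lemma O_rat (r : ℚ) : P.O 0 (r : K) := by
  have := O_F (P := P) (r : F)
  simpa using this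

lemma rat_eq_zero {r : ℚ} (h : P.O 1 (r : K)) : r = 0 := by
  by_contra hr
  have := P.ord_F (r : F) (by simpa using hr)
  rw [map_ratCast] at this
  rcases h with h | h
  · exact hr (by simpa using h)
  · omega

lemma ord_eq {n : ℤ} {x : K} (h : P.O n x) (h' : ¬ P.O (n+1) x) : x ≠ 0 ∧ P.ord x = n := by
  have hx : x ≠ 0 := by rintro rfl; exact h' (O_zero _)
  refine ⟨hx, ?_⟩
  have h1 := h.resolve_left hx
  have h2 : ¬ (n + 1 ≤ P.ord x) := fun h => h' (Or.inr h)
  omega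

lemma not_O_succ {x : K} (hx : x ≠ 0) {n : ℤ} (hn : P.ord x < n) : ¬ P.O n x := by
  rintro (h | h)
  · exact hx h
  · omega

/-- dominant term -/
lemma ord_eq_of_sub {x y : K} (hy : y ≠ 0) (h : P.O (P.ord y + 1) (x - y)) : x ≠ 0 ∧ P.ord x = P.ord y := by
  apply ord_eq
  · rw [show x = (x - y) + y by ring]
    exact O_add (O_mono h (by omega)) (O_self _)
  · intro h2
    have := O_sub h2 h
    rw [sub_sub_cancel] at this
    exact not_O_succ hy (by omega) this

lemma O_aeval {x : K} (hx : P.O 0 x) (p : F[X]) : P.O 0 (aeval x p) := by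
  induction p using Polynomial.induction_on with
  | C a => simpa using O_F a
  | add p q h h' => rw [map_add]; exact O_add h h'
  | monomial n a h =>
    rw [_root_.pow_succ, ← mul_assoc, map_mul, aeval_X]
    have := O_mul h hx
    simpa using this

lemma ord_zpow {x : K} (hx : x ≠ 0) (n : ℤ) : P.ord (x ^ n) = n * P.ord x := by
  induction n using Int.induction_on with
  | zero => simp [ord_one]
  | succ n ih => rw [zpow_add_one₀ hx, P.ord_mul _ _ (zpow_ne_zero _ hx) hx, ih]; ring
  | pred n ih =>
    rw [zpow_sub_one₀ hx, P.ord_mul _ _ (zpow_ne_zero _ hx) (inv_ne_zero hx), ih, ord_inv hx]; ring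

end Place

lemma Der.inv {K : Type*} [Field K] (D : Der K) (x : K) (hx : x ≠ 0) : D.f x⁻¹ = - D.f x / x^2 := by
  have := D.leib x x⁻¹
  rw [mul_inv_cancel₀ hx, D.one] at this
  field_simp
  field_simp at this
  linear_combination -this

lemma Der.div {K : Type*} [Field K] (D : Der K) (x y : K) (hy : y ≠ 0) : D.f (x / y) = (D.f x * y - x * D.f y) / y^2 := by
  rw [div_eq_mul_inv, D.leib, D.inv y hy]
  field_simp
  ring

lemma Der.zpow {K : Type*} [Field K] (D : Der K) (x : K) (hx : x ≠ 0) (n : ℤ) : D.f (x ^ n) = n * (D.f x / x) * x ^ n := by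
  induction n using Int.induction_on with
  | zero => simp [D.one]
  | succ n ih => rw [zpow_add_one₀ hx, D.leib, ih]; push_cast; field_simp; ring
  | pred n ih => rw [zpow_sub_one₀ hx, D.leib, ih, D.inv x hx]; push_cast; field_simp; ring

lemma Der.rat {K : Type*} [Field K] [CharZero K] (D : Der K) (r : ℚ) : D.f (r : K) = 0 := by
  have h := D.natCast r.den
  have h2 : D.f ((r.num : ℤ) : K) = 0 := by
    rcases Int.eq_nat_or_neg r.num with ⟨n, h | h⟩ <;> rw [h] <;> simp [D.natCast]
  rw [Rat.cast_def, D.div _ _ (by simp), h, h2]; simp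

namespace Place
variable {F K : Type*} [Field F] [CharZero F] [Field K] [CharZero K] [Algebra F K] {dF : Der F} {D : Der K}
  (hcomp : ∀ c, D.f (algebraMap F K c) = algebraMap F K (dF.f c)) (P : Place F K D)

/-- the derivation lowers the order by at most `-d` -/
def Bd (d : ℤ) : Prop := ∀ n x, P.O n x → P.O (n + d) (D.f x)

variable {P}
include hcomp

lemma unit_der {d : ℤ} (hd : d ≤ -1) (hB : P.Bd d) {x : K} (hx : x ≠ 0) (hx0 : P.ord x = 0) : P.O (d + 1) (D.f x) := by
  classical
  let T : Set ℕ := {n | ∃ p : F[X], p ≠ 0 ∧ P.O 1 (aeval x p) ∧ p.natDegree = n}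
  have hT : T.Nonempty := by
    obtain ⟨p, h1, h2⟩ := P.res x hx hx0
    exact ⟨_, p, h1, h2, rfl⟩
  obtain ⟨p, hp0, hfp, hpn⟩ := Nat.sInf_mem hT
  have hOx : P.O 0 x := Or.inr hx0.ge
  have hdeg : 1 ≤ p.natDegree := by
    by_contra h
    have h0 : p.natDegree = 0 := by omega
    rw [eq_C_of_natDegree_eq_zero h0] at hfp hp0
    rw [aeval_C] at hfp
    rw [Ne, C_eq_zero] at hp0
    exact not_O_succ (by simpa using hp0) (by rw [P.ord_F _ hp0]; omega) hfp
  have hder : ¬ P.O 1 (aeval x (derivative p)) := by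
    intro h
    have h1 : derivative p ≠ 0 := by
      intro h0
      have := derivative_eq_zero.1 h0
      omega
    have h2 : (derivative p).natDegree ∈ T := ⟨_, h1, h, rfl⟩
    have h3 := Nat.sInf_le h2
    have h4 := natDegree_derivative_lt (p := p) (by omega)
    omega
  obtain ⟨hn, ho⟩ := ord_eq (O_aeval hOx (derivative p)) hder
  have h1 := hB _ _ hfp
  rw [chain1 dF D hcomp] at h1
  have h2 : P.O (d+1) (D.f x * aeval x (derivative p)) := by
    rw [show D.f x * aeval x (derivative p) = (aeval x ((mapDer dF).f p) + D.f x * aeval x (derivative p)) - aeval x ((mapDer dF).f p) by ring]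
    exact O_sub (O_mono h1 (by omega)) (O_mono (O_aeval hOx _) (by omega))
  have := O_of_mul h2 hn
  rwa [ho, sub_zero] at this

lemma log_der {d : ℤ} (hd : d ≤ -1) (hB : P.Bd d) {x : K} (hx : x ≠ 0) :
    P.O (P.ord x + d + 1) (D.f x - P.ord x * (D.f P.π / P.π) * x) := by
  have hπ := P.π_ne
  set n := P.ord x with hn
  have hpn : P.π ^ n ≠ 0 := zpow_ne_zero _ hπ
  set w := x / P.π ^ n with hw
  have hxw : x = P.π ^ n * w := by rw [hw]; field_simp
  have hw0 : w ≠ 0 := div_ne_zero hx hpn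
  have hwo : P.ord w = 0 := by
    rw [hw, ord_div hx hpn, ord_zpow hπ, P.ord_π]; omega
  have h1 := unit_der hcomp hd hB hw0 hwo
  have h2 := O_mul (O_self (P := P) (P.π ^ n)) h1
  rw [ord_zpow hπ, P.ord_π] at h2
  have : D.f x - n * (D.f P.π / P.π) * x = P.π ^ n * D.f w := by
    rw [hxw, D.leib, D.zpow _ hπ]; ring
  rw [this]
  exact O_mono h2 (by omega)

lemma local_data : P.Bd 0 ∨ ∃ d : ℤ, d ≤ -1 ∧ P.Bd d ∧ ∃ σ : K, σ ≠ 0 ∧ P.ord σ = d ∧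
    ∀ x, x ≠ 0 → P.O (P.ord x + d + 1) (D.f x - P.ord x * σ * x) := by
  by_cases h0 : P.Bd 0
  · exact Or.inl h0
  right
  obtain ⟨c, hc⟩ := P.bdd
  have hBc : P.Bd c := by
    intro n x hx
    by_cases hx0 : x = 0
    · left; simp [hx0]
    rcases hc x hx0 with h | h
    · exact Or.inl h
    · right
      have := hx.resolve_left hx0
      omega
  have key : ∃ d : ℤ, d ≤ -1 ∧ P.Bd d ∧ ¬ P.Bd (d+1) := by
    by_contra! hcon
    have : ∀ k : ℕ, P.Bd (min c 0 + k) ∨ 0 < min c 0 + k := by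
      intro k
      induction k with
      | zero =>
        left
        intro n x hx
        exact O_mono (hBc n x hx) (by have := min_le_left c 0; push_cast; omega)
      | succ k ih =>
        rcases ih with ih | ih
        · by_cases h : min c 0 + k ≤ -1
          · left
            have := hcon _ h ih
            push_cast
            rwa [← add_assoc]
          · right; push_cast; omega
        · right; push_cast; omega
    have h1 := this (min c 0).natAbs
    have h2 : min c 0 + ((min c 0).natAbs : ℤ) = 0 := by
      have := min_le_right c 0
      omega
    rw [h2] at h1
    rcases h1 with h1 | h1
    · exact h0 h1
    · exact lt_irrefl _ h1
  obtain ⟨d, hd, hB, hnB⟩ := key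
  have hlog := fun x (hx : x ≠ 0) => log_der hcomp hd hB hx
  have hσ1 : P.O d (D.f P.π / P.π) := by
    have := O_div (hB 1 P.π (Or.inr P.ord_π.ge)) P.π_ne
    rw [P.ord_π] at this
    exact O_mono this (by omega)
  have hσ2 : ¬ P.O (d+1) (D.f P.π / P.π) := by
    intro h
    apply hnB
    intro n x hx
    by_cases hx0 : x = 0
    · left; simp [hx0]
    have hn := hx.resolve_left hx0
    have h1 := hlog x hx0
    have h2 : P.O (P.ord x + d + 1) ((P.ord x : K) * (D.f P.π / P.π) * x) := by
      have h3 : P.O 0 ((P.ord x : ℤ) : K) := by simpa using O_rat (P := P) ((P.ord x : ℤ) : ℚ)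
      exact O_mono (O_mul (O_mul h3 h) (O_self x)) (by omega)
    have := O_add h1 h2
    rw [sub_add_cancel] at this
    exact O_mono this (by omega)
  obtain ⟨h1, h2⟩ := ord_eq hσ1 hσ2
  exact ⟨d, hd, hB, _, h1, h2, hlog⟩

end Place
end JEq


open Polynomial
set_option linter.unusedSectionVars false
set_option linter.unusedSimpArgs false

namespace JEq
namespace Place
variable {F K : Type*} [Field F] [CharZero F] [Field K] [CharZero K] [Algebra F K] {dF : Der F} {D : Der K}
  (hcomp : ∀ c, D.f (algebraMap F K c) = algebraMap F K (dF.f c)) {P : Place F K D}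

lemma O_int (n : ℤ) : P.O 0 (n : K) := by simpa using O_rat (P := P) (n : ℚ)

lemma ord_int {n : ℤ} (hn : n ≠ 0) : P.ord (n : K) = 0 := by
  have := P.ord_F (n : F) (by simpa using hn)
  simpa using this

include hcomp

lemma singular (η v u Q : K) (q : ℚ) (hq : 1 < 2 * q) (hη : η ≠ 0) (he : P.ord η ≠ 0)
    (hv0 : v ≠ 0) (h1 : D.f η = v) (h2 : D.f v = u * v^2) (h3 : D.f u = - v * (u^2/2 + Q))
    (hQ : P.O 1 (η^2 * Q - q)) : P.Bd 0 := by
  rcases local_data (P := P) hcomp with h | ⟨d, hd, hB, σ, hσ0, hσ, hlog⟩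
  · exact h
  exfalso
  set e := P.ord η with hedef
  have heK : (e : K) ≠ 0 := by simpa using he
  have hse : σ * η ≠ 0 := mul_ne_zero hσ0 hη
  have hose : P.ord (σ * η) = e + d := by rw [P.ord_mul _ _ hσ0 hη, hσ]; omega
  set V := v / (σ * η) with hVdef
  have hV0 : V ≠ 0 := div_ne_zero hv0 hse
  have hV : P.O 1 (V - e) := by
    have := O_div (hlog η hη) hse
    rw [hose, h1] at this
    have e1 : (v - e * σ * η) / (σ * η) = V - e := by rw [hVdef]; field_simp
    rw [e1] at this
    exact O_mono this (by omega)
  have hVo : P.ord V = 0 := by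
    have := (ord_eq_of_sub (P := P) heK (O_mono hV (by rw [ord_int he]; omega))).2
    rw [this, ord_int he]
  have hvo : P.ord v = e + d := by
    have : v = V * (σ * η) := by rw [hVdef]; field_simp
    rw [this, P.ord_mul _ _ hV0 hse, hVo, hose]; omega
  have hvs : v * σ ≠ 0 := mul_ne_zero hv0 hσ0
  have hUV : P.O 1 (u * η * V - ((e + d : ℤ) : K)) := by
    have := O_div (hlog v hv0) hvs
    rw [P.ord_mul _ _ hv0 hσ0, hvo, hσ, h2] at this
    have e1 : (u * v^2 - ((e + d : ℤ) : K) * σ * v) / (v * σ) = u * η * V - ((e + d : ℤ) : K) := by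
      rw [hVdef]; field_simp
    rw [e1] at this
    exact O_mono this (by omega)
  set ρ : ℚ := ((e + d : ℤ) : ℚ) / (e : ℚ) with hρ
  have hρe : (ρ : K) * (e : K) = ((e + d : ℤ) : K) := by
    rw [hρ]; push_cast; field_simp
  set U := u * η with hU
  have hUρ : P.O 1 (U - ρ) := by
    have e1 : (U - ρ) * V = (U * V - ((e + d : ℤ) : K)) - ρ * (V - e) := by
      rw [← hρe]; ring
    have h4 : P.O 1 ((U - ρ) * V) := by
      rw [e1]
      exact O_sub hUV (O_mono (O_mul (O_rat ρ) hV) (by omega))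
    have := O_of_mul h4 hV0
    rwa [hVo, sub_zero] at this
  have hDU : P.O (1 + d) (D.f U) := by
    have := hB _ _ hUρ
    rwa [map_sub, D.rat, sub_zero] at this
  have hvη : v / η ≠ 0 := div_ne_zero hv0 hη
  have hDU2 : D.f U = (U - U^2/2 - η^2 * Q) * (v / η) := by
    rw [hU, D.leib, h1, h3]; field_simp; ring
  rw [hDU2] at hDU
  have h5 := O_of_mul hDU hvη
  rw [ord_div hv0 hη, hvo] at h5
  have h6 : P.O 1 (U - U^2/2 - η^2 * Q) := O_mono h5 (by omega)
  have hUρ2 : P.O 0 (1 - (U + ρ)/2) := by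
    have e2 : 1 - (U + ρ)/2 = (((1 - ρ : ℚ)) : K) - ((1/2 : ℚ) : K) * (U - ρ) := by push_cast; ring
    rw [e2]
    exact O_sub (O_rat _) (O_mono (O_mul (O_rat _) hUρ) (by omega))
  have h7 : P.O 1 (((ρ - ρ^2/2 - q : ℚ)) : K) := by
    have e3 : (((ρ - ρ^2/2 - q : ℚ)) : K) = (U - U^2/2 - η^2 * Q) + (η^2 * Q - q) - (U - ρ) * (1 - (U + ρ)/2) := by
      push_cast; ring
    rw [e3]
    exact O_sub (O_add h6 hQ) (O_mono (O_mul hUρ hUρ2) (by omega))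
  have := rat_eq_zero h7
  nlinarith [sq_nonneg (ρ - 1)]

lemma regular (y v u Q : K) (hy : y ≠ 0) (hy0 : P.ord y = 0)
    (hv0 : v ≠ 0) (h1 : D.f y = v) (h2 : D.f v = u * v^2) (h3 : D.f u = - v * (u^2/2 + Q))
    (hQ : P.O 0 Q) : P.O 0 v := by
  rcases local_data (P := P) hcomp with h | ⟨d, hd, hB, σ, hσ0, hσ, hlog⟩
  · have := h 0 y (Or.inr hy0.ge)
    rwa [h1, add_zero] at this
  by_contra hv
  have hvne : ¬ 0 ≤ P.ord v := fun h => hv (Or.inr h)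
  have hk := (hlog y hy)
  rw [hy0, h1] at hk
  simp only [Int.cast_zero, zero_mul, sub_zero, zero_add] at hk
  have hk1 := hk.resolve_left hv0
  set k := P.ord v with hkdef
  have hkK : (k : K) ≠ 0 := by
    have : k ≠ 0 := by omega
    simpa using this
  have hvs : v * σ ≠ 0 := mul_ne_zero hv0 hσ0
  set W := u * v / σ with hW
  have hWk : P.O 1 (W - k) := by
    have := O_div (hlog v hv0) hvs
    rw [P.ord_mul _ _ hv0 hσ0, ← hkdef, hσ, h2] at this
    have e1 : (u * v^2 - (k : K) * σ * v) / (v * σ) = W - k := by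
      rw [hW]; field_simp
    rw [e1] at this
    exact O_mono this (by omega)
  have hk0 : k ≠ 0 := by omega
  obtain ⟨hW0, hWo⟩ := (ord_eq_of_sub (P := P) hkK (O_mono hWk (by rw [ord_int hk0]; omega)))
  rw [ord_int hk0] at hWo
  have hw : u * v = W * σ := by rw [hW]; field_simp
  have hw0 : u * v ≠ 0 := by rw [hw]; exact mul_ne_zero hW0 hσ0
  have hwo : P.ord (u * v) = d := by rw [hw, P.ord_mul _ _ hW0 hσ0, hWo, hσ]; omega
  have h4 := hlog (u * v) hw0
  rw [hwo] at h4
  have e2 : D.f (u * v) - d * σ * (u * v) + v * v * Q = (W^2/2 - d * W) * (σ * σ) := by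
    rw [D.leib, h2, h3]
    linear_combination (u * v + W * σ) / 2 * hw - d * σ * hw
  have hvv : P.O (d + d + 1) (v * v * Q) :=
    O_mono (O_mul (O_mul (O_self v) (O_self v)) hQ) (by omega)
  have h5 := O_add h4 hvv
  rw [e2] at h5
  have h6 := O_of_mul h5 (mul_ne_zero hσ0 hσ0)
  rw [P.ord_mul _ _ hσ0 hσ0, hσ] at h6
  have hWk2 : P.O 0 ((W + k)/2 - d) := by
    have e3 : (W + k)/2 - d = (((k - d : ℚ)) : K) + ((1/2 : ℚ) : K) * (W - k) := by push_cast; ring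
    rw [e3]
    exact O_add (O_rat _) (O_mono (O_mul (O_rat _) hWk) (by omega))
  have h7 : P.O 1 ((((k:ℚ)^2/2 - d * k : ℚ)) : K) := by
    have e3 : ((((k:ℚ)^2/2 - d * k : ℚ)) : K) = (W^2/2 - d * W) - (W - k) * ((W + k)/2 - d) := by
      push_cast; ring
    rw [e3]
    exact O_sub (O_mono h6 (by omega)) (O_mono (O_mul hWk hWk2) (by omega))
  have h8 := rat_eq_zero h7
  have h9 : (k : ℚ) ≠ 0 := by exact_mod_cast hk0
  have h10 : (k : ℚ) * (k - 2 * d) = 0 := by linear_combination 2 * h8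
  have h11 := (mul_eq_zero.1 h10).resolve_left h9
  have h12 : k - 2 * d = 0 := by exact_mod_cast h11
  omega

end Place
end JEq


open Polynomial
set_option linter.unusedSectionVars false
set_option linter.unusedSimpArgs false

namespace JEq
namespace Place
variable {F K : Type*} [Field F] [CharZero F] [Field K] [CharZero K] [Algebra F K] {dF : Der F} {D : Der K}
  (hcomp : ∀ c, D.f (algebraMap F K c) = algebraMap F K (dF.f c)) {P : Place F K D}

lemma ord_sub_rat {y : K} {r : ℚ} (hr : r ≠ 0) (h : 0 < P.ord y) (hy : y ≠ 0): P.ord (y - r) = 0 ∧ y - r ≠ 0 := by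
  have hrK : (-r : K) ≠ 0 := by simpa using hr
  have ho : P.ord (-r : K) = 0 := by
    rw [ord_neg (by simpa using hr)]
    have := P.ord_F (r : F) (by simpa using hr)
    simpa using this
  have := ord_eq_of_sub (P := P) (x := y - r) (y := -r) hrK (by
    rw [ho]; right
    rw [show y - r - -r = y by ring]; omega)
  exact ⟨this.2.trans ho, this.1⟩

lemma ord_sub_rat_neg {y : K} {r : ℚ} (h : P.ord y < 0) (hy : y ≠ 0) : P.ord (y - r) = P.ord y ∧ y - r ≠ 0 := by
  have := ord_eq_of_sub (P := P) (x := y - r) (y := y) hy (by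
    rw [show y - r - y = ((-r : ℚ) : K) by push_cast; ring]
    exact O_mono (O_rat _) (by omega))
  exact ⟨this.2, this.1⟩

include hcomp

lemma main_bound (y v u : K) (hy : y ≠ 0) (hy' : y ≠ 1728) (hv0 : v ≠ 0) (h1 : D.f y = v) (h2 : D.f v = u * v^2)
    (h3 : D.f u = - v * (u^2/2 + (y^2 - 1968*y + 2654208) / (y * (y - 1728))^2)) :
    P.O 0 (v / (y * (y - 1728))) ∧ (P.ord y < 0 → P.O 1 (v / (y * (y - 1728)))) := by
  have hyd : y - 1728 ≠ 0 := sub_ne_zero.2 hy'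
  have hδ : y * (y - 1728) ≠ 0 := mul_ne_zero hy hyd
  rcases lt_trichotomy (P.ord y) 0 with h | h | h
  · have ho := (ord_sub_rat_neg (P := P) (r := 1728) h hy).1
    push_cast at ho
    have hB := singular (P := P) hcomp y v u _ 1 (by norm_num) hy h.ne hv0 h1 h2 h3 (by
      rw [show y^2 * ((y^2 - 1968*y + 2654208) / (y * (y - 1728))^2) - ((1 : ℚ) : K) = (((1488 : ℚ) : K) * y - ((331776 : ℚ) : K)) / ((y - 1728) * (y - 1728)) by
        push_cast; field_simp; ring]
      have : P.O (P.ord y) (((1488 : ℚ) : K) * y - ((331776 : ℚ) : K)) :=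
        O_sub (O_mono (O_mul (O_rat _) (O_self y)) (by omega)) (O_mono (O_rat _) (by omega))
      refine O_mono (O_div this (mul_ne_zero hyd hyd)) ?_
      rw [P.ord_mul _ _ hyd hyd, ho]; omega)
    have hv : P.O (P.ord y) v := by
      have := hB _ _ (O_self y)
      rwa [h1, add_zero] at this
    have := O_div hv hδ
    rw [P.ord_mul _ _ hy hyd, ho] at this
    exact ⟨O_mono this (by omega), fun _ => O_mono this (by omega)⟩
  · refine ⟨?_, fun h' => absurd h' (by omega)⟩
    have hO : P.O 0 (y - 1728) := by
      have := O_sub (P := P) (Or.inr h.ge : P.O 0 y) (O_rat 1728)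
      exact_mod_cast this
    have hO' := hO.resolve_left hyd
    by_cases hpos : 0 < P.ord (y - 1728)
    · have hB := singular (P := P) hcomp (y - 1728) v u _ (3/4) (by norm_num) hyd hpos.ne' hv0 (by
          rw [map_sub, D.ofNat, h1, sub_zero]) h2 h3 (by
        rw [show (y - 1728)^2 * ((y^2 - 1968*y + 2654208) / (y * (y - 1728))^2) - ((3/4 : ℚ) : K) = ((y - 1728) * (((1/4 : ℚ) : K) * y + ((-1536 : ℚ) : K))) / (y * y) by
          push_cast; field_simp; ring]
        have : P.O 1 ((y - 1728) * (((1/4 : ℚ) : K) * y + ((-1536 : ℚ) : K))) := by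
          have h6 : P.O 0 (((1/4 : ℚ) : K) * y + ((-1536 : ℚ) : K)) :=
            O_add (O_mono (O_mul (O_rat _) (O_self y)) (by omega)) (O_mono (O_rat _) (by omega))
          exact O_mono (O_mul (O_self _) h6) (by omega)
        refine O_mono (O_div this (mul_ne_zero hy hy)) ?_
        rw [P.ord_mul _ _ hy hy]; omega)
      have hv : P.O (P.ord (y - 1728)) v := by
        have := hB _ _ (O_self (y - 1728))
        rwa [map_sub, D.ofNat, h1, add_zero, sub_zero] at this
      have := O_div hv hδ
      rw [P.ord_mul _ _ hy hyd] at this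
      exact O_mono this (by omega)
    · have hz : P.ord (y - 1728) = 0 := by omega
      have hv := regular (P := P) hcomp y v u _ hy h hv0 h1 h2 h3 (by
        have h7 : P.O 0 (y^2 - 1968*y + 2654208) := by
          rw [show y^2 - 1968*y + 2654208 = y * y - (((1968 : ℚ) : K) * y) + ((2654208 : ℚ) : K) by push_cast; ring]
          exact O_add (O_sub (O_mono (O_mul (O_self _) (O_self _)) (by omega)) (O_mono (O_mul (O_rat _) (O_self _)) (by omega))) (O_rat _)
        rw [pow_two (y * (y - 1728))]
        refine O_mono (O_div h7 (mul_ne_zero hδ hδ)) ?_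
        rw [P.ord_mul _ _ hδ hδ, P.ord_mul _ _ hy hyd]; omega)
      have := O_div hv hδ
      rw [P.ord_mul _ _ hy hyd] at this
      exact O_mono this (by omega)
  · refine ⟨?_, fun h' => absurd h' (by omega)⟩
    have ho := (ord_sub_rat (P := P) (r := 1728) (by norm_num) h hy).1
    push_cast at ho
    have hB := singular (P := P) hcomp y v u _ (8/9) (by norm_num) hy h.ne' hv0 h1 h2 h3 (by
      rw [show y^2 * ((y^2 - 1968*y + 2654208) / (y * (y - 1728))^2) - ((8/9 : ℚ) : K) = (y * (((1/9 : ℚ) : K) * y + ((1104 : ℚ) : K))) / ((y - 1728) * (y - 1728)) by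
        push_cast; field_simp; ring]
      have : P.O 1 (y * (((1/9 : ℚ) : K) * y + ((1104 : ℚ) : K))) := by
        have h6 : P.O 0 (((1/9 : ℚ) : K) * y + ((1104 : ℚ) : K)) :=
          O_add (O_mono (O_mul (O_rat _) (O_self y)) (by omega)) (O_mono (O_rat _) (by omega))
        exact O_mono (O_mul (O_self _) h6) (by omega)
      refine O_mono (O_div this (mul_ne_zero hyd hyd)) ?_
      rw [P.ord_mul _ _ hyd hyd, ho]; omega)
    have hv : P.O (P.ord y) v := by
      have := hB _ _ (O_self y)
      rwa [h1, add_zero] at this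
    have := O_div hv hδ
    rw [P.ord_mul _ _ hy hyd, ho] at this
    exact O_mono this (by omega)

end Place
end JEq


open Polynomial IsDedekindDomain
open scoped WithZero
set_option linter.unusedSectionVars false
set_option linter.unusedSimpArgs false

namespace JEq

section
variable {F K : Type*} [Field F] [CharZero F] [Field K] [CharZero K] [Algebra F K]

lemma val_aeval {R : Type*} [CommRing R] [Algebra R K] (v : Valuation K ℤᵐ⁰) (hF : ∀ c : R, v (algebraMap R K c) ≤ 1) {x : K} (hx : v x ≤ 1) (p : R[X]) :
    v (aeval x p) ≤ 1 := by
  induction p using Polynomial.induction_on with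
  | C a => simpa using hF a
  | add p q h h' => rw [map_add]; exact (v.map_add _ _).trans (max_le h h')
  | monomial n a h =>
    rw [_root_.pow_succ, ← mul_assoc, map_mul, aeval_X, map_mul]
    exact mul_le_one' h hx

lemma res_val (hfin : ∀ w : K, Transcendental F w → Algebra.IsAlgebraic (IntermediateField.adjoin F {w}) K)
    (v : Valuation K ℤᵐ⁰) (hF : ∀ c : F, v (algebraMap F K c) ≤ 1) (π : K) (hπ0 : π ≠ 0) (hπ : v π < 1)
    (x : K) (hx : v x ≤ 1) : ∃ p : F[X], p ≠ 0 ∧ v (aeval x p) < 1 := by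
  by_contra! hcon
  have hx2 : Transcendental F x := by
    rintro ⟨p, hp, h⟩
    have := hcon p hp
    rw [h, map_zero] at this
    exact absurd this (by simp)
  have h1 := (hfin x hx2).isAlgebraic π
  have h2 : IsAlgebraic (Algebra.adjoin F {x}) π := by
    open scoped IntermediateField.algebraAdjoinAdjoin in
    exact (IsFractionRing.isAlgebraic_iff (Algebra.adjoin F {x}) (IntermediateField.adjoin F {x}) K).2 h1
  obtain ⟨q, hq0, hq⟩ := h2.exists_nonzero_coeff_and_aeval_eq_zero (mem_nonZeroDivisors_of_ne_zero hπ0)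
  have hA : ∀ a : Algebra.adjoin F {x}, ∃ p : F[X], (a : K) = aeval x p := by
    rintro ⟨a, ha⟩
    rw [Algebra.adjoin_singleton_eq_range_aeval] at ha
    obtain ⟨p, hp⟩ := ha
    exact ⟨p, hp.symm⟩
  have hA1 : ∀ a : Algebra.adjoin F {x}, v (algebraMap (Algebra.adjoin F {x}) K a) ≤ 1 := by
    intro a
    change v (a : K) ≤ 1
    obtain ⟨p, hp⟩ := hA a
    rw [hp]; exact val_aeval v hF hx p
  have hB : ∀ q : (Algebra.adjoin F {x})[X], v (aeval π q) ≤ 1 := fun q => val_aeval v hA1 hπ.le q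
  have h3 := divX_mul_X_add q
  apply_fun (aeval π) at h3
  rw [hq, map_add, map_mul, aeval_X, aeval_C] at h3
  obtain ⟨p, hp⟩ := hA (q.coeff 0)
  have hp0 : p ≠ 0 := by
    rintro rfl
    rw [map_zero] at hp
    exact hq0 (by exact_mod_cast hp)
  have h4 := hcon p hp0
  have h5 : aeval x p = - (aeval π q.divX * π) := by
    rw [← hp]
    change algebraMap (Algebra.adjoin F {x}) K (q.coeff 0) = _
    linear_combination h3
  rw [h5, Valuation.map_neg, map_mul] at h4
  have h6 : v (aeval π q.divX) * v π < 1 := by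
    calc _ ≤ 1 * v π := mul_le_mul_left (hB _) _
      _ < 1 := by simpa using hπ
  exact absurd h4 (not_le.2 h6)

lemma bdd_val {B : Type*} [CommRing B] [IsDedekindDomain B] [Algebra B K] [IsFractionRing B K] (D : Der K)
    (v : HeightOneSpectrum B) (π : K) (hπ : v.valuation K π = WithZero.exp (-1))
    (hZ : ∀ n : ℤ, v.valuation K (n : K) ≤ 1) (g : ℤᵐ⁰)
    (hg : ∀ b : B, v.valuation K (D.f (algebraMap B K b)) ≤ g) :
    ∃ M : ℤᵐ⁰, M ≠ 0 ∧ ∀ x, v.valuation K (D.f x) ≤ M * v.valuation K x := by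
  have hπ0 : π ≠ 0 := by rintro rfl; rw [map_zero] at hπ; exact WithZero.exp_ne_zero hπ.symm
  have h1 : ∀ x, v.valuation K x ≤ 1 → v.valuation K (D.f x) ≤ g := by
    intro x hx
    obtain ⟨n, d, hnd⟩ := v.exists_primeCompl_mul_eq_of_integer x hx
    have hd : v.valuation K (algebraMap B K d) = 1 := by
      rw [v.valuation_of_algebraMap]
      exact (v.intValuation_eq_one_iff_mem_primeCompl d).2 d.2
    have h2 : D.f x * algebraMap B K d = D.f (algebraMap B K n) - x * D.f (algebraMap B K d) := by
      rw [← hnd, D.leib]; ring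
    have h3 : v.valuation K (D.f x) = v.valuation K (D.f x * algebraMap B K d) := by
      rw [map_mul, hd, mul_one]
    rw [h3, h2]
    refine (Valuation.map_sub _ _ _).trans (max_le (hg _) ?_)
    rw [map_mul]
    calc _ ≤ 1 * g := mul_le_mul' hx (hg _)
      _ = g := one_mul _
  refine ⟨max (max g 1) (v.valuation K (D.f π / π)), ?_, ?_⟩
  · intro h
    have : (1 : ℤᵐ⁰) ≤ 0 := by rw [← h]; exact (le_max_right _ _).trans (le_max_left _ _)
    exact absurd this (by simp)
  intro x
  by_cases hx : x = 0
  · simp [hx]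
  set k := - WithZero.log (v.valuation K x) with hk
  have hvx : v.valuation K x ≠ 0 := by simpa using hx
  have hpk : v.valuation K (π ^ k) = v.valuation K x := by
    rw [map_zpow₀, hπ, ← WithZero.exp_zsmul, hk]
    simp [WithZero.exp_log hvx]
  have hpk0 : π ^ k ≠ 0 := zpow_ne_zero _ hπ0
  set w := x / π ^ k with hw
  have hxw : x = π ^ k * w := by rw [hw]; field_simp
  have hvw : v.valuation K w = 1 := by
    rw [hw, map_div₀, hpk, div_self hvx]
  have e : D.f x = k * (D.f π / π) * x + π ^ k * D.f w := by
    rw [hxw, D.leib, D.zpow _ hπ0]; ring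
  rw [e]
  refine (Valuation.map_add _ _ _).trans (max_le ?_ ?_)
  · rw [map_mul, map_mul]
    refine mul_le_mul' ?_ le_rfl
    calc _ ≤ 1 * v.valuation K (D.f π / π) := mul_le_mul' (hZ k) le_rfl
      _ = _ := one_mul _
      _ ≤ _ := le_max_right _ _
  · rw [map_mul, hpk, mul_comm]
    refine mul_le_mul' ?_ le_rfl
    exact (h1 w hvw.le).trans ((le_max_left _ _).trans (le_max_left _ _))

lemma mk_place (hfin : ∀ w : K, Transcendental F w → Algebra.IsAlgebraic (IntermediateField.adjoin F {w}) K)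
    {B : Type*} [CommRing B] [IsDedekindDomain B] [Algebra B K] [IsFractionRing B K] (D : Der K)
    (v : HeightOneSpectrum B) (hF : ∀ c : F, v.valuation K (algebraMap F K c) ≤ 1) (g : ℤᵐ⁰)
    (hg : ∀ b : B, v.valuation K (D.f (algebraMap B K b)) ≤ g) (z : K) (hz : v.valuation K z < 1) (hz0 : z ≠ 0) :
    ∃ P : Place F K D, 1 ≤ P.ord z := by
  obtain ⟨π, hπ⟩ := v.valuation_exists_uniformizer K
  have hπ0 : π ≠ 0 := by rintro rfl; rw [map_zero] at hπ; exact WithZero.exp_ne_zero hπ.symm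
  obtain ⟨M, hM0, hM⟩ := bdd_val D v π hπ (fun n => by simpa using hF n) g hg
  have hne : ∀ x : K, x ≠ 0 → v.valuation K x ≠ 0 := fun x hx => by simpa using hx
  have hlt : ∀ x : K, v.valuation K x < 1 → x = 0 ∨ 1 ≤ - WithZero.log (v.valuation K x) := by
    intro x hx
    by_cases hx0 : x = 0
    · exact Or.inl hx0
    right
    have := (WithZero.log_lt_log (hne x hx0) one_ne_zero).2 hx
    rw [WithZero.log_one] at this
    omega
  refine ⟨{ ord := fun x => - WithZero.log (v.valuation K x)
            ord_mul := fun x y hx hy => by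
              rw [map_mul, WithZero.log_mul (hne x hx) (hne y hy)]; omega
            ord_add := fun x y hx hy hxy => by
              have h := (v.valuation K).map_add x y
              rcases le_max_iff.1 h with h | h
              · have := (WithZero.log_le_log (hne _ hxy) (hne x hx)).2 h
                exact (min_le_left _ _).trans (by omega)
              · have := (WithZero.log_le_log (hne _ hxy) (hne y hy)).2 h
                exact (min_le_right _ _).trans (by omega)
            ord_F := fun c hc => by
              have h1 := hF c
              have h2 := hF c⁻¹
              have h3 : v.valuation K (algebraMap F K c) = 1 := by
                refine le_antisymm h1 ?_
                rw [map_inv₀, map_inv₀] at h2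
                exact (inv_le_one₀ (zero_lt_iff.2 (hne _ (by simpa using hc)))).1 h2
              rw [h3]; simp
            π := π
            π_ne := hπ0
            ord_π := by rw [hπ]; simp
            bdd := by
              refine ⟨- WithZero.log M, fun x hx => ?_⟩
              by_cases h : D.f x = 0
              · exact Or.inl h
              right
              have := (WithZero.log_le_log (hne _ h) (mul_ne_zero hM0 (hne x hx))).2 (hM x)
              rw [WithZero.log_mul hM0 (hne x hx)] at this
              omega
            res := by
              intro x hx h
              have h1 : v.valuation K x = 1 := by
                rw [← WithZero.exp_log (hne x hx)]
                rw [neg_eq_zero] at h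
                rw [h]; simp
              obtain ⟨p, hp, hp2⟩ := res_val hfin (v.valuation K) hF π hπ0 (by rw [hπ, ← WithZero.exp_zero, WithZero.exp_lt_exp]; omega) x h1.le
              exact ⟨p, hp, hlt _ hp2⟩ }, (hlt z hz).resolve_left hz0⟩

end
end JEq


open Polynomial IsDedekindDomain
open scoped WithZero
set_option linter.unusedSectionVars false
set_option linter.unusedSimpArgs false

namespace JEq

section
variable {F K : Type*} [Field F] [CharZero F] [Field K] [CharZero K] [Algebra F K] {dF : Der F} {D : Der K}
  (hcomp : ∀ c, D.f (algebraMap F K c) = algebraMap F K (dF.f c))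
include hcomp

open scoped IntermediateField.algebraAdjoinAdjoin in
lemma exists_place (hfin : ∀ w : K, Transcendental F w → FiniteDimensional (IntermediateField.adjoin F {w}) K)
    (z : K) (hz : Transcendental F z) : ∃ P : Place F K D, 1 ≤ P.ord z := by
  have hz0 : z ≠ 0 := by rintro rfl; exact hz isAlgebraic_zero
  let A := Algebra.adjoin F {z}
  let K0 := IntermediateField.adjoin F {z}
  have hA : ∀ a : A, ∃ p : F[X], (a : K) = aeval z p := by
    rintro ⟨a, ha⟩
    have ha' : a ∈ Algebra.adjoin F {z} := ha
    rw [Algebra.adjoin_singleton_eq_range_aeval] at ha'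
    obtain ⟨p, hp⟩ := ha'
    exact ⟨p, hp.symm⟩
  have hzA : z ∈ A := Algebra.self_mem_adjoin_singleton F z
  have : IsPrincipalIdealRing A := by
    let f : F[X] →ₐ[F] A := aeval (⟨z, hzA⟩ : A)
    refine IsPrincipalIdealRing.of_surjective f.toRingHom ?_
    intro a
    obtain ⟨p, hp⟩ := hA a
    refine ⟨p, Subtype.ext ?_⟩
    rw [hp]
    change (A.val (aeval (⟨z, hzA⟩ : A) p)) = _
    rw [← aeval_algHom_apply]; rfl
  have : FiniteDimensional K0 K := hfin z hz
  have : Algebra.IsSeparable K0 K := inferInstance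
  have : IsDedekindDomain A := inferInstance
  let B := integralClosure A K
  have : IsDedekindDomain B := integralClosure.isDedekindDomain A K0 K
  have : IsFractionRing B K := integralClosure.isFractionRing_of_finite_extension K0 K
  have hBf : Module.Finite A B := IsIntegralClosure.finite A K0 K B
  let zB : B := algebraMap A B ⟨z, hzA⟩
  have hzB : algebraMap B K zB = z := rfl
  have hnu : ¬ IsUnit zB := by
    intro hu
    obtain ⟨c, hc⟩ := hu.exists_right_inv
    have h1 : (c : K) = z⁻¹ := by
      have := congrArg (algebraMap B K) hc
      rw [map_mul, map_one, hzB] at this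
      exact (inv_eq_of_mul_eq_one_right this).symm
    have h2 : IsIntegral A (z⁻¹) := by rw [← h1]; exact c.2
    have h3 : IsIntegral A ((algebraMap A K0 ⟨z, hzA⟩)⁻¹) := by
      rw [← isIntegral_algebraMap_iff (B := K) (algebraMap K0 K).injective, map_inv₀]
      exact h2
    obtain ⟨a, ha⟩ := (IsIntegrallyClosed.isIntegral_iff (R := A) (K := K0)).1 h3
    have h4 : (a : K) = z⁻¹ := by
      have := congrArg (algebraMap K0 K) ha
      rw [map_inv₀] at this
      exact this
    obtain ⟨p, hp⟩ := hA a
    rw [hp] at h4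
    refine hz ⟨X * p - 1, ?_, ?_⟩
    · intro h
      have := congrArg (eval 0) h
      simp at this
    · rw [map_sub, map_mul, aeval_X, h4, map_one, mul_inv_cancel₀ hz0, sub_self]
  obtain ⟨𝔪, hm, hzm⟩ := exists_max_ideal_of_mem_nonunits hnu
  have hzB0 : zB ≠ 0 := by
    intro h
    apply hz0
    rw [← hzB, h, map_zero]
  let v : HeightOneSpectrum B := ⟨𝔪, hm.isPrime, by
    intro h
    rw [h] at hzm
    exact hzB0 hzm⟩
  have hvB : ∀ b : B, v.valuation K (b : K) ≤ 1 := fun b => v.valuation_le_one b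
  have hvA : ∀ a : A, v.valuation K (a : K) ≤ 1 := fun a => hvB (algebraMap A B a)
  have hF : ∀ c : F, v.valuation K (algebraMap F K c) ≤ 1 := fun c => hvA (algebraMap F A c)
  have hvz : v.valuation K z < 1 := (v.valuation_lt_one_iff_mem zB).2 hzm
  obtain ⟨s, hs⟩ := hBf.fg_top
  classical
  let g : ℤᵐ⁰ := max (max 1 (v.valuation K (D.f z))) (s.sup (fun b => v.valuation K (D.f (b : K))))
  have hgA : ∀ a : A, v.valuation K (D.f (a : K)) ≤ g := by
    intro a
    obtain ⟨p, hp⟩ := hA a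
    rw [hp, chain1 dF D hcomp]
    refine le_trans (le_trans (Valuation.map_add _ _ _) (max_le_max (val_aeval _ hF hvz.le _) ?_)) (le_max_left _ _)
    rw [map_mul]
    calc _ ≤ v.valuation K (D.f z) * 1 := mul_le_mul' le_rfl (val_aeval _ hF hvz.le _)
      _ = _ := mul_one _
  have hgB : ∀ b : B, v.valuation K (D.f (algebraMap B K b)) ≤ g := by
    intro b
    have hb : b ∈ Submodule.span A (s : Set B) := by rw [hs]; trivial
    induction hb using Submodule.span_induction with
    | mem b hb => exact le_trans (Finset.le_sup (f := fun b : B => v.valuation K (D.f (b : K))) hb) (le_max_right _ _)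
    | zero => simp
    | add b c _ _ hb hc =>
      rw [map_add, map_add]
      exact (Valuation.map_add _ _ _).trans (max_le hb hc)
    | smul a b _ hb =>
      have e : algebraMap B K (a • b) = (a : K) * algebraMap B K b := by
        rw [Algebra.smul_def, map_mul]; rfl
      rw [e, D.leib]
      refine (Valuation.map_add _ _ _).trans (max_le ?_ ?_)
      · rw [map_mul]
        calc _ ≤ 1 * g := mul_le_mul' (hvA a) hb
          _ = g := one_mul _
      · rw [map_mul]
        calc _ ≤ g * 1 := mul_le_mul' (hgA a) (hvB b)
          _ = g := mul_one _
  exact mk_place (fun w hw => have := hfin w hw; inferInstance) D v hF g hgB z hvz hz0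

/-- Case 1a, intrinsic form. -/
lemma case1a_field (hfin : ∀ w : K, Transcendental F w → FiniteDimensional (IntermediateField.adjoin F {w}) K)
    (y v u : K) (hyt : Transcendental F y) (hv0 : v ≠ 0) (h1 : D.f y = v) (h2 : D.f v = u * v^2)
    (h3 : D.f u = - v * (u^2/2 + (y^2 - 1968*y + 2654208) / (y * (y - 1728))^2)) : False := by
  have hy : y ≠ 0 := by rintro rfl; exact hyt isAlgebraic_zero
  have hy' : y ≠ 1728 := by
    rintro rfl
    apply hyt
    have := isAlgebraic_algebraMap (R := F) (A := K) 1728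
    rwa [map_ofNat] at this
  have hz0 : v / (y * (y - 1728)) ≠ 0 := div_ne_zero hv0 (mul_ne_zero hy (sub_ne_zero.2 hy'))
  have hb := fun P : Place F K D => Place.main_bound (P := P) hcomp y v u hy hy' hv0 h1 h2 h3
  set z := v / (y * (y - 1728)) with hz
  have hneg : ∀ w : K, Transcendental F w → ∃ P : Place F K D, P.ord w < 0 := by
    intro w hw
    have hw0 : w ≠ 0 := by rintro rfl; exact hw isAlgebraic_zero
    obtain ⟨P, hP⟩ := exists_place hcomp hfin w⁻¹ (fun h => hw (by simpa using h.inv))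
    refine ⟨P, ?_⟩
    rw [Place.ord_inv hw0] at hP
    omega
  by_cases hzt : IsAlgebraic F z
  · obtain ⟨P, hP⟩ := hneg y hyt
    have h4 := (hb P).2 hP
    obtain ⟨q, hq0, hq⟩ := hzt.exists_nonzero_coeff_and_aeval_eq_zero (mem_nonZeroDivisors_of_ne_zero hz0)
    have h5 := divX_mul_X_add q
    apply_fun (aeval z) at h5
    rw [hq, map_add, map_mul, aeval_X, aeval_C] at h5
    have h6 : P.O 1 (algebraMap F K (q.coeff 0)) := by
      rw [show algebraMap F K (q.coeff 0) = -(aeval z q.divX * z) by linear_combination h5]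
      exact Place.O_neg (Place.O_mono (Place.O_mul (Place.O_aeval (hb P).1 _) h4) (by omega))
    exact Place.not_O_succ (by simpa using hq0) (by rw [P.ord_F _ hq0]; omega) h6
  · obtain ⟨P, hP⟩ := hneg z hzt
    exact Place.not_O_succ hz0 hP (hb P).1

end
end JEq


open Polynomial
set_option linter.unusedSectionVars false
set_option linter.unusedSimpArgs false

namespace JEq

lemma algInd_of_ev3 {F E : Type*} [Field F] [CharZero F] [Field E] [Algebra F E] (y x v : E)
    (h : ∀ p, ev3 F y x v p = 0 → p = 0) : AlgebraicIndependent F ![y, x, v] := by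
  rw [algebraicIndependent_iff]
  intro p hp
  let φ : MvPolynomial (Fin 3) F →ₐ[F] F[X][X][X] := MvPolynomial.aeval (![C (C X), C X, X] : Fin 3 → F[X][X][X])
  let ψ : F[X][X][X] →+* MvPolynomial (Fin 3) F :=
    eval₂RingHom (eval₂RingHom (eval₂RingHom (MvPolynomial.C) (MvPolynomial.X 0)) (MvPolynomial.X 1)) (MvPolynomial.X 2)
  have h1 : ψ.comp φ.toRingHom = RingHom.id _ := by
    apply MvPolynomial.ringHom_ext
    · intro r
      have : φ (MvPolynomial.C r) = C (C (C r)) := by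
        rw [← MvPolynomial.algebraMap_eq, AlgHom.commutes]; rfl
      simp [this, ψ]
    · intro i
      fin_cases i <;> simp [φ, ψ]
  have h2 : (ev3 F y x v).comp φ.toRingHom = (MvPolynomial.aeval ![y, x, v] : MvPolynomial (Fin 3) F →ₐ[F] E).toRingHom := by
    apply MvPolynomial.ringHom_ext
    · intro r
      have : φ (MvPolynomial.C r) = C (C (C r)) := by
        rw [← MvPolynomial.algebraMap_eq, AlgHom.commutes]; rfl
      simp [this]
    · intro i
      fin_cases i <;> simp [φ]
  have h3 : φ p = 0 := by
    apply h
    have := congrArg (fun f => f p) h2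
    simpa [hp] using this
  have := congrArg (fun f => f p) h1
  simpa [h3] using this.symm

lemma algInd_swap {F E : Type*} [Field F] [Field E] [Algebra F E] (y x v w : E) (hv : v ≠ 0)
    (hx : x = y * (y - 1728) * w / v^2)
    (h : AlgebraicIndependent F ![y, x, v]) : AlgebraicIndependent F ![y, v, w] := by
  let S : Set E := {y, v, w}
  let K := IntermediateField.adjoin F S
  have mS : ∀ s ∈ S, s ∈ K := fun s hs => IntermediateField.subset_adjoin F S hs
  let y' : K := ⟨y, mS y (by simp [S])⟩
  let v' : K := ⟨v, mS v (by simp [S])⟩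
  let w' : K := ⟨w, mS w (by simp [S])⟩
  let x' : K := y' * (y' - 1728) * w' / v'^2
  have hx' : (x' : E) = x := by rw [hx]; rfl
  have hi : AlgebraicIndependent F ![y', x', v'] := by
    apply AlgebraicIndependent.of_comp K.val
    convert h using 1
    funext i
    fin_cases i
    · rfl
    · exact hx'
    · rfl
  have halg : Algebra.IsAlgebraic (Algebra.adjoin F (Set.range ![y', v', w'])) K := by
    constructor
    rintro ⟨k, hk⟩
    induction hk using IntermediateField.adjoin_induction with
    | mem s hs =>
      have : (⟨s, mS s hs⟩ : K) ∈ Algebra.adjoin F (Set.range ![y', v', w']) := by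
        apply Algebra.subset_adjoin
        rcases hs with rfl | rfl | rfl
        · exact ⟨0, rfl⟩
        · exact ⟨1, rfl⟩
        · exact ⟨2, rfl⟩
      exact isAlgebraic_algebraMap (⟨_, this⟩ : Algebra.adjoin F (Set.range ![y', v', w']))
    | algebraMap r =>
      exact isAlgebraic_algebraMap (algebraMap F (Algebra.adjoin F (Set.range ![y', v', w'])) r)
    | add a b ha hb iha ihb => exact iha.add ihb
    | mul a b ha hb iha ihb => exact iha.mul ihb
    | inv a ha iha => exact iha.inv
  have hb := Algebra.IsAlgebraic.isTranscendenceBasis_of_lift_le_trdeg_of_finite F ![y', v', w'] hi.lift_cardinalMk_le_trdeg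
  have := hb.1.map' (f := K.val) K.val.injective
  convert this using 1
  funext i
  fin_cases i <;> rfl

/-- the `F[X]`-algebra structure given by evaluation -/
@[reducible] noncomputable def algX (F : Type*) {E : Type*} [Field F] [Field E] [Algebra F E] (y : E) : Algebra F[X] E :=
  (aeval y : F[X] →ₐ[F] E).toRingHom.toAlgebra

section
variable {F E : Type*} [Field F] [CharZero F] [Field E] [CharZero E] [Algebra F E]

lemma hfin_aux (y u v : E) (hyt : Transcendental F y)
    (hu : @IsAlgebraic F[X] E _ _ (algX F y) u) (hv : @IsAlgebraic F[X] E _ _ (algX F y) v)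
    (w : IntermediateField.adjoin F {y, u, v})
    (hw : Transcendental F w) : FiniteDimensional (IntermediateField.adjoin F {w}) (IntermediateField.adjoin F {y, u, v}) := by
  have hyK : y ∈ IntermediateField.adjoin F {y, u, v} := IntermediateField.subset_adjoin F _ (by simp)
  let y' : IntermediateField.adjoin F {y, u, v} := ⟨y, hyK⟩
  let := algX F y
  let := algX F y'
  have t1 : IsScalarTower F[X] (IntermediateField.adjoin F {y, u, v}) E := IsScalarTower.of_algebraMap_eq (fun p => by
    change aeval y p = ((aeval y' p : IntermediateField.adjoin F {y, u, v}) : E)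
    exact aeval_algHom_apply (IntermediateField.adjoin F {y, u, v}).val y' p)
  have t2 : IsScalarTower F F[X] (IntermediateField.adjoin F {y, u, v}) := IsScalarTower.of_algebraMap_eq (fun p => by
    change _ = aeval y' (C p)
    simp)
  have inj : Function.Injective (algebraMap F[X] E) := transcendental_iff_injective.1 hyt
  have inj' : Function.Injective (algebraMap F[X] (IntermediateField.adjoin F {y, u, v})) := by
    rw [IsScalarTower.algebraMap_eq F[X] (IntermediateField.adjoin F {y, u, v}) E, RingHom.coe_comp] at inj
    exact Function.Injective.of_comp inj
  have hf : FaithfulSMul F[X] (IntermediateField.adjoin F {y, u, v}) := (faithfulSMul_iff_algebraMap_injective _ _).2 inj'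
  have halg : Algebra.IsAlgebraic F[X] (IntermediateField.adjoin F {y, u, v}) := by
    constructor
    rintro ⟨k, hk⟩
    rw [← isAlgebraic_algebraMap_iff (A := E) (algebraMap (IntermediateField.adjoin F {y, u, v}) E).injective]
    change IsAlgebraic F[X] k
    induction hk using IntermediateField.adjoin_induction with
    | mem s hs =>
      rcases hs with rfl | rfl | rfl
      · have := isAlgebraic_algebraMap (A := E) (X : F[X])
        rwa [show algebraMap F[X] E X = s from aeval_X _] at this
      · exact hu
      · exact hv
    | algebraMap r =>
      have := isAlgebraic_algebraMap (A := E) (C r : F[X])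
      rwa [show algebraMap F[X] E (C r) = algebraMap F E r from aeval_C _ _] at this
    | add a b ha hb iha ihb => exact iha.add ihb
    | mul a b ha hb iha ihb => exact iha.mul ihb
    | inv a ha iha => exact iha.inv
  have htr : Algebra.trdeg F (IntermediateField.adjoin F {y, u, v}) = 1 := by
    have := lift_trdeg_add_eq F F[X] (IntermediateField.adjoin F {y, u, v})
    rw [Polynomial.trdeg_of_isDomain, trdeg_eq_zero (R := F[X])] at this
    simpa using this.symm
  have hind : AlgebraicIndependent F (fun _ : Unit => w) := algebraicIndependent_unique_type_iff.2 hw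
  have hb := hind.isTranscendenceBasis_of_lift_trdeg_le_of_finite (by rw [htr]; simp)
  have h1 := hb.isAlgebraic_field
  rw [Set.range_const] at h1
  classical
  have h2 : Algebra.EssFiniteType F (IntermediateField.adjoin F {y, u, v}) :=
    IntermediateField.essFiniteType_iff.2 ⟨{y, u, v}, by simp⟩
  have h3 : Algebra.EssFiniteType (IntermediateField.adjoin F {w}) (IntermediateField.adjoin F {y, u, v}) :=
    Algebra.EssFiniteType.of_comp F _ _
  exact Algebra.finite_of_essFiniteType_of_isAlgebraic

lemma case1a {dF : Der F} {D : Der E} (hcomp : ∀ c, D.f (algebraMap F E c) = algebraMap F E (dF.f c))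
    (y v u : E) (hyt : Transcendental F y) (hv0 : v ≠ 0) (h1 : D.f y = v) (h2 : D.f v = u * v^2)
    (h3 : D.f u = - v * (u^2/2 + (y^2 - 1968*y + 2654208) / (y * (y - 1728))^2))
    (hu : @IsAlgebraic F[X] E _ _ (algX F y) u) (hv : @IsAlgebraic F[X] E _ _ (algX F y) v) : False := by
  have hy : y ∈ IntermediateField.adjoin F {y, u, v} := IntermediateField.subset_adjoin F _ (by simp)
  have huK : u ∈ IntermediateField.adjoin F {y, u, v} := IntermediateField.subset_adjoin F _ (by simp)
  have hvK : v ∈ IntermediateField.adjoin F {y, u, v} := IntermediateField.subset_adjoin F _ (by simp)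
  have hst : ∀ k ∈ IntermediateField.adjoin F {y, u, v}, D.f k ∈ IntermediateField.adjoin F {y, u, v} := by
    intro k hk
    induction hk using IntermediateField.adjoin_induction with
    | mem s hs =>
      rcases hs with rfl | rfl | rfl
      · rw [h1]; exact hvK
      · rw [h3]
        have hn : ∀ n : ℕ, (n : E) ∈ IntermediateField.adjoin F {y, s, v} := fun n => natCast_mem _ n
        have e2 := hn 2
        have e3 := hn 1968
        have e4 := hn 2654208
        have e5 := hn 1728
        push_cast at e2 e3 e4 e5
        exact mul_mem (neg_mem hvK) (add_mem (div_mem (pow_mem huK 2) e2)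
          (div_mem (add_mem (sub_mem (pow_mem hy 2) (mul_mem e3 hy)) e4)
            (pow_mem (mul_mem hy (sub_mem hy e5)) 2)))
      · rw [h2]; exact mul_mem huK (pow_mem hvK 2)
    | algebraMap r => rw [hcomp]; exact IntermediateField.algebraMap_mem _ _
    | add a b ha hb iha ihb => rw [map_add]; exact add_mem iha ihb
    | mul a b ha hb iha ihb => rw [D.leib]; exact add_mem (mul_mem ha ihb) (mul_mem iha hb)
    | inv a ha iha =>
      by_cases h0 : a = 0
      · simp [h0]
      · rw [D.inv a h0]; exact div_mem (neg_mem iha) (pow_mem ha 2)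
  let DK : Der (IntermediateField.adjoin F {y, u, v}) :=
    { f := { toFun := fun k => ⟨D.f k, hst k k.2⟩
             map_zero' := by ext; simp
             map_add' := fun a b => by ext; simp }
      leib := fun a b => by ext; simp [D.leib] }
  have hDK : ∀ k, ((DK.f k : IntermediateField.adjoin F {y, u, v}) : E) = D.f k := fun k => rfl
  refine case1a_field (F := F) (dF := dF) (D := DK) (fun c => ?_) (hfin_aux y u v hyt hu hv)
    ⟨y, hy⟩ ⟨v, hvK⟩ ⟨u, huK⟩ ?_ ?_ ?_ ?_ ?_
  · apply Subtype.ext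
    rw [hDK]
    exact hcomp c
  · intro h
    exact hyt (h.algebraMap (A := E))
  · intro h
    exact hv0 (congrArg Subtype.val h)
  · apply Subtype.ext
    rw [hDK]; exact h1
  · apply Subtype.ext
    rw [hDK]; exact h2
  · apply Subtype.ext
    rw [hDK]; exact h3

lemma ev2_inj {dF : Der F} {D : Der E} (hcomp : ∀ c, D.f (algebraMap F E c) = algebraMap F E (dF.f c))
    (y v u x : E) (hyt : Transcendental F y) (hv0 : v ≠ 0) (h1 : D.f y = v) (h2 : D.f v = u * v^2)
    (h3 : D.f u = - v * (u^2/2 + (y^2 - 1968*y + 2654208) / (y * (y - 1728))^2))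
    (hu : u = x / (y * (y - 1728)))
    (hv : y * (y - 1728) * D.f v = x * v^2)
    (hx : y * (y - 1728) * D.f x = v * ((2 * y - 1728) * x - x^2/2 - (y^2 - 1968*y + 2654208))) :
    ∀ p, ev2 F y x p = 0 → p = 0 := by
  by_contra! hne
  obtain ⟨p0, hp0, hp0'⟩ := hne
  refine hp0' (case1b dF D hcomp y x v h1 hv hx hyt ?_ p0 hp0)
  intro p q hpq
  by_contra hq
  let := algX F y
  have t2 : ∀ r : F[X], algebraMap F[X] E r = aeval y r := fun r => rfl
  have inj : Function.Injective (algebraMap F[X] E) := transcendental_iff_injective.1 hyt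
  have hf : FaithfulSMul F[X] E := (faithfulSMul_iff_algebraMap_injective _ _).2 inj
  have xalg : IsAlgebraic F[X] x := ⟨p0, hp0', hp0⟩
  have halg : ∀ r : F[X][X], IsAlgebraic F[X] (ev2 F y x r) := by
    intro r
    induction r using Polynomial.induction_on' with
    | add a b ha hb => rw [map_add]; exact ha.add hb
    | monomial n a =>
      rw [← C_mul_X_pow_eq_monomial, map_mul, map_pow, ev2_C, ev2_X]
      exact (isAlgebraic_algebraMap (A := E) a).mul (xalg.pow n)
  have dalg : IsAlgebraic F[X] (y * (y - 1728)) := by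
    have := halg (C (X * (X - C 1728)))
    simpa [map_ofNat] using this
  have ve : v = - (y * (y - 1728) * ev2 F y x p) * (ev2 F y x q)⁻¹ := by
    field_simp
    linear_combination hpq
  have valg : IsAlgebraic F[X] v := by
    rw [ve]
    exact (dalg.mul (halg p)).neg.mul (halg q).inv
  have ualg : IsAlgebraic F[X] u := by
    rw [hu, div_eq_mul_inv]
    exact xalg.mul dalg.inv
  exact case1a hcomp y v u hyt hv0 h1 h2 h3 ualg valg

lemma main {dF : Der F} {D : Der E} (hcomp : ∀ c, D.f (algebraMap F E c) = algebraMap F E (dF.f c))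
    (a : E) (ha' : D.f a ≠ 0) (ha0 : a ≠ 0) (ha1728 : a ≠ 1728)
    (heq : 2 * D.f (D.f (D.f a)) * D.f a * a ^ 2 * (a - 1728) ^ 2
        - 3 * (D.f (D.f a)) ^ 2 * a ^ 2 * (a - 1728) ^ 2
        + 2 * (D.f a) ^ 4 * (a ^ 2 - 1968 * a + 2654208) = 0) (hyt : Transcendental F a) :
    AlgebraicIndependent F ![a, D.f a, D.f (D.f a)] := by
  have hs : a - 1728 ≠ 0 := sub_ne_zero.2 ha1728
  have hd : D.f (a - 1728) = D.f a := by rw [map_sub, D.ofNat, sub_zero]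
  set v := D.f a with hv
  set w := D.f v with hw
  have h2 : D.f v = w / v^2 * v^2 := by field_simp; rfl
  have e3 : D.f w = (3 * w^2 * a^2 * (a-1728)^2 - 2 * v^4 * (a^2 - 1968*a + 2654208)) / (2 * v * a^2 * (a-1728)^2) := by
    rw [eq_div_iff (by simp [ha', ha0, hs])]
    linear_combination heq
  have h3 : D.f (w / v^2) = - v * ((w/v^2)^2/2 + (a^2 - 1968*a + 2654208) / (a * (a - 1728))^2) := by
    rw [D.div _ _ (pow_ne_zero 2 ha'), D.sq, ← hw, e3]
    field_simp
    ring
  have hv' : a * (a - 1728) * D.f v = a * (a - 1728) * w / v^2 * v^2 := by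
    rw [← hw]; field_simp
  have hx : a * (a - 1728) * D.f (a * (a - 1728) * w / v^2) = v * ((2 * a - 1728) * (a * (a - 1728) * w / v^2) - (a * (a - 1728) * w / v^2)^2/2 - (a^2 - 1968*a + 2654208)) := by
    rw [mul_div_assoc, D.leib, D.leib, h3, hd, ← hv]
    field_simp
    ring
  have k2 := ev2_inj hcomp a v (w/v^2) (a * (a - 1728) * w / v^2) hyt ha' rfl h2 h3 (by field_simp) hv' hx
  have k3 := case2 dF D hcomp a (a * (a - 1728) * w / v^2) v rfl hv' hx ha' k2
  exact algInd_swap _ _ _ _ ha' rfl (algInd_of_ev3 _ _ _ k3)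

end

end JEq

theorem statement_0 {E : Type*} [Field E] [CharZero E]
    (D : E → E)
    (hD_add : ∀ x y : E, D (x + y) = D x + D y)
    (hD_mul : ∀ x y : E, D (x * y) = x * D y + D x * y)
    (F : Subfield E) (hF : ∀ x ∈ F, D x ∈ F)
    (a : E)
    (ha' : D a ≠ 0) (ha0 : a ≠ 0) (ha1728 : a ≠ 1728)
    (heq : 2 * D (D (D a)) * D a * a ^ 2 * (a - 1728) ^ 2
        - 3 * (D (D a)) ^ 2 * a ^ 2 * (a - 1728) ^ 2
        + 2 * (D a) ^ 4 * (a ^ 2 - 1968 * a + 2654208) = 0) :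
    IsAlgebraic F a ∨ AlgebraicIndependent F ![a, D a, D (D a)] := by
  by_cases hyt : IsAlgebraic F a
  · exact Or.inl hyt
  right
  let dE : JEq.Der E := { f := AddMonoidHom.mk' D hD_add, leib := hD_mul }
  let dF : JEq.Der F :=
    { f := AddMonoidHom.mk' (fun x => (⟨D x, hF x x.2⟩ : F)) (fun x y => Subtype.ext (hD_add x y))
      leib := fun x y => Subtype.ext (hD_mul x y) }
  exact JEq.main (F := F) (dF := dF) (D := dE) (fun c => rfl) a ha' ha0 ha1728 heq hyt
end

section
/- Let V ⊆ ℍ be a connected open set and let f be holomorphic on V with f′(z) ≠ 0, f(z) ≠ 0 and f(z) ≠ 1728 for all z ∈ V, satisfying on V the j-equation 2·f‴·f′·f²·(f − 1728)² − 3·(f″)²·f²·(f − 1728)² + 2·(f′)⁴·(f² − 1968·f + 2654208) = 0, and suppose f is transcendental over ℂ(z) in 𝓜(V). Then for every ℂ-Pfaffian chain (f₁, …, f_l) on V, f is not algebraic over ℂ(z, f₁, …, f_l); in particular f is not ℂ-Pfaffian on V. -/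
/-- `(f 0, …, f (l-1))` is a ℂ-Pfaffian chain of holomorphic functions on `V ⊆ ℂ`:
each `f i` is holomorphic on `V` and `fᵢ' = pᵢ(z, f₁, …, fᵢ)` on `V` for some polynomial
`pᵢ ∈ ℂ[X, Y₁, …, Yᵢ]`. -/
def CPfaffianChain (V : Set ℂ) {l : ℕ} (f : Fin l → ℂ → ℂ) : Prop :=
  (∀ i, DifferentiableOn ℂ (f i) V) ∧
  ∀ i : Fin l, ∃ p : MvPolynomial (Fin ((i : ℕ) + 2)) ℂ,
    ∀ z ∈ V, deriv (f i) z =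
      MvPolynomial.eval
        (Fin.cons z fun j : Fin ((i : ℕ) + 1) => f (Fin.castLE i.isLt j) z) p

/-- `g` is algebraic over the subfield `ℂ(z, f₁, …, f_l)` of the field of meromorphic
functions on `V`: there is a polynomial relation `∑ₖ cₖ(z, f₁, …, f_l) · gᵏ = 0` on `V`
where some coefficient `cₖ(z, f₁, …, f_l)` is not identically zero on `V`. -/
def AlgebraicOverCChain (V : Set ℂ) {l : ℕ} (f : Fin l → ℂ → ℂ) (g : ℂ → ℂ) : Prop :=
  ∃ n : ℕ, ∃ c : Fin (n + 1) → MvPolynomial (Fin (l + 1)) ℂ,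
    (∃ k, ¬ ∀ z ∈ V, MvPolynomial.eval (Fin.cons z fun j => f j z) (c k) = 0) ∧
    ∀ z ∈ V, ∑ k : Fin (n + 1),
      MvPolynomial.eval (Fin.cons z fun j => f j z) (c k) * g z ^ (k : ℕ) = 0

/-- `g` is ℂ-Pfaffian on `V`: a polynomial with complex coefficients in `z` and the functions
of some ℂ-Pfaffian chain on `V`. -/
def IsCPfaffian (V : Set ℂ) (g : ℂ → ℂ) : Prop :=
  ∃ (l : ℕ) (f : Fin l → ℂ → ℂ), CPfaffianChain V f ∧
    ∃ p : MvPolynomial (Fin (l + 1)) ℂ,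
      ∀ z ∈ V, g z = MvPolynomial.eval (Fin.cons z fun j => f j z) p

section Helpers
open Polynomial WithZero


structure GoodPlace (k : Type*) {L : Type*} [Field k] [Field L] [Algebra k L]
    (D : Derivation ℤ L L) (v : Valuation L ℤᵐ⁰) : Prop where
  alg : ∀ c : L, IsAlgebraic k c → c ≠ 0 → v c = 1
  res : ∀ w : L, v w ≤ 1 → ∃ p : k[X], v (aeval w p) < 1 ∧ v (aeval w (derivative p)) = 1
  bdd : ∃ γ : ℤᵐ⁰, ∀ z, v (D z) ≤ γ * v z
  der : ∀ c : k, v (D (algebraMap k L c)) ≤ 1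

section Local
variable {k L : Type*} [Field k] [Field L] [Algebra k L]
variable {D : Derivation ℤ L L} {v : Valuation L ℤᵐ⁰}

theorem GoodPlace.map_le (h : GoodPlace k D v) (c : k) : v (algebraMap k L c) ≤ 1 := by
  by_cases hc : c = 0
  · simp [hc]
  · exact (h.alg _ (isAlgebraic_algebraMap c) (by simpa using hc)).le

theorem aeval_le_aux (hm : ∀ c : k, v (algebraMap k L c) ≤ 1) {w : L} (hw : v w ≤ 1) (p : k[X]) :
    v (aeval w p) ≤ 1 := by
  rw [Polynomial.aeval_eq_sum_range]
  refine v.map_sum_le fun i _ => ?_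
  rw [Algebra.smul_def, map_mul, map_pow]
  exact mul_le_one' (hm _) (pow_le_one' hw _)

theorem aeval_der_aux (hder : ∀ c : k, v (D (algebraMap k L c)) ≤ 1)
    {w : L} (hw : v w ≤ 1) (p : k[X]) :
    v (D (aeval w p) - aeval w (derivative p) * D w) ≤ 1 := by
  induction p using Polynomial.induction_on' with
  | add p q hp hq =>
    have : D (aeval w (p + q)) - aeval w (derivative (p + q)) * D w =
      (D (aeval w p) - aeval w (derivative p) * D w) +
      (D (aeval w q) - aeval w (derivative q) * D w) := by
      simp only [map_add]; ring
    rw [this]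
    exact (v.map_add _ _).trans (max_le hp hq)
  | monomial n a =>
    have : D (aeval w (monomial n a)) - aeval w (derivative (monomial n a)) * D w =
      D (algebraMap k L a) * w ^ n := by
      rw [derivative_monomial, aeval_monomial, aeval_monomial, Derivation.leibniz,
        Derivation.leibniz_pow]
      simp only [smul_eq_mul, nsmul_eq_mul, map_mul, map_natCast]
      ring
    rw [this, map_mul, map_pow]
    exact mul_le_one' (hder _) (pow_le_one' hw _)

theorem GoodPlace.aeval_le (h : GoodPlace k D v) {w : L} (hw : v w ≤ 1) (p : k[X]) :
    v (aeval w p) ≤ 1 := aeval_le_aux h.map_le hw p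

theorem GoodPlace.aeval_der (h : GoodPlace k D v) {w : L} (hw : v w ≤ 1) (p : k[X]) :
    v (D (aeval w p) - aeval w (derivative p) * D w) ≤ 1 := aeval_der_aux h.der hw p

theorem GoodPlace.unit_der (h : GoodPlace k D v) {u : L} (hu : 1 < v u)
    (hD : ∀ z, v (D z) ≤ v u * v z) {w : L} (hw : v w ≤ 1) : v (D w) < v u := by
  obtain ⟨p, hp, hp'⟩ := h.res w hw
  have h1 := h.aeval_der hw p
  have h2 : v (D (aeval w p)) < v u := by
    refine (hD _).trans_lt ?_
    calc v u * v (aeval w p) < v u * 1 := by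
          gcongr
          exact zero_lt_one.trans hu
      _ = v u := mul_one _
  have h3 : D w * aeval w (derivative p) =
    D (aeval w p) - (D (aeval w p) - aeval w (derivative p) * D w) := by ring
  have h4 : v (D w) = v (D w * aeval w (derivative p)) := by rw [map_mul, hp', mul_one]
  rw [h4, h3]
  exact (v.map_sub _ _).trans_lt (max_lt h2 (h1.trans_lt hu))

theorem GoodPlace.exists_max (h : GoodPlace k D v) {x : L} (hx : 1 < v (D x / x)) :
    ∃ x₀ : L, x₀ ≠ 0 ∧ 1 < v (D x₀ / x₀) ∧ ∀ z, v (D z) ≤ v (D x₀ / x₀) * v z := by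
  obtain ⟨γ, hγ⟩ := h.bdd
  have hne : ∀ z, v (D z / z) ≠ 0 → z ≠ 0 ∧ D z ≠ 0 := by
    intro z hz
    constructor <;> rintro h0 <;> simp [h0] at hz
  have hbd : ∀ z, v (D z / z) ≤ γ := by
    intro z
    by_cases hz : z = 0
    · simp [hz]
    · rw [map_div₀, div_le_iff₀ (zero_lt_iff.2 (by simpa using hz))]
      exact hγ z
  have hx0 := hne x (zero_lt_one.trans hx).ne'
  have hγ0 : γ ≠ 0 := by
    rintro rfl
    exact absurd (hx.trans_le (hbd x)) (by simp)
  obtain ⟨m, ⟨x₀, hx₀, rfl⟩, hm⟩ := Int.exists_greatest_of_bdd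
    (P := fun n => ∃ z : L, v (D z / z) ≠ 0 ∧ log (v (D z / z)) = n)
    ⟨log γ, by
      rintro n ⟨z, hz, rfl⟩
      exact (log_le_log hz hγ0).2 (hbd z)⟩
    ⟨_, x, (zero_lt_one.trans hx).ne', rfl⟩
  have hmax : ∀ z, v (D z / z) ≤ v (D x₀ / x₀) := by
    intro z
    by_cases hz : v (D z / z) = 0
    · rw [hz]; exact zero_le
    · exact (log_le_log hz hx₀).1 (hm _ ⟨z, hz, rfl⟩)
  refine ⟨x₀, (hne _ hx₀).1, hx.trans_le (hmax x), fun z => ?_⟩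
  by_cases hz : z = 0
  · simp [hz]
  · have := hmax z
    rwa [map_div₀ v (D z), div_le_iff₀ (zero_lt_iff.2 (by simpa using hz))] at this

theorem ld_mul (D : Derivation ℤ L L) {a b : L} (ha : a ≠ 0) (hb : b ≠ 0) :
    D (a * b) / (a * b) = D a / a + D b / b := by
  rw [Derivation.leibniz]; simp only [smul_eq_mul]; field_simp; ring

theorem ld_inv (D : Derivation ℤ L L) {a : L} (ha : a ≠ 0) :
    D a⁻¹ / a⁻¹ = - (D a / a) := by
  rw [Derivation.leibniz_inv]; simp only [smul_eq_mul]; field_simp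

theorem ld_zpow (D : Derivation ℤ L L) {a : L} (ha : a ≠ 0) (n : ℤ) :
    D (a ^ n) / a ^ n = n * (D a / a) := by
  induction n using Int.induction_on with
  | zero => simp
  | succ n ih => rw [zpow_add_one₀ ha, ld_mul D (zpow_ne_zero _ ha) ha, ih]; push_cast; ring
  | pred n ih =>
    rw [zpow_sub_one₀ ha, ld_mul D (zpow_ne_zero _ ha) (inv_ne_zero ha), ih, ld_inv D ha]
    push_cast; ring

theorem GoodPlace.rat (h : GoodPlace k D v) [CharZero L] {q : ℚ} (hq : q ≠ 0) : v (q : L) = 1 := by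
  apply h.alg
  · have := charZero_of_injective_algebraMap (R := ℚ) (A := L) (algebraMap ℚ L).injective
    have h2 : CharZero k := ⟨fun a b hab => by
      have := congrArg (algebraMap k L) hab
      simpa using this⟩
    have : (q : L) = algebraMap k L (q : k) := by simp
    rw [this]
    exact isAlgebraic_algebraMap _
  · exact_mod_cast hq

theorem GoodPlace.exists_rho [CharZero L] (h : GoodPlace k D v) {x : L} (hx : 1 < v (D x / x)) :
    ∃ u : L, ∃ N : ℤ, N ≠ 0 ∧ 1 < v u ∧ (∀ z, v (D z) ≤ v u * v z) ∧
      (∀ z, v z ≤ 1 → v (D z) < v u) ∧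
      ∀ z, z ≠ 0 → v (D z / (u * z) - ((log (v z) / N : ℚ) : L)) < 1 := by
  obtain ⟨x₀, hx₀, hu, hD⟩ := h.exists_max hx
  have hU : ∀ z, v z ≤ 1 → v (D z) < v (D x₀ / x₀) := fun z hz => h.unit_der hu hD hz
  set u := D x₀ / x₀ with hudef
  have hu0 : u ≠ 0 := by
    intro h0; rw [h0] at hu; simp at hu
  have hvu : 0 < v u := zero_lt_one.trans hu
  have hN : log (v x₀) ≠ 0 := by
    intro h0
    have h1 : v x₀ = 1 := by
      rw [← exp_log (show v x₀ ≠ 0 by simpa using hx₀), h0, exp_zero]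
    have := hU x₀ h1.le
    rw [hudef, map_div₀, h1, div_one] at this
    exact lt_irrefl _ this
  refine ⟨u, log (v x₀), hN, hu, hD, hU, fun z hz => ?_⟩
  have hvz : v z ≠ 0 := by simpa using hz
  have hvx : v x₀ ≠ 0 := by simpa using hx₀
  set N := log (v x₀)
  set M := log (v z)
  have hw1 : v (z ^ N * (x₀ ^ M)⁻¹) = 1 := by
    rw [map_mul, map_inv₀, map_zpow₀, map_zpow₀, ← exp_log hvz, ← exp_log hvx,
      ← exp_zsmul, ← exp_zsmul]
    change exp (N • M) * (exp (M • N))⁻¹ = 1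
    rw [smul_eq_mul, smul_eq_mul, mul_comm M N]
    exact mul_inv_cancel₀ (exp_ne_zero (a := N * M))
  have hw0 := hU _ hw1.le
  have hld := ld_mul D (zpow_ne_zero N hz) (inv_ne_zero (zpow_ne_zero M hx₀))
  rw [ld_inv D (zpow_ne_zero M hx₀), ld_zpow D hz, ld_zpow D hx₀, ← hudef] at hld
  have h5 : v ((N : L) * (D z / z) + -(M * u)) < v u := by
    rw [← hld, map_div₀, hw1, div_one]; exact hw0
  have hNL : (N : L) ≠ 0 := by exact_mod_cast hN
  have h6 : D z / (u * z) - ((M / N : ℚ) : L) =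
      ((N : L) * (D z / z) + -(M * u)) / u * (((N : ℚ)⁻¹ : ℚ) : L) := by
    push_cast; field_simp; ring
  rw [h6, map_mul, h.rat (inv_ne_zero (by exact_mod_cast hN)), mul_one, map_div₀,
    div_lt_iff₀ hvu, one_mul]
  exact h5

def Res (v : Valuation L ℤᵐ⁰) (z : L) (q : ℚ) : Prop := v (z - (q : L)) < 1

theorem GoodPlace.rat_le (h : GoodPlace k D v) [CharZero L] (q : ℚ) : v (q : L) ≤ 1 := by
  by_cases hq : q = 0
  · simp [hq]
  · exact (h.rat hq).le

theorem GoodPlace.res_rat (_ : GoodPlace k D v) [CharZero L] (q : ℚ) : Res v (q : L) q := by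
  simp [Res]

theorem GoodPlace.res_le (h : GoodPlace k D v) [CharZero L] {z : L} {q : ℚ} (hz : Res v z q) :
    v z ≤ 1 := by
  have : z = (z - q) + q := by ring
  rw [this]
  exact (v.map_add _ _).trans (max_le (le_of_lt hz) (h.rat_le q))

theorem GoodPlace.res_add (_ : GoodPlace k D v) [CharZero L] {z w : L} {q r : ℚ} (hz : Res v z q)
    (hw : Res v w r) : Res v (z + w) (q + r) := by
  have : z + w - ((q + r : ℚ) : L) = (z - q) + (w - r) := by push_cast; ring
  rw [Res, this]
  exact (v.map_add _ _).trans_lt (max_lt hz hw)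

theorem GoodPlace.res_mul (h : GoodPlace k D v) [CharZero L] {z w : L} {q r : ℚ} (hz : Res v z q)
    (hw : Res v w r) : Res v (z * w) (q * r) := by
  have : z * w - ((q * r : ℚ) : L) = (z - q) * w + q * (w - r) := by push_cast; ring
  rw [Res, this]
  refine (v.map_add _ _).trans_lt (max_lt ?_ ?_)
  · rw [map_mul]; exact mul_lt_one_of_lt_of_le hz (h.res_le hw)
  · rw [map_mul]; exact (mul_le_of_le_one_left' (h.rat_le q)).trans_lt hw

theorem GoodPlace.res_unique (h : GoodPlace k D v) [CharZero L] {z : L} {q r : ℚ} (hz : Res v z q)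
    (hw : Res v z r) : q = r := by
  by_contra hne
  have h1 := h.rat (sub_ne_zero.2 hne)
  have : ((q - r : ℚ) : L) = (z - r) - (z - q) := by push_cast; ring
  rw [this] at h1
  exact (((v.map_sub _ _).trans_lt (max_lt hw hz)).ne) h1

theorem GoodPlace.res_eq_one (h : GoodPlace k D v) [CharZero L] {z : L} {q : ℚ} (hz : Res v z q)
    (hq : q ≠ 0) : v z = 1 := by
  refine le_antisymm (h.res_le hz) (not_lt.1 fun hlt => hq ?_)
  exact h.res_unique hz (by simpa [Res] using hlt)

theorem GoodPlace.res_inv (h : GoodPlace k D v) [CharZero L] {z : L} {q : ℚ} (hz : Res v z q)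
    (hq : q ≠ 0) : Res v z⁻¹ q⁻¹ := by
  have h1 := h.res_eq_one hz hq
  have hz0 : z ≠ 0 := by rintro rfl; simp at h1
  have hqL : (q : L) ≠ 0 := by exact_mod_cast hq
  have : z⁻¹ - ((q⁻¹ : ℚ) : L) = (z - q) * (-(z⁻¹ * (q : L)⁻¹)) := by push_cast; field_simp; ring
  rw [Res, this, map_mul, Valuation.map_neg, map_mul, map_inv₀, map_inv₀, h1, h.rat hq]
  simpa [Res] using hz

theorem GoodPlace.schwarz (h : GoodPlace k D v) [CharZero L] {u : L} {N : ℤ}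
    (hu : 1 < v u) (hU : ∀ z, v z ≤ 1 → v (D z) < v u)
    (hρ : ∀ z, z ≠ 0 → v (D z / (u * z) - ((log (v z) / N : ℚ) : L)) < 1)
    {f' : L} (hf' : f' ≠ 0) {b c : ℚ} (hb : b = (log (v u) / N : ℚ))
    (hc : c = (log (v f') / N : ℚ)) :
    Res v ((D (D f') / f' - 3 / 2 * (D f' / f') ^ 2) / u ^ 2) (b * c - c ^ 2 / 2) := by
  have hu0 : u ≠ 0 := by intro h0; rw [h0] at hu; simp at hu
  have hvu : 0 < v u := zero_lt_one.trans hu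
  have h1 : Res v (D u / (u * u)) b := by rw [hb]; exact hρ u hu0
  have h2 : Res v (D f' / (u * f')) c := by rw [hc]; exact hρ f' hf'
  have h3 : Res v (D (D f' / (u * f')) / u) 0 := by
    rw [Res, Rat.cast_zero, sub_zero, map_div₀, div_lt_iff₀ hvu, one_mul]
    exact hU _ (h.res_le h2)
  have h4 := h.res_add (h.res_add (h.res_mul h1 h2) h3)
    (h.res_mul (h.res_mul h2 h2) (h.res_rat (-1/2)))
  have e1 : b * c + 0 + c * c * (-1/2) = b * c - c ^ 2 / 2 := by ring
  rw [e1] at h4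
  convert h4 using 1
  rw [Derivation.leibniz_div, Derivation.leibniz]
  simp only [smul_eq_mul]
  push_cast
  field_simp
  ring

theorem GoodPlace.case_sing (h : GoodPlace k D v) [CharZero L] {g f' Q : L} {κ : ℚ}
    (hg : D g = f') (hvg : v g ≠ 1) (hpole : 1 < v (f' / g))
    (hQ : Res v Q κ) (hκ : 1 / 2 < κ)
    (heq : D (D f') / f' - 3 / 2 * (D f' / f') ^ 2 + Q * (f' / g) ^ 2 = 0) : False := by
  have hg0 : g ≠ 0 := by rintro rfl; simp at hpole
  have hf0 : f' ≠ 0 := by rintro rfl; simp at hpole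
  rw [← hg] at hpole
  obtain ⟨u, N, hN, hu, hD, hU, hρ⟩ := h.exists_rho hpole
  have hu0 : u ≠ 0 := by intro h0; rw [h0] at hu; simp at hu
  have hvg0 : v g ≠ 0 := by simpa using hg0
  have hvu0 : v u ≠ 0 := by simpa using hu0
  have hNQ : (N : ℚ) ≠ 0 := by exact_mod_cast hN
  have ha := hρ g hg0
  rw [hg] at ha
  set a : ℚ := log (v g) / N with hadef
  have hlog : log (v g) ≠ 0 := by
    intro h0; apply hvg; rw [← exp_log hvg0, h0, exp_zero]
  have ha0 : a ≠ 0 := div_ne_zero (by exact_mod_cast hlog) hNQ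
  have h1 := h.res_eq_one ha ha0
  have h2 : v f' = v u * v g := by
    rw [map_div₀, map_mul, div_eq_one_iff_eq (mul_ne_zero hvu0 hvg0)] at h1
    exact h1
  have h3 : (log (v f') / N : ℚ) = a + log (v u) / N := by
    rw [h2, log_mul hvu0 hvg0]; push_cast; rw [hadef]; ring
  have h4 := h.schwarz hu hU hρ hf0 rfl h3.symm
  set b : ℚ := log (v u) / N
  have h5 := h.res_add h4 (h.res_mul hQ (h.res_mul ha ha))
  have h6 : (D (D f') / f' - 3 / 2 * (D f' / f') ^ 2) / u ^ 2 +
      Q * (f' / (u * g) * (f' / (u * g))) = ((0 : ℚ) : L) := by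
    rw [Rat.cast_zero, ← zero_div (u ^ 2), ← heq]
    field_simp
  rw [h6] at h5
  have h7 := h.res_unique (h.res_rat 0) h5
  have h8 : 0 < a ^ 2 := by positivity
  nlinarith [sq_nonneg b]

theorem GoodPlace.case_reg (h : GoodPlace k D v) [CharZero L] {f f' R : L}
    (hf : D f = f') (hvf : v f ≤ 1) (hpole : 1 < v f') (hR : v R ≤ 1)
    (heq : D (D f') / f' - 3 / 2 * (D f' / f') ^ 2 + R * f' ^ 2 = 0) : False := by
  obtain ⟨p, hp, hp'⟩ := h.res f hvf
  have hE := h.aeval_der hvf p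
  rw [hf] at hE
  set g := aeval f p with hgdef
  have hvDg : v (D g) = v f' := by
    have e : D g = aeval f (derivative p) * f' + (D g - aeval f (derivative p) * f') := by ring
    have e2 : v (aeval f (derivative p) * f') = v f' := by rw [map_mul, hp', one_mul]
    rw [e, Valuation.map_add_eq_of_lt_left, e2]
    rw [e2]; exact hE.trans_lt hpole
  have hg0 : g ≠ 0 := by
    intro h0; rw [← hvDg, h0] at hpole; simp at hpole
  have hf0 : f' ≠ 0 := by rintro rfl; simp at hpole
  have hvg0 : v g ≠ 0 := by simpa using hg0
  have hx : 1 < v (D g / g) := by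
    rw [map_div₀, hvDg, one_lt_div₀ (zero_lt_iff.2 hvg0)]
    exact hp.trans hpole
  obtain ⟨u, N, hN, hu, hD, hU, hρ⟩ := h.exists_rho hx
  have hu0 : u ≠ 0 := by intro h0; rw [h0] at hu; simp at hu
  have hvu0 : v u ≠ 0 := by simpa using hu0
  have hNQ : (N : ℚ) ≠ 0 := by exact_mod_cast hN
  have ha := hρ g hg0
  set a : ℚ := log (v g) / N with hadef
  have hlog : log (v g) < 0 := by
    have := (log_lt_log hvg0 one_ne_zero).2 hp
    simpa using this
  have hlogu : 0 < log (v u) := by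
    have := (log_lt_log one_ne_zero hvu0).2 hu
    simpa using this
  have hlogf : 0 < log (v f') := by
    have := (log_lt_log one_ne_zero (by simpa using hf0)).2 hpole
    simpa using this
  have ha0 : a ≠ 0 := div_ne_zero (by exact_mod_cast hlog.ne) hNQ
  have h1 := h.res_eq_one ha ha0
  have h2 : v f' = v u * v g := by
    rw [map_div₀, map_mul, div_eq_one_iff_eq (mul_ne_zero hvu0 hvg0), hvDg] at h1
    exact h1
  have h3 : (log (v f') / N : ℚ) = a + log (v u) / N := by
    rw [h2, log_mul hvu0 hvg0]; push_cast; rw [hadef]; ring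
  have h4 := h.schwarz hu hU hρ hf0 rfl h3.symm
  have hz : Res v (R * (f' / u) ^ 2) 0 := by
    rw [Res, Rat.cast_zero, sub_zero, map_mul, map_pow, map_div₀, h2, mul_div_cancel_left₀ _ hvu0]
    exact (mul_le_of_le_one_left' hR).trans_lt (pow_lt_one₀ zero_le hp two_ne_zero)
  have h5 := h.res_add h4 hz
  have h6 : (D (D f') / f' - 3 / 2 * (D f' / f') ^ 2) / u ^ 2 +
      R * (f' / u) ^ 2 = ((0 : ℚ) : L) := by
    rw [Rat.cast_zero, ← zero_div (u ^ 2), ← heq]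
    field_simp
  rw [h6] at h5
  have h7 := h.res_unique (h.res_rat 0) h5
  have h8 : (a + log (v u) / N) * (log (v u) / N - a) = 0 := by linear_combination -2 * h7
  rcases mul_eq_zero.1 h8 with h9 | h9
  · rw [← h3] at h9
    have : ((log (v f') : ℤ) : ℚ) = 0 := by
      rcases div_eq_zero_iff.1 h9 with h | h
      · exact h
      · exact absurd h hNQ
    exact hlogf.ne' (by exact_mod_cast this)
  · rw [hadef, ← sub_div] at h9
    have : ((log (v u) : ℤ) : ℚ) - (log (v g) : ℤ) = 0 := by
      rcases div_eq_zero_iff.1 h9 with h | h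
      · exact h
      · exact absurd h hNQ
    have h10 : log (v u) - log (v g) = 0 := by exact_mod_cast this
    omega

/-- The `j`-type equation. -/
def JEq (D : Derivation ℤ L L) (f : L) : Prop :=
  2 * D (D (D f)) * D f * f ^ 2 * (f - 1728) ^ 2
    - 3 * (D (D f)) ^ 2 * f ^ 2 * (f - 1728) ^ 2
    + 2 * (D f) ^ 4 * (f ^ 2 - 1968 * f + 2654208) = 0

theorem GoodPlace.case_1728 (h : GoodPlace k D v) [CharZero L] {f : L} (hj : JEq D f)
    (hv : v (f - 1728) < 1) (hp : 1 < v (D f / (f - 1728))) : False := by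
  have hr : Res v f 1728 := by simpa [Res] using hv
  have hf1 := h.res_eq_one hr (by norm_num)
  have hf0 : f ≠ 0 := by rintro rfl; simp at hf1
  have hD0 : D f ≠ 0 := by intro h0; rw [h0] at hp; simp at hp
  have hg0 : f - 1728 ≠ 0 := by intro h0; rw [h0] at hp; simp at hp
  have hc : D (1728 : L) = 0 := by simpa using D.map_natCast 1728
  refine h.case_sing (g := f - 1728) (f' := D f)
    (Q := (f * f + f * ((-1968 : ℚ) : L) + ((2654208 : ℚ) : L)) * (f⁻¹ * f⁻¹)) (κ := 3 / 4)
    (by rw [map_sub, hc, sub_zero]) hv.ne hp ?_ (by norm_num) ?_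
  · have := h.res_mul (h.res_add (h.res_add (h.res_mul hr hr) (h.res_mul hr (h.res_rat (-1968))))
      (h.res_rat 2654208)) (h.res_mul (h.res_inv hr (by norm_num)) (h.res_inv hr (by norm_num)))
    convert this using 1
    norm_num
  · unfold JEq at hj
    push_cast
    field_simp
    linear_combination hj

theorem GoodPlace.main (h : GoodPlace k D v) [CharZero L] {f : L} (hj : JEq D f)
    (hp : 1 < v (D f / f)) : False := by
  have hD0 : D f ≠ 0 := by intro h0; rw [h0] at hp; simp at hp
  have hf0 : f ≠ 0 := by intro h0; rw [h0] at hp; simp at hp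
  have hf8 : f - 1728 ≠ 0 := by
    intro h0
    apply hD0
    rw [sub_eq_zero.1 h0]
    simpa using D.map_natCast 1728
  rcases lt_trichotomy (v f) 1 with hlt | heq | hgt
  · have hr : Res v f 0 := by simpa [Res] using hlt
    have hr8 : Res v (f + ((-1728 : ℚ) : L)) (0 + -1728) := h.res_add hr (h.res_rat _)
    refine h.case_sing (g := f) (f' := D f)
      (Q := (f * f + f * ((-1968 : ℚ) : L) + ((2654208 : ℚ) : L)) *
        ((f + ((-1728 : ℚ) : L))⁻¹ * (f + ((-1728 : ℚ) : L))⁻¹)) (κ := 8 / 9)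
      rfl hlt.ne hp ?_ (by norm_num) ?_
    · have := h.res_mul (h.res_add (h.res_add (h.res_mul hr hr) (h.res_mul hr (h.res_rat (-1968))))
        (h.res_rat 2654208)) (h.res_mul (h.res_inv hr8 (by norm_num)) (h.res_inv hr8 (by norm_num)))
      convert this using 1
      norm_num
    · unfold JEq at hj
      push_cast
      rw [← sub_eq_add_neg]
      field_simp
      linear_combination hj
  · rw [map_div₀, heq, div_one] at hp
    rcases lt_or_ge (v (f - 1728)) 1 with h8 | h8
    · refine h.case_1728 hj h8 ?_
      rw [map_div₀, one_lt_div₀ (zero_lt_iff.2 (by simpa using hf8))]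
      exact h8.trans hp
    · have hle : v (f - ((1728 : ℚ) : L)) ≤ 1 :=
        (v.map_sub _ _).trans (max_le heq.le (h.rat_le _))
      have h81 : v (f - 1728) = 1 := le_antisymm (by simpa using hle) h8
      refine h.case_reg (f := f) (f' := D f)
        (R := (f * f + f * ((-1968 : ℚ) : L) + ((2654208 : ℚ) : L)) / (f ^ 2 * (f - 1728) ^ 2))
        rfl heq.le hp ?_ ?_
      · rw [map_div₀, map_mul, map_pow, map_pow, heq, h81]
        simp only [one_pow, mul_one, div_one]
        refine (v.map_add _ _).trans (max_le ((v.map_add _ _).trans (max_le ?_ ?_)) (h.rat_le _))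
        · simp [heq]
        · rw [map_mul, heq, one_mul]; exact h.rat_le _
      · unfold JEq at hj
        push_cast
        field_simp
        linear_combination hj
  · have hr : Res v f⁻¹ 0 := by
      rw [Res, Rat.cast_zero, sub_zero, map_inv₀]
      exact inv_lt_one_of_one_lt₀ hgt
    have hr8 := h.res_add (h.res_rat 1) (h.res_mul hr (h.res_rat (-1728)))
    refine h.case_sing (g := f) (f' := D f)
      (Q := (((1 : ℚ) : L) + f⁻¹ * ((-1968 : ℚ) : L) + f⁻¹ * f⁻¹ * ((2654208 : ℚ) : L)) *
        ((((1 : ℚ) : L) + f⁻¹ * ((-1728 : ℚ) : L))⁻¹ *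
         (((1 : ℚ) : L) + f⁻¹ * ((-1728 : ℚ) : L))⁻¹)) (κ := 1)
      rfl hgt.ne' hp ?_ (by norm_num) ?_
    · have := h.res_mul (h.res_add (h.res_add (h.res_rat 1) (h.res_mul hr (h.res_rat (-1968))))
        (h.res_mul (h.res_mul hr hr) (h.res_rat 2654208)))
        (h.res_mul (h.res_inv hr8 (by norm_num)) (h.res_inv hr8 (by norm_num)))
      convert this using 1
      norm_num
    · have e : ((1 : ℚ) : L) + f⁻¹ * ((-1728 : ℚ) : L) = (f - 1728) / f := by
        push_cast; field_simp; ring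
      rw [e]
      unfold JEq at hj
      push_cast
      field_simp
      linear_combination hj

end Local
section Place
variable {k L : Type*} [Field k] [Field L] [Algebra k L]
variable {D : Derivation ℤ L L} {v : Valuation L ℤᵐ⁰}

theorem exists_primitive_rel {x w : L} (hx : Transcendental k x)
    (hw : IsAlgebraic (Algebra.adjoin k {x}) w) :
    ∃ Q : k[X][X], Q.IsPrimitive ∧ Polynomial.eval₂ (aeval x : k[X] →ₐ[k] L).toRingHom w Q = 0 := by
  classical
  obtain ⟨P, hP0, hP⟩ := hw
  have hsurj : Function.Surjective
      ((aeval x : k[X] →ₐ[k] L).codRestrict (Algebra.adjoin k {x})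
        (fun p => by rw [Algebra.adjoin_singleton_eq_range_aeval]; exact ⟨p, rfl⟩)) := by
    rintro ⟨y, hy⟩
    rw [Algebra.adjoin_singleton_eq_range_aeval] at hy
    obtain ⟨p, rfl⟩ := hy
    exact ⟨p, rfl⟩
  obtain ⟨Q, hQ⟩ := Polynomial.map_surjective
    ((aeval x : k[X] →ₐ[k] L).codRestrict (Algebra.adjoin k {x})
        (fun p => by rw [Algebra.adjoin_singleton_eq_range_aeval]; exact ⟨p, rfl⟩)).toRingHom hsurj P
  have hQ0 : Q ≠ 0 := by
    rintro rfl; apply hP0; rw [← hQ]; simp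
  have hQe : Polynomial.eval₂ (aeval x : k[X] →ₐ[k] L).toRingHom w Q = 0 := by
    rw [← hP, ← hQ, aeval_def, eval₂_map]
    rfl
  let : NormalizedGCDMonoid k[X] := Classical.choice inferInstance
  refine ⟨Q.primPart, Q.isPrimitive_primPart, ?_⟩
  rw [Q.eq_C_content_mul_primPart, eval₂_mul, eval₂_C] at hQe
  rcases mul_eq_zero.1 hQe with h | h
  · exfalso
    have := (transcendental_iff.1 hx) _ h
    exact hQ0 (Polynomial.content_eq_zero_iff.1 this)
  · exact h

theorem exists_res (hm : ∀ c : k, v (algebraMap k L c) ≤ 1) [CharZero k]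
    (hm1 : ∀ c : k, c ≠ 0 → v (algebraMap k L c) = 1)
    {x w : L} (hx : Transcendental k x) (hvx : v x < 1)
    (hw : IsAlgebraic (Algebra.adjoin k {x}) w) (hvw : v w ≤ 1) :
    ∃ p : k[X], v (aeval w p) < 1 ∧ v (aeval w (derivative p)) = 1 := by
  classical
  obtain ⟨Q, hQ, hQe⟩ := exists_primitive_rel hx hw
  have hex : ∃ n, ∃ p : k[X], p ≠ 0 ∧ p.natDegree = n ∧ v (aeval w p) < 1 := by
    refine ⟨_, Q.map (Polynomial.evalRingHom 0), ?_, rfl, ?_⟩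
    · intro h0
      have : C (X : k[X]) ∣ Q := by
        rw [C_dvd_iff_dvd_coeff]
        intro i
        rw [X_dvd_iff, coeff_zero_eq_eval_zero]
        have := congrArg (fun p => p.coeff i) h0
        simpa using this
      exact not_isUnit_X (hQ _ this)
    · have key : ∀ q : k[X], v (aeval x q - algebraMap k L (q.eval 0)) < 1 := by
        intro q
        obtain ⟨r, hr⟩ : X ∣ q - C (q.eval 0) := by
          rw [X_dvd_iff, coeff_zero_eq_eval_zero]; simp
        have : aeval x q - algebraMap k L (q.eval 0) = x * aeval x r := by
          have := congrArg (aeval x) hr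
          simpa using this
        rw [this, map_mul]
        exact mul_lt_one_of_lt_of_le hvx (aeval_le_aux hm hvx.le _)
      have e : aeval w (Q.map (Polynomial.evalRingHom 0)) =
          -∑ i ∈ Finset.range (Q.natDegree + 1),
            (aeval x (Q.coeff i) - algebraMap k L ((Q.coeff i).eval 0)) * w ^ i := by
        rw [aeval_def, eval₂_map, eval₂_eq_sum_range]
        rw [eval₂_eq_sum_range] at hQe
        simp only [sub_mul, Finset.sum_sub_distrib]
        have h2 : ∑ i ∈ Finset.range (Q.natDegree + 1), aeval x (Q.coeff i) * w ^ i = 0 := hQe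
        rw [h2, zero_sub, neg_neg]
        rfl
      rw [e, Valuation.map_neg]
      refine v.map_sum_lt one_ne_zero fun i _ => ?_
      rw [map_mul, map_pow]
      exact mul_lt_one_of_lt_of_le (key _) (pow_le_one' hvw _)
  obtain ⟨p, hp0, hpn, hpv⟩ := Nat.find_spec hex
  refine ⟨p, hpv, le_antisymm (aeval_le_aux hm hvw _) (not_lt.1 fun hlt => ?_)⟩
  have hdeg : p.natDegree ≠ 0 := by
    intro h0
    rw [Polynomial.eq_C_of_natDegree_eq_zero h0, aeval_C, hm1] at hpv
    · exact lt_irrefl _ hpv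
    · intro h1; apply hp0; rw [Polynomial.eq_C_of_natDegree_eq_zero h0, h1, C_0]
  have hlt2 := natDegree_derivative_lt hdeg
  rw [hpn] at hlt2
  refine Nat.find_min hex hlt2 ⟨derivative p, ?_, rfl, hlt⟩
  intro h0
  exact hdeg (derivative_eq_zero.1 h0)

open scoped IntermediateField.algebraAdjoinAdjoin IntermediateField in
theorem exists_place [CharZero k] (hk : ∀ c : k, ∃ c' : k, D (algebraMap k L c) = algebraMap k L c')
    {x : L} (hx : Transcendental k x) [FiniteDimensional k⟮x⟯ L] :
    ∃ v : Valuation L ℤᵐ⁰, GoodPlace k D v ∧ v x < 1 := by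
  classical
  have hsurj : Function.Surjective
      ((aeval x : k[X] →ₐ[k] L).codRestrict (Algebra.adjoin k {x})
        (fun p => by rw [Algebra.adjoin_singleton_eq_range_aeval]; exact ⟨p, rfl⟩)) := by
    rintro ⟨y, hy⟩
    rw [Algebra.adjoin_singleton_eq_range_aeval] at hy
    obtain ⟨p, rfl⟩ := hy
    exact ⟨p, rfl⟩
  have : IsPrincipalIdealRing (Algebra.adjoin k {x}) :=
    IsPrincipalIdealRing.of_surjective _ hsurj
  have : CharZero L := charZero_of_injective_algebraMap (algebraMap k L).injective
  have : IsDedekindDomain (Algebra.adjoin k {x}) := inferInstance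
  have : Algebra.IsSeparable k⟮x⟯ L := inferInstance
  have hDed : IsDedekindDomain (integralClosure (Algebra.adjoin k {x}) L) :=
    integralClosure.isDedekindDomain _ k⟮x⟯ L
  have hFrac : IsFractionRing (integralClosure (Algebra.adjoin k {x}) L) L :=
    integralClosure.isFractionRing_of_finite_extension k⟮x⟯ L
  have hFin : Module.Finite (Algebra.adjoin k {x}) (integralClosure (Algebra.adjoin k {x}) L) :=
    IsIntegralClosure.finite _ k⟮x⟯ L _
  set R := Algebra.adjoin k {x} with hR
  set B := integralClosure R L with hB
  have hxR : x ∈ R := Algebra.self_mem_adjoin_singleton k x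
  have hmemB : ∀ r : R, (r : L) ∈ B := fun r => isIntegral_algebraMap (x := r)
  have hx0 : x ≠ 0 := by
    rintro rfl; exact hx isAlgebraic_zero
  let xB : B := ⟨x, hmemB ⟨x, hxR⟩⟩
  have hnu : ¬ IsUnit xB := by
    rintro hu
    obtain ⟨y, hy⟩ := hu.exists_right_inv
    have hy' : x * (y : L) = 1 := congrArg Subtype.val hy
    have hyx : (y : L) = x⁻¹ := eq_inv_of_mul_eq_one_right hy'
    have hyK : (y : L) ∈ k⟮x⟯ := by
      rw [hyx]; exact inv_mem (IntermediateField.mem_adjoin_simple_self k x)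
    have hInt : IsIntegral R (⟨(y : L), hyK⟩ : k⟮x⟯) := by
      have : IsIntegral R (algebraMap k⟮x⟯ L ⟨(y : L), hyK⟩) := y.2
      exact (isIntegral_algebraMap_iff (algebraMap k⟮x⟯ L).injective).1 this
    obtain ⟨r, hr⟩ := IsIntegrallyClosed.isIntegral_iff.1 hInt
    obtain ⟨q, hq⟩ := hsurj r
    have hq' : aeval x q = (y : L) := by
      have h1 : aeval x q = (r : L) := congrArg Subtype.val hq
      have h2 : (r : L) = y := congrArg Subtype.val hr
      rw [h1, h2]
    have : aeval x (X * q - 1) = 0 := by simp [hq', hy']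
    have h3 := (transcendental_iff.1 hx) _ this
    have h4 := congrArg (Polynomial.eval 0) h3
    simp at h4
  obtain ⟨P, hPmax, hPle⟩ := Ideal.exists_le_maximal (Ideal.span {xB})
    (by rwa [Ne, Ideal.span_singleton_eq_top])
  have hxP : xB ∈ P := hPle (Ideal.mem_span_singleton_self _)
  have hPbot : P ≠ ⊥ := by
    rintro rfl
    exact hx0 (congrArg Subtype.val (Ideal.mem_bot.1 hxP))
  let 𝔭 : IsDedekindDomain.HeightOneSpectrum B := ⟨P, hPmax.isPrime, hPbot⟩
  set v := 𝔭.valuation L with hv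
  have hB1 : ∀ b : B, v (b : L) ≤ 1 := fun b => 𝔭.valuation_le_one b
  have hvx : v x < 1 := (𝔭.valuation_lt_one_iff_mem xB).2 hxP
  have halgle : ∀ c : L, IsAlgebraic k c → v c ≤ 1 := by
    intro c hc
    have : IsIntegral R c := hc.isIntegral.tower_top
    exact hB1 ⟨c, this⟩
  have halg : ∀ c : L, IsAlgebraic k c → c ≠ 0 → v c = 1 := by
    intro c hc hc0
    refine le_antisymm (halgle c hc) ?_
    have := halgle _ hc.inv
    rw [map_inv₀] at this
    exact (inv_le_one₀ (zero_lt_iff.2 (by simpa using hc0))).1 this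
  have hm : ∀ c : k, v (algebraMap k L c) ≤ 1 := fun c => halgle _ (isAlgebraic_algebraMap c)
  have hm1 : ∀ c : k, c ≠ 0 → v (algebraMap k L c) = 1 := fun c hc =>
    halg _ (isAlgebraic_algebraMap c) (by simpa using hc)
  have hder : ∀ c : k, v (D (algebraMap k L c)) ≤ 1 := by
    intro c
    obtain ⟨c', hc'⟩ := hk c
    rw [hc']; exact hm c'
  have halgR : ∀ w : L, IsAlgebraic R w := by
    intro w
    exact (IsFractionRing.isAlgebraic_iff R k⟮x⟯ L).2 (Algebra.IsAlgebraic.isAlgebraic w)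
  refine ⟨v, ⟨halg, fun w hw => exists_res hm hm1 hx hvx (halgR w) hw, ?_, hder⟩, hvx⟩
  -- boundedness
  obtain ⟨s, hs⟩ := hFin.fg_top
  obtain ⟨γ₁, hγ₁⟩ : ∃ γ₁ : ℤᵐ⁰, ∀ b ∈ s, v (D (b : L)) ≤ γ₁ :=
    ⟨s.sup (fun b => v (D (b : L))), fun b hb => Finset.le_sup (f := fun b : B => v (D (b : L))) hb⟩
  set γ := max (max 1 (v (D x))) γ₁ with hγ
  have hDR : ∀ r : R, v (D (r : L)) ≤ γ := by
    intro r
    obtain ⟨p, hp⟩ := hsurj r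
    have hp' : aeval x p = (r : L) := congrArg Subtype.val hp
    have h1 := aeval_der_aux hder hvx.le p
    have h2 : D (r : L) = (D (aeval x p) - aeval x (derivative p) * D x) +
      aeval x (derivative p) * D x := by rw [hp']; ring
    rw [h2]
    refine (v.map_add _ _).trans (max_le (h1.trans (by simp [hγ])) ?_)
    rw [map_mul]
    exact (mul_le_of_le_one_left' (aeval_le_aux hm hvx.le _)).trans (by simp [hγ])
  have hDB : ∀ b : B, v (D (b : L)) ≤ γ := by
    intro b
    have hb : b ∈ Submodule.span R (s : Set B) := by rw [hs]; trivial
    induction hb using Submodule.span_induction with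
    | mem b hb => exact (hγ₁ b hb).trans (le_max_right _ _)
    | zero => simp
    | add a b _ _ ha hb =>
      rw [B.coe_add, map_add]
      exact (v.map_add _ _).trans (max_le ha hb)
    | smul r b _ hb =>
      have : ((r • b : B) : L) = (r : L) * (b : L) := rfl
      rw [this, Derivation.leibniz]
      refine (v.map_add _ _).trans (max_le ?_ ?_)
      · rw [smul_eq_mul, map_mul]
        exact (mul_le_of_le_one_left' (hB1 ⟨r, hmemB r⟩)).trans hb
      · rw [smul_eq_mul, map_mul]
        exact (mul_le_of_le_one_left' (hB1 b)).trans (hDR r)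
  have hDO : ∀ z : L, v z ≤ 1 → v (D z) ≤ γ := by
    intro z hz
    obtain ⟨n, d, hnd⟩ := 𝔭.exists_primeCompl_mul_eq_of_integer z hz
    have hd1 : v (d : B) = 1 := by
      have h1 := (𝔭.intValuation_eq_one_iff_mem_primeCompl d).2 d.2
      rw [← 𝔭.valuation_of_algebraMap (K := L)] at h1
      exact h1
    have hnd' : z * ((d : B) : L) = (n : L) := hnd
    have h2 := congrArg D hnd'
    rw [Derivation.leibniz, smul_eq_mul, smul_eq_mul] at h2
    have h3 : v (D z) = v (((d : B) : L) * D z) := by rw [map_mul, hd1, one_mul]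
    have h4 : ((d : B) : L) * D z = D (n : L) - z * D ((d : B) : L) := by rw [← h2]; ring
    rw [h3, h4]
    refine (v.map_sub _ _).trans (max_le (hDB n) ?_)
    rw [map_mul]
    exact (mul_le_of_le_one_left' hz).trans (hDB d)
  obtain ⟨π, hπ⟩ := 𝔭.valuation_exists_uniformizer L
  have hπ' : v π = exp (-1 : ℤ) := hπ
  have hπ0 : π ≠ 0 := by
    rintro rfl; rw [map_zero] at hπ'; exact exp_ne_zero hπ'.symm
  refine ⟨max (v (D π / π)) γ, fun z => ?_⟩
  by_cases hz : z = 0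
  · simp [hz]
  have hvz : v z ≠ 0 := by simpa using hz
  rw [← div_le_iff₀ (zero_lt_iff.2 hvz), ← map_div₀]
  set n : ℤ := log (v z)
  set w := z * π ^ n with hw
  have hw1 : v w = 1 := by
    rw [hw, map_mul, map_zpow₀, hπ', ← exp_zsmul, ← exp_log hvz]
    change exp n * exp (n • (-1)) = 1
    rw [← exp_add]; simp
  have hw0 : w ≠ 0 := by intro h0; rw [h0] at hw1; simp at hw1
  have hzw : z = w * (π ^ n)⁻¹ := by
    rw [hw, mul_assoc, mul_inv_cancel₀ (zpow_ne_zero _ hπ0), mul_one]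
  have h5 : D z / z = D w / w + -(n * (D π / π)) := by
    conv_lhs => rw [hzw]
    rw [ld_mul D hw0 (inv_ne_zero (zpow_ne_zero _ hπ0)), ld_inv D (zpow_ne_zero _ hπ0),
      ld_zpow D hπ0]
  rw [h5]
  refine (v.map_add _ _).trans (max_le ?_ ?_)
  · rw [map_div₀, hw1, div_one]
    exact (hDO w hw1.le).trans (le_max_right _ _)
  · rw [Valuation.map_neg, map_mul]
    refine (mul_le_of_le_one_left' ?_).trans (le_max_left _ _)
    simpa using hm (n : k)

end Place

section Alg
open IntermediateField

theorem thmA {k L : Type*} [Field k] [Field L] [Algebra k L] [CharZero k]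
    (D : Derivation ℤ L L)
    (hk : ∀ c : k, ∃ c' : k, D (algebraMap k L c) = algebraMap k L c')
    (hfin : ∀ x : L, Transcendental k x → FiniteDimensional k⟮x⟯ L)
    {f : L} (hj : JEq D f) (hDf : D f ≠ 0) : IsAlgebraic k f := by
  by_contra hf
  have : CharZero L := charZero_of_injective_algebraMap (algebraMap k L).injective
  have hf0 : f ≠ 0 := by
    rintro rfl
    exact hf isAlgebraic_zero
  have hh : IsAlgebraic k (D f / f) := by
    by_contra hh
    have hx : Transcendental k (D f / f)⁻¹ := fun h => hh (by simpa using h.inv)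
    have := hfin _ hx
    obtain ⟨v, hv, h1⟩ := exists_place (D := D) hk hx
    refine hv.main hj ?_
    rw [map_inv₀] at h1
    by_contra! h2
    have h0 : v (D f / f) ≠ 0 := by
      rw [Valuation.ne_zero_iff]
      exact div_ne_zero hDf hf0
    have := (inv_lt_one₀ (zero_lt_iff.2 h0)).1 h1
    exact absurd h2 (not_le.2 this)
  have hx : Transcendental k (f - 1728) := by
    intro h
    apply hf
    have := h.add (isAlgebraic_algebraMap (A := L) (1728 : k))
    rwa [map_ofNat, sub_add_cancel] at this
  have := hfin _ hx
  obtain ⟨v, hv, h1⟩ := exists_place (D := D) hk hx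
  refine hv.case_1728 hj h1 ?_
  have hfv : v f = 1 := by
    have hr : Res v f 1728 := by
      simpa [Res] using h1
    exact hv.res_eq_one hr (by norm_num)
  have hhv := hv.alg _ hh (div_ne_zero hDf hf0)
  have hDv : v (D f) = 1 := by
    rw [map_div₀, hfv, div_one] at hhv
    exact hhv
  rw [map_div₀, hDv, one_div]
  have h0 : v (f - 1728) ≠ 0 := by
    rw [Valuation.ne_zero_iff]
    rintro h
    exact hx (h ▸ isAlgebraic_zero)
  exact (one_lt_inv₀ (zero_lt_iff.2 h0)).2 h1

open scoped IntermediateField.algebraAdjoinAdjoin in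
theorem finite_of_trdeg_one {k L : Type*} [Field k] [Field L] [Algebra k L]
    [Algebra.EssFiniteType k L] {y : L} (hy : Transcendental k y)
    (hL : Algebra.IsAlgebraic k⟮y⟯ L) {x : L} (hx : Transcendental k x) :
    FiniteDimensional k⟮x⟯ L := by
  have h1 : IsTranscendenceBasis k (fun _ : Unit => y) := by
    rw [AlgebraicIndependent.isTranscendenceBasis_iff_isAlgebraic
      ((algebraicIndependent_unique_type_iff).2 hy)]
    rw [Set.range_const]
    exact (IsFractionRing.comap_isAlgebraic_iff (A := Algebra.adjoin k {y}) (K := k⟮y⟯)).2 hL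
  have h2 : IsTranscendenceBasis k (fun _ : Unit => x) := by
    refine AlgebraicIndependent.isTranscendenceBasis_of_lift_trdeg_le_of_finite
      ((algebraicIndependent_unique_type_iff).2 hx) ?_
    rw [← h1.lift_cardinalMk_eq_trdeg]
  have h3 := h2.isAlgebraic
  rw [Set.range_const] at h3
  have : Algebra.IsAlgebraic k⟮x⟯ L := 
    (IsFractionRing.comap_isAlgebraic_iff (A := Algebra.adjoin k {x}) (K := k⟮x⟯)).1 h3
  have : Algebra.EssFiniteType k⟮x⟯ L := Algebra.EssFiniteType.of_comp k _ _
  exact Algebra.finite_of_essFiniteType_of_isAlgebraic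

theorem D_adjoin {k M : Type*} [Field k] [Field M] [Algebra k M] (D : Derivation ℤ M M)
    (K : IntermediateField k M) {S : Set M}
    (hk : ∀ c : k, D (algebraMap k M c) ∈ K)
    (hSK : adjoin k S ≤ K)
    (hS : ∀ s ∈ S, D s ∈ K) {x : M} (hx : x ∈ adjoin k S) : D x ∈ K := by
  induction hx using IntermediateField.adjoin_induction with
  | mem x hx => exact hS x hx
  | algebraMap x => exact hk x
  | add x y hx hy h1 h2 => rw [map_add]; exact add_mem h1 h2
  | inv x hx h1 =>
    by_cases h0 : x = 0
    · simp [h0]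
    · have : D x⁻¹ = - (x⁻¹ * x⁻¹ * D x) := by
        have h := D.leibniz x x⁻¹
        rw [mul_inv_cancel₀ h0, D.map_one_eq_zero] at h
        simp only [smul_eq_mul] at h
        field_simp at h ⊢
        linear_combination -h
      rw [this]
      exact neg_mem (mul_mem (mul_mem (inv_mem (hSK hx)) (inv_mem (hSK hx))) h1)
  | mul x y hx hy h1 h2 =>
    rw [D.leibniz, smul_eq_mul, smul_eq_mul]
    exact add_mem (mul_mem (hSK hx) h2) (mul_mem (hSK hy) h1)

theorem D_alg {k M : Type*} [Field k] [Field M] [Algebra k M] [CharZero k] (D : Derivation ℤ M M)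
    (K L : IntermediateField k M) (hKL : K ≤ L) (hK : ∀ x ∈ K, D x ∈ L) {f : M} (hfL : f ∈ L)
    (hf : IsAlgebraic K f) : D f ∈ L := by
  have hInt := hf.isIntegral
  set p := minpoly K f with hp
  have key : ∀ q : K[X], D (aeval f q) - aeval f (derivative q) * D f ∈ L := by
    intro q
    induction q using Polynomial.induction_on' with
    | add q r hq hr =>
      have := add_mem hq hr
      convert this using 1
      simp only [map_add, add_mul]; ring
    | monomial n a =>
      rw [aeval_monomial, derivative_monomial, aeval_monomial, D.leibniz, D.leibniz_pow]
      have : (algebraMap K M a • n • f ^ (n - 1) • D f + f ^ n • D (algebraMap K M a)) -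
        algebraMap K M (a * n) * f ^ (n - 1) * D f = f ^ n * D (a : M) := by
        simp only [smul_eq_mul, nsmul_eq_mul, map_mul, map_natCast]
        change _ + f ^ n * D (a : M) - _ = _
        ring
      rw [this]
      exact mul_mem (pow_mem hfL n) (hK _ a.2)
  have h := key p
  rw [minpoly.aeval, map_zero, zero_sub] at h
  have hne : aeval f (derivative p) ≠ 0 := (minpoly.irreducible hInt).separable.aeval_derivative_ne_zero (minpoly.aeval K f)
  have hmem : aeval f (derivative p) ∈ L := by
    rw [aeval_eq_sum_range]
    refine sum_mem fun i _ => ?_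
    rw [Algebra.smul_def]
    exact mul_mem (hKL (Subtype.mem _)) (pow_mem hfL i)
  have := mul_mem (inv_mem hmem) (neg_mem h)
  rwa [neg_neg, inv_mul_cancel_left₀ hne] at this

/-- restriction of a derivation to an intermediate field -/
noncomputable def restrD {k M : Type*} [Field k] [Field M] [Algebra k M] (D : Derivation ℤ M M)
    (L : IntermediateField k M) (hL : ∀ x ∈ L, D x ∈ L) : Derivation ℤ L L :=
  Derivation.mk'
    (AddMonoidHom.toIntLinearMap
      { toFun := fun x => (⟨D x, hL x x.2⟩ : L)
        map_zero' := by ext; simp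
        map_add' := fun x y => by ext; simp })
    (fun x y => by
      apply Subtype.ext
      change D ((x : M) * y) = (x : M) * D y + y * D x
      simp [D.leibniz])

theorem thmB {k M : Type*} [Field k] [Field M] [Algebra k M] [CharZero k]
    (D : Derivation ℤ M M)
    (hk : ∀ c : k, ∃ c' : k, D (algebraMap k M c) = algebraMap k M c')
    {f y : M} (hy : D y ∈ k⟮y⟯) (hj : JEq D f) (hDf : D f ≠ 0)
    (hf : IsAlgebraic k⟮y⟯ f) : IsAlgebraic k f := by
  by_cases hyt : IsAlgebraic k y
  · have := isAlgebraic_adjoin_simple hyt.isIntegral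
    exact hf.restrictScalars k
  have hk' (K : IntermediateField k M) (c : k) : D (algebraMap k M c) ∈ K := by
    obtain ⟨c', h⟩ := hk c
    rw [h]; exact K.algebraMap_mem c'
  set L : IntermediateField k M := adjoin k {y, f} with hLdef
  have hyL : y ∈ L := subset_adjoin _ _ (by simp)
  have hfL : f ∈ L := subset_adjoin _ _ (by simp)
  have hKL : k⟮y⟯ ≤ L := adjoin_simple_le_iff.2 hyL
  have hDK : ∀ x ∈ k⟮y⟯, D x ∈ k⟮y⟯ := fun x hx =>
    D_adjoin D _ (hk' _) le_rfl (by rintro s rfl; exact hy) hx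
  have hDfL : D f ∈ L := D_alg D k⟮y⟯ L hKL (fun x hx => hKL (hDK x hx)) hfL hf
  have hDL : ∀ x ∈ L, D x ∈ L := fun x hx =>
    D_adjoin D _ (hk' _) le_rfl (by
      rintro s (rfl | rfl)
      · exact hKL hy
      · exact hDfL) hx
  let f' : L := ⟨f, hfL⟩
  let y' : L := ⟨y, hyL⟩
  have hess : Algebra.EssFiniteType k L := by
    rw [essFiniteType_iff]
    exact fg_adjoin_of_finite (by simp)
  have hy't : Transcendental k y' := fun h => hyt (h.algebraMap (A := M))
  have halg : Algebra.IsAlgebraic k⟮y'⟯ L := by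
    have hall : ∀ x ∈ L, IsAlgebraic k⟮y⟯ x := by
      intro x hx
      induction hx using IntermediateField.adjoin_induction with
      | mem x hx =>
        rcases hx with rfl | rfl
        · exact isAlgebraic_algebraMap (A := M) (⟨x, mem_adjoin_simple_self k x⟩ : k⟮x⟯)
        · exact hf
      | algebraMap x =>
        exact isAlgebraic_algebraMap (A := M) (algebraMap k k⟮y⟯ x)
      | add x y hx hy h1 h2 => exact h1.add h2
      | inv x hx h1 => exact h1.inv
      | mul x y hx hy h1 h2 => exact h1.mul h2
    have hlift : lift k⟮y'⟯ = k⟮y⟯ := lift_adjoin_simple k L y'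
    let e : k⟮y'⟯ ≃ₐ[k] k⟮y⟯ := (liftAlgEquiv k⟮y'⟯).trans (equivOfEq hlift)
    refine ⟨fun x => ?_⟩
    refine IsAlgebraic.of_ringHom_of_comp_eq (e : k⟮y'⟯ →+* k⟮y⟯) (algebraMap L M)
      (hall x x.2) e.surjective (algebraMap L M).injective ?_
    rfl
  have := thmA (restrD D L hDL) (f := f') (fun c => by
      obtain ⟨c', h⟩ := hk c
      exact ⟨c', Subtype.ext h⟩)
    (fun x hx => finite_of_trdeg_one hy't halg hx) (Subtype.ext hj)
    (fun h => hDf (congrArg Subtype.val h))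
  exact this.algebraMap (A := M)

theorem thmC {k M : Type*} [Field k] [IsAlgClosed k] [Field M] [Algebra k M] [CharZero k]
    (D : Derivation ℤ M M)
    (hk : ∀ c : k, D (algebraMap k M c) = 0)
    {f : M} (hj : JEq D f) (hDf : D f ≠ 0) (G : ℕ → M) (n : ℕ)
    (hG : ∀ i < n, D (G i) ∈ adjoin k (G '' Set.Iio (i + 1))) (m : ℕ) (hm : m ≤ n) :
    (∀ x ∈ adjoin k (G '' Set.Iio m), D x ∈ adjoin k (G '' Set.Iio m)) ∧
      ¬ IsAlgebraic (adjoin k (G '' Set.Iio m)) f := by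
  have hk' (K : IntermediateField k M) (c : k) : D (algebraMap k M c) ∈ K := by
    rw [hk]; exact zero_mem K
  have h1 : ∀ m ≤ n, ∀ x ∈ adjoin k (G '' Set.Iio m), D x ∈ adjoin k (G '' Set.Iio m) := by
    intro m hm x hx
    refine D_adjoin D _ (hk' _) le_rfl ?_ hx
    rintro _ ⟨i, hi, rfl⟩
    have hi' : i < m := hi
    exact adjoin.mono _ _ _ (Set.image_mono (fun j (hj : j < i + 1) => show j < m by omega))
      (hG i (by omega))
  refine ⟨h1 m hm, ?_⟩
  induction m with
  | zero =>
    intro h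
    have h0 : G '' Set.Iio 0 = ∅ := by simp
    rw [h0, adjoin_empty] at h
    have h2 : IsAlgebraic k f := h.restrictScalars k
    have := isAlgebraic_adjoin_simple h2.isIntegral
    obtain ⟨c, hc⟩ := (IsAlgClosed.algebraMap_bijective_of_isIntegral (k := k) (K := k⟮f⟯)).2
      ⟨f, mem_adjoin_simple_self k f⟩
    have hc' : algebraMap k M c = f := congrArg Subtype.val hc
    exact hDf (by rw [← hc', hk])
  | succ m ih =>
    intro h
    apply ih (by omega)
    have hins : G '' Set.Iio (m + 1) = G '' Set.Iio m ∪ {G m} := by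
      have : Set.Iio (m + 1) = Set.Iio m ∪ {m} := by
        ext j; simp; try omega
      rw [this, Set.image_union, Set.image_singleton]
    have hDm := hG m (by omega)
    rw [hins, ← adjoin_adjoin_left] at h hDm
    refine thmB D (fun c => ⟨⟨D c, h1 m (by omega) c c.2⟩, rfl⟩) (y := G m) hDm hj hDf h

end Alg

section Conc

theorem exists_derivation_frac {A M : Type*} [CommRing A] [IsDomain A] [Field M] [Algebra A M]
    [IsFractionRing A M] (d : Derivation ℤ A A) :
    ∃ D : Derivation ℤ M M, ∀ a, D (algebraMap A M a) = algebraMap A M (d a) := by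
  let φ : A →+* TrivSqZeroExt M M :=
    { toFun := fun a => TrivSqZeroExt.inl (algebraMap A M a) + TrivSqZeroExt.inr (algebraMap A M (d a))
      map_one' := by ext <;> simp
      map_zero' := by ext <;> simp
      map_mul' := fun a b => by
        ext
        · simp
        · simp only [Derivation.leibniz, smul_eq_mul, map_add, map_mul, TrivSqZeroExt.snd_add,
            TrivSqZeroExt.snd_inl, TrivSqZeroExt.snd_inr, TrivSqZeroExt.snd_mul,
            TrivSqZeroExt.fst_add, TrivSqZeroExt.fst_inl, TrivSqZeroExt.fst_inr,
            MulOpposite.op_add, MulOpposite.smul_eq_mul_unop, MulOpposite.unop_op,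
            MulOpposite.unop_add, MulOpposite.op_zero, MulOpposite.unop_zero]
          ring
      map_add' := fun a b => by ext <;> simp [Algebra.smul_def] }
  have hφ : ∀ y : nonZeroDivisors A, IsUnit (φ y) := by
    intro y
    rw [TrivSqZeroExt.isUnit_iff_isUnit_fst]
    simp [φ]
  let Φ : M →+* TrivSqZeroExt M M := IsLocalization.lift (M := nonZeroDivisors A) hφ
  have hΦ : ∀ a, Φ (algebraMap A M a) = φ a := fun a => IsLocalization.lift_eq hφ a
  have hfst : ∀ x, (Φ x).fst = x := by
    have : ((TrivSqZeroExt.fstHom M M M : TrivSqZeroExt M M →+* M).comp Φ) = RingHom.id M := by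
      apply IsLocalization.ringHom_ext (nonZeroDivisors A)
      ext a
      simp [hΦ, φ]
    exact fun x => DFunLike.congr_fun this x
  refine ⟨Derivation.mk' (AddMonoidHom.toIntLinearMap
      { toFun := fun x => (Φ x).snd
        map_zero' := by simp
        map_add' := fun x y => by simp }) ?_, ?_⟩
  · intro x y
    change (Φ (x * y)).snd = x * (Φ y).snd + y * (Φ x).snd
    simp only [map_mul, TrivSqZeroExt.snd_mul, hfst, smul_eq_mul,
      MulOpposite.smul_eq_mul_unop, MulOpposite.unop_op]
    ring
  · intro a
    change (Φ _).snd = _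
    rw [hΦ]
    change TrivSqZeroExt.snd (TrivSqZeroExt.inl (algebraMap A M a)
      + TrivSqZeroExt.inr (algebraMap A M (d a))) = _
    rw [TrivSqZeroExt.snd_add, TrivSqZeroExt.snd_inl, TrivSqZeroExt.snd_inr, zero_add]

/-- holomorphic functions on `V` -/
def Hol (V : Set ℂ) : Subalgebra ℂ (V → ℂ) where
  carrier := {g | ∃ G : ℂ → ℂ, DifferentiableOn ℂ G V ∧ ∀ z : V, G z = g z}
  mul_mem' := by
    rintro _ _ ⟨G, h, e⟩ ⟨G', h', e'⟩
    exact ⟨G * G', h.mul h', fun z => by simp [e, e']⟩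
  add_mem' := by
    rintro _ _ ⟨G, h, e⟩ ⟨G', h', e'⟩
    exact ⟨G + G', h.add h', fun z => by simp [e, e']⟩
  algebraMap_mem' := fun c => ⟨fun _ => c, differentiableOn_const c, fun z => rfl⟩

/-- the class of a holomorphic function -/
def toHol (V : Set ℂ) (G : ℂ → ℂ) (h : DifferentiableOn ℂ G V) : Hol V :=
  ⟨fun z => G z, G, h, fun _ => rfl⟩

theorem toHol_surj {V : Set ℂ} (g : Hol V) : ∃ G, ∃ h, toHol V G h = g := by
  obtain ⟨g, G, h, e⟩ := g
  exact ⟨G, h, Subtype.ext (funext e)⟩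

theorem hol_domain {V : Set ℂ} (hVo : IsOpen V) (hVc : IsPreconnected V) (hne : V.Nonempty) :
    IsDomain (Hol V) := by
  obtain ⟨z₀, hz₀⟩ := hne
  have : Nontrivial (Hol V) := ⟨0, 1, fun h => by
    have := congrFun (congrArg Subtype.val h) ⟨z₀, hz₀⟩
    exact zero_ne_one this⟩
  have : NoZeroDivisors (Hol V) := ⟨by
    intro a b hab
    obtain ⟨G, h, rfl⟩ := toHol_surj a
    obtain ⟨G', h', rfl⟩ := toHol_surj b
    have hG := h.analyticOnNhd hVo
    have hG' := h'.analyticOnNhd hVo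
    have := AnalyticOnNhd.eq_zero_or_eq_zero_of_mul_eq_zero hG hG' (fun z hz =>
      congrFun (congrArg Subtype.val hab) ⟨z, hz⟩) hVc
    rcases this with h1 | h1
    · left; exact Subtype.ext (funext fun z => h1 z z.2)
    · right; exact Subtype.ext (funext fun z => h1 z z.2)⟩
  exact NoZeroDivisors.to_isDomain _

theorem exists_derivation_hol {V : Set ℂ} (hVo : IsOpen V) :
    ∃ d : Derivation ℤ (Hol V) (Hol V), ∀ G h,
      d (toHol V G h) = toHol V (deriv G) (h.deriv hVo) := by
  choose G hG eG using (toHol_surj (V := V))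
  have key : ∀ F h (g : Hol V), toHol V F h = g →
      toHol V (deriv (G g)) ((hG g).deriv hVo) = toHol V (deriv F) (h.deriv hVo) := by
    rintro F h g hg
    apply Subtype.ext
    funext z
    change deriv (G g) z = deriv F z
    apply Filter.EventuallyEq.deriv_eq
    filter_upwards [hVo.mem_nhds z.2] with w hw
    exact congrFun (congrArg Subtype.val ((eG g).trans hg.symm)) ⟨w, hw⟩
  refine ⟨Derivation.mk' (AddMonoidHom.toIntLinearMap (AddMonoidHom.mk'
     (fun g => toHol V (deriv (G g)) ((hG g).deriv hVo)) ?_)) ?_, fun F h => key F h _ rfl⟩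
  · intro a b
    refine (key (G a + G b) ((hG a).add (hG b)) (a + b) ?_).trans ?_
    · exact congrArg₂ (· + ·) (eG a) (eG b)
    · apply Subtype.ext
      funext z
      have ha := (hG a).differentiableAt (hVo.mem_nhds z.2)
      have hb := (hG b).differentiableAt (hVo.mem_nhds z.2)
      exact deriv_add ha hb
  · intro a b
    refine (key (G a * G b) ((hG a).mul (hG b)) (a * b) ?_).trans ?_
    · exact congrArg₂ (· * ·) (eG a) (eG b)
    · apply Subtype.ext
      funext z
      have ha := (hG a).differentiableAt (hVo.mem_nhds z.2)
      have hb := (hG b).differentiableAt (hVo.mem_nhds z.2)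
      have ea : a.1 z = G a z := congrFun (congrArg Subtype.val (eG a)).symm z
      have eb : b.1 z = G b z := congrFun (congrArg Subtype.val (eG b)).symm z
      change deriv (G a * G b) z = a.1 z * deriv (G b) z + b.1 z * deriv (G a) z
      rw [deriv_mul ha hb, ea, eb]; ring

end Conc

section Final

theorem hol_aeval {V : Set ℂ} {σ : Type*} (g : σ → Hol V) (P : MvPolynomial σ ℂ) (z : V) :
    (MvPolynomial.aeval g P : Hol V).1 z = MvPolynomial.eval (fun j => (g j).1 z) P := by
  let φ : Hol V →ₐ[ℂ] ℂ := (Pi.evalAlgHom ℂ (fun _ : V => ℂ) z).comp (Hol V).val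
  have h : φ.comp (MvPolynomial.aeval g) = MvPolynomial.aeval (fun j => (g j).1 z) := by
    ext j
    simp [φ]
  exact DFunLike.congr_fun h P

theorem aeval_mem_adjoin {M σ : Type*} [Field M] [Algebra ℂ M] (E : IntermediateField ℂ M)
    (g : σ → M) (hg : ∀ j, g j ∈ E) (P : MvPolynomial σ ℂ) : MvPolynomial.aeval g P ∈ E := by
  have : MvPolynomial.aeval g P ∈ Algebra.adjoin ℂ (Set.range g) := by
    rw [Algebra.adjoin_range_eq_range_aeval]
    exact ⟨P, rfl⟩
  have hle : Algebra.adjoin ℂ (Set.range g) ≤ E.toSubalgebra :=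
    Algebra.adjoin_le (by rintro _ ⟨j, rfl⟩; exact hg j)
  exact hle this

theorem final_core (V : Set ℂ) (hVo : IsOpen V) (hVc : IsPreconnected V) (hne : V.Nonempty)
    (f : ℂ → ℂ) (hf : DifferentiableOn ℂ f V)
    (hf' : ∀ z ∈ V, deriv f z ≠ 0)
    (heq : ∀ z ∈ V,
      2 * deriv (deriv (deriv f)) z * deriv f z * f z ^ 2 * (f z - 1728) ^ 2
        - 3 * (deriv (deriv f) z) ^ 2 * f z ^ 2 * (f z - 1728) ^ 2
        + 2 * (deriv f z) ^ 4 * (f z ^ 2 - 1968 * f z + 2654208) = 0)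
    (l : ℕ) (F : Fin l → ℂ → ℂ) (hF : CPfaffianChain V F) : ¬ AlgebraicOverCChain V F f := by
  rintro ⟨n, c, ⟨k₀, hk₀⟩, hrel⟩
  obtain ⟨hFd, hFp⟩ := hF
  have := hol_domain hVo hVc hne
  let M := FractionRing (Hol V)
  let ι : Hol V →ₐ[ℂ] M := IsScalarTower.toAlgHom ℂ (Hol V) M
  have hι : Function.Injective ι := IsFractionRing.injective (Hol V) M
  obtain ⟨d, hd⟩ := exists_derivation_hol hVo
  obtain ⟨D, hD'⟩ := exists_derivation_frac (M := M) d
  have hD : ∀ a, D (ι a) = ι (d a) := hD'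
  let g : ℕ → Hol V := fun i => match i with
    | 0 => toHol V id differentiableOn_id
    | i + 1 => if h : i < l then toHol V (F ⟨i, h⟩) (hFd _) else 0
  have hg0 : g 0 = toHol V id differentiableOn_id := rfl
  have hgs : ∀ i (h : i < l), g (i + 1) = toHol V (F ⟨i, h⟩) (hFd _) := fun i h => by
    simp [g, h]
  have hcons : ∀ (m : ℕ) (hm : m ≤ l) (z : V),
      (Fin.cons (z : ℂ) fun j : Fin m => F (Fin.castLE hm j) z : Fin (m + 1) → ℂ) =
        fun j : Fin (m + 1) => (g j).1 z := by
    intro m hm z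
    funext j
    refine Fin.cases ?_ (fun j => ?_) j
    · rfl
    · rw [Fin.cons_succ, Fin.val_succ, hgs j (by omega)]
      rfl
  let fA : Hol V := toHol V f hf
  let G : ℕ → M := fun i => ι (g i)
  have hGev : ∀ (m : ℕ) (P : MvPolynomial (Fin m) ℂ),
      ι (MvPolynomial.aeval (fun j : Fin m => g j) P) =
        MvPolynomial.aeval (fun j : Fin m => G j) P := by
    intro m P
    have h : ι.comp (MvPolynomial.aeval (fun j : Fin m => g j)) =
        MvPolynomial.aeval (fun j : Fin m => G j) := by
      ext j
      simp [G]
    exact DFunLike.congr_fun h P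
  have hGmem : ∀ (m : ℕ) (P : MvPolynomial (Fin m) ℂ),
      ι (MvPolynomial.aeval (fun j : Fin m => g j) P) ∈
        IntermediateField.adjoin ℂ (G '' Set.Iio m) := by
    intro m P
    rw [hGev]
    have hmem : ∀ j : Fin m, G j ∈ IntermediateField.adjoin ℂ (G '' Set.Iio m) := fun j =>
      IntermediateField.subset_adjoin _ _ (Set.mem_image_of_mem G (Set.mem_Iio.2 j.2))
    exact aeval_mem_adjoin _ _ hmem P
  have hfd := hf.deriv hVo
  have hfdd := hfd.deriv hVo
  have hD1 : D (ι fA) = ι (toHol V (deriv f) hfd) := by rw [hD, hd]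
  have hD2 : D (D (ι fA)) = ι (toHol V (deriv (deriv f)) hfdd) := by rw [hD1, hD, hd]
  have hD3 : D (D (D (ι fA))) = ι (toHol V (deriv (deriv (deriv f))) (hfdd.deriv hVo)) := by
    rw [hD2, hD, hd]
  have hj : JEq D (ι fA) := by
    unfold JEq
    rw [hD3, hD2, hD1]
    have h0 : 2 * toHol V (deriv (deriv (deriv f))) (hfdd.deriv hVo) * toHol V (deriv f) hfd
        * fA ^ 2 * (fA - 1728) ^ 2
        - 3 * (toHol V (deriv (deriv f)) hfdd) ^ 2 * fA ^ 2 * (fA - 1728) ^ 2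
        + 2 * (toHol V (deriv f) hfd) ^ 4 * (fA ^ 2 - 1968 * fA + 2654208) = 0 :=
      Subtype.ext (funext fun z => heq z z.2)
    have := congrArg ι h0
    simpa only [map_add, map_sub, map_mul, map_pow, map_ofNat, map_zero] using this
  have hDf : D (ι fA) ≠ 0 := by
    rw [hD1, Ne, map_eq_zero_iff ι hι]
    intro h
    obtain ⟨z, hz⟩ := hne
    exact hf' z hz (congrFun (congrArg Subtype.val h) ⟨z, hz⟩)
  have hk : ∀ a : ℂ, D (algebraMap ℂ M a) = 0 := by
    intro a
    have h1 : algebraMap ℂ M a = ι (toHol V (fun _ => a) (differentiableOn_const a)) :=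
      (ι.commutes a).symm
    rw [h1, hD, hd]
    have : toHol V (deriv fun _ => a) ((differentiableOn_const a).deriv hVo) = 0 :=
      Subtype.ext (funext fun z => deriv_const (z : ℂ) a)
    rw [this, map_zero]
  have hG : ∀ i < l + 1, D (G i) ∈ IntermediateField.adjoin ℂ (G '' Set.Iio (i + 1)) := by
    intro i hi
    match i with
    | 0 =>
      have : D (G 0) = 1 := by
        change D (ι (g 0)) = 1
        rw [hg0, hD, hd]
        have : toHol V (deriv id) (differentiableOn_id.deriv hVo) = 1 :=
          Subtype.ext (funext fun z => deriv_id (z : ℂ))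
        rw [this, map_one]
      rw [this]
      exact one_mem _
    | i + 1 =>
      have hi' : i < l := by omega
      obtain ⟨p, hp⟩ := hFp ⟨i, hi'⟩
      have : D (G (i + 1)) = ι (MvPolynomial.aeval (fun j : Fin (i + 2) => g j) p) := by
        change D (ι (g (i + 1))) = _
        rw [hgs i hi', hD, hd]
        congr 1
        apply Subtype.ext
        funext z
        rw [hol_aeval, ← hcons (i + 1) hi' z]
        exact hp z z.2
      rw [this]
      exact hGmem (i + 2) p
  refine (thmC D hk hj hDf G (l + 1) hG (l + 1) le_rfl).2 ?_
  have hcons' : ∀ z : V, (Fin.cons (z : ℂ) fun j : Fin l => F j z : Fin (l + 1) → ℂ) =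
        fun j : Fin (l + 1) => (g j).1 z := fun z => hcons l le_rfl z
  let a : Fin (n + 1) → Hol V := fun k => MvPolynomial.aeval (fun j : Fin (l + 1) => g j) (c k)
  have ha : ∀ k (z : V), (a k).1 z =
      MvPolynomial.eval (Fin.cons (z : ℂ) fun j : Fin l => F j z) (c k) := fun k z => by
    rw [hcons' z]; exact hol_aeval _ _ z
  let E := IntermediateField.adjoin ℂ (G '' Set.Iio (l + 1))
  let b : Fin (n + 1) → E := fun k => ⟨ι (a k), hGmem (l + 1) (c k)⟩
  refine ⟨∑ k : Fin (n + 1), Polynomial.monomial (k : ℕ) (b k), ?_, ?_⟩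
  · intro h0
    have h1 := congrArg (fun q => Polynomial.coeff q k₀) h0
    simp only [Polynomial.finsetSum_coeff, Polynomial.coeff_monomial, Polynomial.coeff_zero] at h1
    rw [Finset.sum_eq_single k₀] at h1
    · rw [if_pos rfl] at h1
      have h2 : ι (a k₀) = 0 := congrArg Subtype.val h1
      rw [map_eq_zero_iff ι hι] at h2
      apply hk₀
      intro z hz
      rw [← ha k₀ ⟨z, hz⟩, h2]
      rfl
    · intro k _ hne
      rw [if_neg (fun h => hne (Fin.ext h))]
    · simp
  · rw [map_sum]
    have h0 : ∑ k : Fin (n + 1), a k * fA ^ (k : ℕ) = 0 := by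
      apply Subtype.ext
      funext z
      have := hrel z z.2
      rw [AddSubmonoidClass.coe_finsetSum, Finset.sum_apply]
      refine Eq.trans (Finset.sum_congr rfl fun k _ => ?_) this
      rw [← ha]
      rfl
    have h1 := congrArg ι h0
    rw [map_sum, map_zero] at h1
    refine Eq.trans (Finset.sum_congr rfl fun k _ => ?_) h1
    rw [Polynomial.aeval_monomial, map_mul, map_pow]
    rfl

end Final

end Helpers

/-- Let `V` be a connected open subset of the upper half-plane and `f`
holomorphic on `V` with `f' ≠ 0`, `f ≠ 0`, `f ≠ 1728` on `V`, satisfying the `j`-equation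
and transcendental over `ℂ(z)`.  Then `f` is not algebraic over any ℂ-Pfaffian chain on `V`;
in particular `f` is not ℂ-Pfaffian on `V`. -/
theorem statement_5 (V : Set ℂ) (hVo : IsOpen V) (hVc : IsPreconnected V)
    (hVH : ∀ z ∈ V, 0 < z.im)
    (f : ℂ → ℂ) (hf : DifferentiableOn ℂ f V)
    (hf' : ∀ z ∈ V, deriv f z ≠ 0)
    (hf0 : ∀ z ∈ V, f z ≠ 0)
    (hf1728 : ∀ z ∈ V, f z ≠ 1728)
    (heq : ∀ z ∈ V,
      2 * deriv (deriv (deriv f)) z * deriv f z * f z ^ 2 * (f z - 1728) ^ 2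
        - 3 * (deriv (deriv f) z) ^ 2 * f z ^ 2 * (f z - 1728) ^ 2
        + 2 * (deriv f z) ^ 4 * (f z ^ 2 - 1968 * f z + 2654208) = 0)
    (htr : ¬ ∃ P : MvPolynomial (Fin 2) ℂ, P ≠ 0 ∧
      ∀ z ∈ V, MvPolynomial.eval ![z, f z] P = 0) :
    (∀ (l : ℕ) (F : Fin l → ℂ → ℂ), CPfaffianChain V F → ¬ AlgebraicOverCChain V F f) ∧
      ¬ IsCPfaffian V f := by
  have hne : V.Nonempty := by
    by_contra h
    rw [Set.not_nonempty_iff_eq_empty] at h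
    exact htr ⟨1, one_ne_zero, fun z hz => by simp [h] at hz⟩
  have h1 := final_core V hVo hVc hne f hf hf' heq
  refine ⟨h1, ?_⟩
  rintro ⟨l, F, hF, p, hp⟩
  refine h1 l F hF ⟨1, ![-p, 1], ⟨1, ?_⟩, ?_⟩
  · intro h
    obtain ⟨z, hz⟩ := hne
    simpa using h z hz
  · intro z hz
    rw [Fin.sum_univ_two, hp z hz]
    simp
end
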